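/- Let r, s ≥ 1 be integers. For all a ∈ C outside some countable subset of C, the algebra A_{r,s,a} is Cohen–Macaulay, and its Hilbert series equals h_{r+1,s+1}(u) − u^{2(r+1)(s+1)}/((u;u)_{r+1}(u;u)_{s+1}), where h_{r+1,s+1}(u) = (1/(u;u)_{r+1}) · Σ_{i=0}^{s+1} u^{i(r+2)}/(u;u)_i is the Hilbert series of Λ_{r+1,s+1,a} for generic a. -/

import Mathlib

open MvPolynomial

set_option synthInstance.maxHeartbeats 1000000
set_option maxHeartbeats 1000000

noncomputable section

/-- The polynomial ring `ℂ[x, y_1,...,y_r, z_1,...,z_s]`, with `x = X (inl ())`,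
`y_j = X (inr (inl j))`, `z_l = X (inr (inr l))`. -/
abbrev Rxrs (r s : ℕ) := MvPolynomial (Unit ⊕ Fin r ⊕ Fin s) ℂ

/-- The degree-`n` homogeneous component of a graded subspace. -/
def compX (r s : ℕ) (M : Submodule ℂ (Rxrs r s)) (n : ℕ) : Submodule ℂ (Rxrs r s) :=
  M ⊓ homogeneousSubmodule (Unit ⊕ Fin r ⊕ Fin s) ℂ n

/-- The Hilbert series of a graded subspace, as a power series over `ℚ`. -/
def hilbX (r s : ℕ) (M : Submodule ℂ (Rxrs r s)) : PowerSeries ℚ :=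
  PowerSeries.mk fun n => (Module.finrank ℂ (compX r s M n) : ℚ)

/-- The `q`-Pochhammer factor `(u;u)_m = (1-u)(1-u^2)⋯(1-u^m)` as a power series. -/
def uu (m : ℕ) : PowerSeries ℚ :=
  ∏ k ∈ Finset.range m, (1 - PowerSeries.X ^ (k + 1))

/-- The generating polynomial `P_i = (a+1)x^i + a(y_1^i + ... + y_r^i) + z_1^i+...+z_s^i`. -/
def Pa (r s : ℕ) (a : ℂ) (i : ℕ) : Rxrs r s :=
  C (a + 1) * X (Sum.inl ()) ^ i + C a * ∑ j : Fin r, X (Sum.inr (Sum.inl j)) ^ i +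
    ∑ l : Fin s, X (Sum.inr (Sum.inr l)) ^ i

/-- The algebra `A_{r,s,a}` generated by the `P_i`, `i ≥ 1`. -/
def Ars (r s : ℕ) (a : ℂ) : Subalgebra ℂ (Rxrs r s) :=
  Algebra.adjoin ℂ {f : Rxrs r s | ∃ i : ℕ, 1 ≤ i ∧ f = Pa r s a i}

/-- The subalgebra `ℂ[P_1,...,P_{r+s+1}]`. -/
def BA (r s : ℕ) (a : ℂ) : Subalgebra ℂ (Rxrs r s) :=
  Algebra.adjoin ℂ {f : Rxrs r s | ∃ i : ℕ, 1 ≤ i ∧ i ≤ r + s + 1 ∧ f = Pa r s a i}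

/-- `A_{r,s,a}` viewed as a module over `ℂ[P_1,...,P_{r+s+1}]`. -/
def ArsMod (r s : ℕ) (a : ℂ) : Submodule ↥(BA r s a) (Rxrs r s) :=
  Submodule.span (BA r s a) (Ars r s a : Set (Rxrs r s))

/-- The list `l` is weakly regular modulo the ideal `I`. -/
def WReg {A : Type*} [CommRing A] : Ideal A → List A → Prop
  | _, [] => True
  | I, x :: l => (∀ f, x * f ∈ I → f ∈ I) ∧ WReg (I ⊔ Ideal.span {x}) l

section WReg
variable {A : Type*} [CommRing A]

theorem wreg_append {I : Ideal A} {l l' : List A} :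
    WReg I (l ++ l') ↔ WReg I l ∧ WReg (I ⊔ Ideal.ofList l) l' := by
  induction l generalizing I with
  | nil => simp [WReg]
  | cons x l ih =>
    simp only [List.cons_append, WReg, ih, Ideal.ofList_cons, sup_assoc, and_assoc]

/-- The last element of a weakly regular list may be replaced by any element one of whose
multiples is a power of it modulo the preceding ones. -/
theorem WReg.exchange {I : Ideal A} {l : List A} {x y : A} (h : WReg I (l ++ [x])) (k : ℕ)
    (hk : x ^ k ∈ I ⊔ Ideal.ofList l ⊔ Ideal.span {y}) : WReg I (l ++ [y]) := by
  rw [wreg_append] at h ⊢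
  refine ⟨h.1, ?_, trivial⟩
  obtain ⟨hx, -⟩ := h.2
  intro f hf
  set J := I ⊔ Ideal.ofList l
  have hpow : ∀ k, x ^ k * f ∈ J → f ∈ J := by
    intro k
    induction k with
    | zero => simp
    | succ k ih =>
      intro h
      apply ih
      apply hx
      rwa [pow_succ', mul_assoc] at h
  apply hpow k
  obtain ⟨j, hj, w, hw, e⟩ := Submodule.mem_sup.1 hk
  obtain ⟨w, rfl⟩ := Ideal.mem_span_singleton'.1 hw
  rw [← e, add_mul]
  refine J.add_mem (J.mul_mem_right _ hj) ?_
  rw [mul_assoc]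
  exact J.mul_mem_left _ hf

theorem WReg.perm {T : Set A} {P : Ideal A → Prop}
    (hP : ∀ I x, P I → x ∈ T → P (I ⊔ Ideal.span {x}))
    (hsep : ∀ I x f, P I → x ∈ T → (∀ k : ℕ, f ∈ I ⊔ Ideal.span {x ^ k}) → f ∈ I)
    {l l' : List A} (hl : l.Perm l') {I : Ideal A} (hI : P I) (hT : ∀ x ∈ l, x ∈ T)
    (h : WReg I l) : WReg I l' := by
  induction hl generalizing I with
  | nil => exact h
  | cons x _ ih =>
    exact ⟨h.1, ih (hP _ _ hI (hT _ (by simp))) (fun y hy => hT _ (by simp [hy])) h.2⟩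
  | swap x y l =>
    obtain ⟨hy, hx, h⟩ := h
    have hx' : ∀ f, x * f ∈ I → f ∈ I := by
      intro f hf
      apply hsep I y f hI (hT _ (by simp))
      intro k
      have key : ∀ k : ℕ, ∃ g, x * g ∈ I ∧ f - y ^ k * g ∈ I := by
        intro k
        induction k with
        | zero => exact ⟨f, hf, by simp⟩
        | succ k ih =>
          obtain ⟨g, hg, hg'⟩ := ih
          obtain ⟨i, hi, w, hw, e⟩ := Submodule.mem_sup.1 (hx g (Ideal.mem_sup_left hg))
          obtain ⟨w, rfl⟩ := Ideal.mem_span_singleton'.1 hw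
          refine ⟨w, hy _ ?_, ?_⟩
          · have : y * (x * w) = x * g - x * i := by rw [← e]; ring
            rw [this]
            exact I.sub_mem hg (I.mul_mem_left _ hi)
          · have : f - y ^ (k + 1) * w = (f - y ^ k * g) + y ^ k * i := by rw [← e]; ring
            rw [this]
            exact I.add_mem hg' (I.mul_mem_left _ hi)
      obtain ⟨g, -, hg⟩ := key k
      have : f = (f - y ^ k * g) + y ^ k * g := by ring
      rw [this]
      exact Ideal.add_mem _ (Ideal.mem_sup_left hg)
        (Ideal.mem_sup_right (Ideal.mul_mem_right _ _ (Ideal.mem_span_singleton_self _)))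
    refine ⟨hx', ?_, by rwa [sup_right_comm]⟩
    intro f hf
    obtain ⟨i, hi, w, hw, e⟩ := Submodule.mem_sup.1 hf
    obtain ⟨w, rfl⟩ := Ideal.mem_span_singleton'.1 hw
    have hw : w ∈ I ⊔ Ideal.span {y} := by
      apply hx
      have : x * w = y * f - i := by rw [← e]; ring
      rw [this]
      exact Ideal.sub_mem _ (Ideal.mem_sup_right (Ideal.mul_mem_right _ _
        (Ideal.mem_span_singleton_self _))) (Ideal.mem_sup_left hi)
    obtain ⟨j, hj, v, hv, e'⟩ := Submodule.mem_sup.1 hw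
    obtain ⟨v, rfl⟩ := Ideal.mem_span_singleton'.1 hv
    have : f - v * x ∈ I := by
      apply hy
      have : y * (f - v * x) = i + j * x := by rw [mul_sub, ← e, ← e']; ring
      rw [this]
      exact I.add_mem hi (I.mul_mem_right _ hj)
    have e : f = (f - v * x) + v * x := by ring
    rw [e]
    exact Ideal.add_mem _ (Ideal.mem_sup_left this)
      (Ideal.mem_sup_right (Ideal.mul_mem_left _ _ (Ideal.mem_span_singleton_self _)))
  | trans h1 _ ih1 ih2 =>
    exact ih2 hI (fun x hx => hT _ (h1.mem_iff.2 hx)) (ih1 hI hT h)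

variable {k : Type*} [Field k] [Algebra k A]

/-- The family `b` is linearly independent modulo the ideal `I`. -/
def IndepMod (k : Type*) {A : Type*} [Field k] [CommRing A] [Algebra k A] (I : Ideal A)
    {ι : Type*} (b : ι → A) : Prop :=
  ∀ w : ι →₀ k, Finsupp.linearCombination k b w ∈ I → w = 0

theorem IndepMod.pow_mul {I : Ideal A} {x : A} (hx : ∀ f, x * f ∈ I → f ∈ I) {ι : Type*}
    {b : ι → A} (hb : IndepMod k (I ⊔ Ideal.span {x}) b) :
    IndepMod k I (fun p : ℕ × ι => x ^ p.1 * b p.2) := by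
  have key : ∀ (K : ℕ) (w : ℕ → ι →₀ k),
      ∑ i ∈ Finset.range K, x ^ i * Finsupp.linearCombination k b (w i) ∈ I →
      ∀ i < K, w i = 0 := by
    intro K
    induction K with
    | zero => intro w _ i hi; omega
    | succ K ih =>
      intro w hw
      have e : ∑ i ∈ Finset.range (K + 1), x ^ i * Finsupp.linearCombination k b (w i) =
          x * (∑ i ∈ Finset.range K, x ^ i * Finsupp.linearCombination k b (w (i + 1))) +
          Finsupp.linearCombination k b (w 0) := by
        rw [Finset.sum_range_succ', Finset.mul_sum]
        congr 1
        · refine Finset.sum_congr rfl fun i _ => by ring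
        · simp
      rw [e] at hw
      have h0 : w 0 = 0 := by
        apply hb
        have := Ideal.sub_mem (I ⊔ Ideal.span {x}) (Ideal.mem_sup_left hw)
          (Ideal.mem_sup_right (Ideal.mul_mem_right (∑ i ∈ Finset.range K,
            x ^ i * Finsupp.linearCombination k b (w (i + 1))) _
            (Ideal.mem_span_singleton_self x)))
        simpa using this
      rw [h0, map_zero, add_zero] at hw
      have := ih (fun i => w (i + 1)) (hx _ hw)
      intro i hi
      rcases i with _ | i
      · exact h0
      · exact this i (by omega)
  intro w hw
  obtain ⟨K, hK⟩ : ∃ K, ∀ p ∈ w.support, p.1 < K := by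
    refine ⟨w.support.sup Prod.fst + 1, fun p hp => ?_⟩
    have := Finset.le_sup (f := Prod.fst) hp
    omega
  have hcurry : Finsupp.linearCombination k (fun p : ℕ × ι => x ^ p.1 * b p.2) w =
      ∑ i ∈ Finset.range K, x ^ i * Finsupp.linearCombination k b (w.curry i) := by
    have h1 : ∀ i, x ^ i * Finsupp.linearCombination k b (w.curry i) =
        (w.curry i).sum fun j c => c • (x ^ i * b j) := by
      intro i
      rw [Finsupp.linearCombination_apply, Finsupp.sum, Finsupp.sum, Finset.mul_sum]
      simp
    simp_rw [h1]
    rw [Finsupp.linearCombination_apply,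
      ← Finsupp.sum_curry_index w (fun i j c => c • (x ^ i * b j))]
    rw [Finsupp.sum]
    apply Finset.sum_subset
    · intro i hi
      rw [Finsupp.mem_support_iff] at hi
      obtain ⟨j, hj⟩ := Finsupp.ne_iff.1 hi
      simp only [Finsupp.curry_apply, Finsupp.coe_zero, Pi.zero_apply] at hj
      exact Finset.mem_range.2 (hK (i, j) (Finsupp.mem_support_iff.2 hj))
    · intro i _ hi
      rw [Finsupp.notMem_support_iff] at hi
      simp [hi]
  rw [hcurry] at hw
  have := key K (fun i => w.curry i) hw
  ext ⟨i, j⟩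
  by_cases hi : i < K
  · have := DFunLike.congr_fun (this i hi) j
    simpa using this
  · by_contra hne
    exact hi (hK _ (Finsupp.mem_support_iff.2 hne))

theorem IndepMod.comp {I : Ideal A} {ι ι' : Type*} {b : ι → A} (hb : IndepMod k I b)
    (e : ι' → ι) (he : Function.Injective e) : IndepMod k I (b ∘ e) := by
  intro w hw
  have := hb (w.mapDomain e) (by rwa [Finsupp.linearCombination_mapDomain])
  exact (Finsupp.mapDomain_injective he) (by simpa using this)

theorem WReg.indepMod {N : ℕ} {I : Ideal A} {θ : Fin N → A} (h : WReg I (List.ofFn θ))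
    {ι : Type*} {b : ι → A} (hb : IndepMod k (I ⊔ Ideal.ofList (List.ofFn θ)) b) :
    IndepMod k I (fun p : (Fin N → ℕ) × ι => (∏ i, θ i ^ p.1 i) * b p.2) := by
  induction N generalizing I with
  | zero =>
    simp only [Finset.univ_eq_empty, Finset.prod_empty, one_mul]
    simp only [List.ofFn_zero, Ideal.ofList_nil, sup_bot_eq] at hb
    exact hb.comp Prod.snd (fun p q h => Prod.ext (Subsingleton.elim _ _) h)
  | succ N ih =>
    rw [List.ofFn_succ] at h hb
    rw [Ideal.ofList_cons, ← sup_assoc] at hb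
    have h1 := (ih h.2 hb).pow_mul h.1
    have h2 := h1.comp (fun p : (Fin (N + 1) → ℕ) × ι => (p.1 0, (fun i => p.1 i.succ), p.2))
      (by
        rintro ⟨p, i⟩ ⟨q, j⟩ h
        simp only [Prod.mk.injEq] at h
        refine Prod.ext (funext fun i => ?_) h.2.2
        refine Fin.cases h.1 (fun i => congrFun h.2.1 i) i)
    convert h2 using 1
    funext p
    simp [Fin.prod_univ_succ, mul_assoc]

end WReg

section Gap
variable {σ : Type*}

theorem homogeneousComponent_add_mul {w x : MvPolynomial σ ℂ} {d : ℕ} (hx : x.IsHomogeneous d)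
    (k : ℕ) : homogeneousComponent (k + d) (w * x) = homogeneousComponent k w * x := by
  conv_lhs => rw [← sum_homogeneousComponent w, Finset.sum_mul, map_sum]
  have h : ∀ i, homogeneousComponent (k + d) (homogeneousComponent i w * x) =
      if i = k then homogeneousComponent i w * x else 0 := by
    intro i
    rw [homogeneousComponent_of_mem ((homogeneousComponent_isHomogeneous i w).mul hx)]
    simp [eq_comm]
  simp_rw [h, Finset.sum_ite_eq', Finset.mem_range]
  split_ifs with hk
  · rfl
  · rw [homogeneousComponent_eq_zero _ _ (by omega), zero_mul]

theorem homogeneousComponent_mul_of_lt {w x : MvPolynomial σ ℂ} {d k : ℕ}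
    (hx : x.IsHomogeneous d) (hk : k < d) : homogeneousComponent k (w * x) = 0 := by
  conv_lhs => rw [← sum_homogeneousComponent w, Finset.sum_mul, map_sum]
  refine Finset.sum_eq_zero fun i _ => ?_
  rw [homogeneousComponent_of_mem ((homogeneousComponent_isHomogeneous i w).mul hx), if_neg]
  omega

/-- The polynomials in which every variable `X i` occurs only with exponents `0` or `≥ g i`. -/
def gapAlg (g : σ → ℕ) : Subalgebra ℂ (MvPolynomial σ ℂ) where
  carrier := {f | ∀ ν ∈ f.support, ∀ i, ν i = 0 ∨ g i ≤ ν i}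
  mul_mem' := by
    classical
    intro a b ha hb ν hν i
    obtain ⟨α, hα, β, hβ, rfl⟩ := Finset.mem_add.1 (support_mul a b hν)
    have h1 := ha α hα i
    have h2 := hb β hβ i
    rw [Finsupp.add_apply]
    omega
  add_mem' := by
    classical
    intro a b ha hb ν hν i
    rcases Finset.mem_union.1 (support_add hν) with h | h
    · exact ha ν h i
    · exact hb ν h i
  algebraMap_mem' := by
    classical
    intro c ν hν i
    rw [algebraMap_eq, mem_support_iff, coeff_C] at hν
    left
    have : (0 : σ →₀ ℕ) = ν := by by_contra h; simp [h] at hν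
    simp [← this]

theorem gapAlg_of_le_one {g : σ → ℕ} (hg : ∀ i, g i ≤ 1) (f : MvPolynomial σ ℂ) :
    f ∈ gapAlg g := by
  intro ν _ i
  have := hg i
  omega

theorem homogeneousComponent_mem_gapAlg {g : σ → ℕ} {f : MvPolynomial σ ℂ} (hf : f ∈ gapAlg g)
    (d : ℕ) : homogeneousComponent d f ∈ gapAlg g := by
  intro ν hν
  rw [mem_support_iff, coeff_homogeneousComponent] at hν
  split_ifs at hν
  · exact hf ν (mem_support_iff.2 hν)
  · exact absurd rfl hν

theorem monomial_mem_gapAlg {g : σ → ℕ} {ν : σ →₀ ℕ} (c : ℂ) (h : ∀ i, ν i = 0 ∨ g i ≤ ν i) :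
    monomial ν c ∈ gapAlg g := by
  intro μ hμ
  have := support_monomial_subset hμ
  rw [Finset.mem_singleton] at this
  rwa [this]

theorem X_pow_mem_gapAlg {g : σ → ℕ} {i : σ} {k : ℕ} (hk : g i ≤ k) :
    (X i ^ k : MvPolynomial σ ℂ) ∈ gapAlg g := by
  classical
  rw [X_pow_eq_monomial]
  apply monomial_mem_gapAlg
  intro j
  rw [Finsupp.single_apply]
  split_ifs with h
  · subst h; exact Or.inr hk
  · exact Or.inl rfl

variable (g : σ → ℕ)

/-- The homogeneous components of an element of `gapAlg g`, as elements of `gapAlg g`. -/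
def gapHC (d : ℕ) (f : gapAlg g) : gapAlg g :=
  ⟨homogeneousComponent d f.1, homogeneousComponent_mem_gapAlg f.2 d⟩

/-- Homogeneity of ideals of `gapAlg g`. -/
def GapHomog (I : Ideal (gapAlg g)) : Prop := ∀ f ∈ I, ∀ d, gapHC g d f ∈ I

/-- The homogeneous elements of positive degree of `gapAlg g`. -/
def gapPos : Set (gapAlg g) := {x | ∃ d, 0 < d ∧ (x : MvPolynomial σ ℂ).IsHomogeneous d}

variable {g}

theorem GapHomog.bot : GapHomog g ⊥ := by
  intro f hf d
  rw [Ideal.mem_bot] at hf ⊢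
  subst hf
  exact Subtype.ext (by simp [gapHC])

theorem GapHomog.sup {I : Ideal (gapAlg g)} (hI : GapHomog g I) {x : gapAlg g}
    (hx : x ∈ gapPos g) : GapHomog g (I ⊔ Ideal.span {x}) := by
  intro f hf k
  obtain ⟨d, -, hd⟩ := hx
  obtain ⟨i, hi, w, hw, rfl⟩ := Submodule.mem_sup.1 hf
  obtain ⟨w, rfl⟩ := Ideal.mem_span_singleton'.1 hw
  have e : gapHC g k (i + w * x) = gapHC g k i + gapHC g k (w * x) :=
    Subtype.ext (by simp [gapHC])
  rw [e]
  refine Ideal.add_mem _ (Ideal.mem_sup_left (hI i hi k)) (Ideal.mem_sup_right ?_)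
  rcases lt_or_ge k d with hk | hk
  · have : gapHC g k (w * x) = 0 := Subtype.ext (homogeneousComponent_mul_of_lt hd hk)
    rw [this]; exact Ideal.zero_mem _
  · obtain ⟨k, rfl⟩ := Nat.exists_eq_add_of_le' hk
    have : gapHC g (k + d) (w * x) = gapHC g k w * x :=
      Subtype.ext (homogeneousComponent_add_mul hd k)
    rw [this]; exact Ideal.mul_mem_left _ _ (Ideal.mem_span_singleton_self _)

theorem GapHomog.ofList {l : List (gapAlg g)} : ∀ {I : Ideal (gapAlg g)}, GapHomog g I →
    (∀ x ∈ l, x ∈ gapPos g) → GapHomog g (I ⊔ Ideal.ofList l) := by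
  induction l with
  | nil => intro I hI _; simpa using hI
  | cons x l ih =>
    intro I hI hl
    rw [Ideal.ofList_cons, ← sup_assoc]
    exact ih (hI.sup (hl x (by simp))) (fun y hy => hl y (by simp [hy]))

theorem sum_gapHC (f : gapAlg g) :
    f = ∑ j ∈ Finset.range (f.1.totalDegree + 1), gapHC g j f := by
  apply Subtype.ext
  rw [AddSubmonoidClass.coe_finsetSum]
  exact (sum_homogeneousComponent f.1).symm

theorem GapHomog.mem_of_forall {I : Ideal (gapAlg g)} (hI : GapHomog g I) {x f : gapAlg g}
    (hx : x ∈ gapPos g) (hf : ∀ k : ℕ, f ∈ I ⊔ Ideal.span {x ^ k}) : f ∈ I := by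
  obtain ⟨d, hd0, hd⟩ := hx
  obtain ⟨i, hi, w, hw, e⟩ := Submodule.mem_sup.1 (hf (f.1.totalDegree + 1))
  obtain ⟨w, rfl⟩ := Ideal.mem_span_singleton'.1 hw
  rw [sum_gapHC f]
  refine I.sum_mem fun j hj => ?_
  rw [Finset.mem_range] at hj
  have : gapHC g j f = gapHC g j i := by
    apply Subtype.ext
    change homogeneousComponent j f.1 = homogeneousComponent j i.1
    have e' : f.1 = i.1 + w.1 * x.1 ^ (f.1.totalDegree + 1) := by
      have := congrArg Subtype.val e
      rw [Subalgebra.coe_add, Subalgebra.coe_mul, Subalgebra.coe_pow] at this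
      exact this.symm
    conv_lhs => rw [e']
    rw [map_add, homogeneousComponent_mul_of_lt (hd.pow _) (by nlinarith), add_zero]
  rw [this]
  exact hI i hi j

theorem WReg.gap_perm {l l' : List (gapAlg g)} (hl : l.Perm l') {I : Ideal (gapAlg g)}
    (hI : GapHomog g I) (hT : ∀ x ∈ l, x ∈ gapPos g) (h : WReg I l) : WReg I l' :=
  WReg.perm (T := gapPos g) (P := GapHomog g) (fun _ _ hI hx => hI.sup hx)
    (fun _ _ _ hI hx hf => hI.mem_of_forall hx hf) hl hI hT h

/-- The power `X i ^ g i` as an element of `gapAlg g`. -/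
def gapX (g : σ → ℕ) (i : σ) : gapAlg g := ⟨X i ^ g i, X_pow_mem_gapAlg le_rfl⟩

theorem gapX_mem_gapPos {i : σ} (hi : 0 < g i) : gapX g i ∈ gapPos g :=
  ⟨g i, hi, isHomogeneous_X_pow i (g i)⟩

/-- The monomial ideal generated by the `X j ^ g j` with `j ∈ s`. -/
def gapIdeal (g : σ → ℕ) (s : Set σ) : Ideal (gapAlg g) where
  carrier := {f | ∀ ν ∈ f.1.support, ∃ j ∈ s, ν j = g j ∨ 2 * g j ≤ ν j}
  zero_mem' := by intro ν hν; simp at hν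
  add_mem' := by
    classical
    intro a b ha hb ν hν
    rcases Finset.mem_union.1 (support_add hν) with h | h
    · exact ha ν h
    · exact hb ν h
  smul_mem' := by
    classical
    intro a b hb ν hν
    obtain ⟨α, hα, β, hβ, rfl⟩ := Finset.mem_add.1 (support_mul a.1 b.1 hν)
    obtain ⟨j, hj, h⟩ := hb β hβ
    refine ⟨j, hj, ?_⟩
    have h1 := a.2 α hα j
    rw [Finsupp.add_apply]
    omega

theorem gapIdeal_empty : gapIdeal g ∅ = ⊥ := by
  rw [eq_bot_iff]
  intro f hf
  rw [Ideal.mem_bot]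
  apply Subtype.ext
  change f.1 = 0
  rw [← support_eq_empty, Finset.eq_empty_iff_forall_notMem]
  intro ν hν
  obtain ⟨j, hj, -⟩ := hf ν hν
  exact hj

theorem gapIdeal_insert (s : Set σ) (i : σ) :
    gapIdeal g s ⊔ Ideal.span {gapX g i} = gapIdeal g (insert i s) := by
  classical
  apply le_antisymm
  · refine sup_le ?_ ?_
    · intro f hf ν hν
      obtain ⟨j, hj, h⟩ := hf ν hν
      exact ⟨j, Set.mem_insert_of_mem _ hj, h⟩
    · rw [Ideal.span_singleton_le_iff_mem]
      intro ν hν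
      change ν ∈ (X i ^ g i : MvPolynomial σ ℂ).support at hν
      rw [X_pow_eq_monomial] at hν
      have := support_monomial_subset hν
      rw [Finset.mem_singleton] at this
      refine ⟨i, Set.mem_insert _ _, Or.inl ?_⟩
      rw [this, Finsupp.single_eq_same]
  · intro f hf
    have e : f = ∑ ν ∈ f.1.support.attach,
        (⟨monomial ν.1 (coeff ν.1 f.1), monomial_mem_gapAlg _ (f.2 ν.1 ν.2)⟩ : gapAlg g) := by
      apply Subtype.ext
      rw [AddSubmonoidClass.coe_finsetSum]
      change f.1 = ∑ ν ∈ f.1.support.attach, monomial ν.1 (coeff ν.1 f.1)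
      rw [Finset.sum_attach f.1.support (fun ν => monomial ν (coeff ν f.1))]
      exact f.1.as_sum
    rw [e]
    refine Ideal.sum_mem _ fun ⟨ν, hν⟩ _ => ?_
    obtain ⟨j, hj, h⟩ := hf ν hν
    rcases Set.mem_insert_iff.1 hj with rfl | hj
    · apply Ideal.mem_sup_right
      rw [Ideal.mem_span_singleton']
      refine ⟨⟨monomial (ν - Finsupp.single j (g j)) (coeff ν f.1), ?_⟩, ?_⟩
      · apply monomial_mem_gapAlg
        intro k
        have := f.2 ν hν k
        rw [Finsupp.tsub_apply, Finsupp.single_apply]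
        split_ifs with hk
        · subst hk; omega
        · simpa using this
      · apply Subtype.ext
        change monomial (ν - Finsupp.single j (g j)) (coeff ν f.1) * X j ^ g j = _
        rw [X_pow_eq_monomial, monomial_mul, mul_one, tsub_add_cancel_of_le]
        rw [Finsupp.single_le_iff]
        omega
    · apply Ideal.mem_sup_left
      intro μ hμ
      have := support_monomial_subset hμ
      rw [Finset.mem_singleton] at this
      subst this
      exact ⟨j, hj, h⟩

theorem gapX_regular {s : Set σ} {i : σ} (hi : i ∉ s) (f : gapAlg g)
    (h : gapX g i * f ∈ gapIdeal g s) : f ∈ gapIdeal g s := by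
  classical
  intro ν hν
  have := h (Finsupp.single i (g i) + ν) (by
    change _ ∈ (X i ^ g i * f.1).support
    rw [X_pow_eq_monomial, mem_support_iff, coeff_monomial_mul, one_mul]
    exact mem_support_iff.1 hν)
  obtain ⟨j, hj, h⟩ := this
  refine ⟨j, hj, ?_⟩
  rwa [Finsupp.add_apply, Finsupp.single_eq_of_ne, zero_add] at h
  rintro rfl
  exact hi hj

theorem wreg_gapX {l : List σ} (hl : l.Nodup) : WReg (⊥ : Ideal (gapAlg g)) (l.map (gapX g)) := by
  rw [← gapIdeal_empty]
  suffices ∀ s : Set σ, (∀ i ∈ l, i ∉ s) → WReg (gapIdeal g s) (l.map (gapX g)) from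
    this ∅ (by simp)
  induction l with
  | nil => intro s _; trivial
  | cons i l ih =>
    intro s hs
    rw [List.nodup_cons] at hl
    refine ⟨fun f hf => gapX_regular (hs i (by simp)) f hf, ?_⟩
    rw [gapIdeal_insert]
    refine ih hl.2 _ fun j hj => ?_
    rw [Set.mem_insert_iff, not_or]
    refine ⟨?_, hs j (by simp [hj])⟩
    rintro rfl
    exact hl.1 hj

theorem isIntegral_gapAlg (hg : ∀ i, 0 < g i) :
    Algebra.IsIntegral (gapAlg g) (MvPolynomial σ ℂ) := by
  refine ⟨fun f => ?_⟩
  have hX : ∀ i, IsIntegral (gapAlg g) (X i : MvPolynomial σ ℂ) := fun i =>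
    IsIntegral.of_pow (hg i) (isIntegral_algebraMap (x := gapX g i))
  induction f using MvPolynomial.induction_on with
  | C a => exact isIntegral_algebraMap (x := algebraMap ℂ (gapAlg g) a)
  | add p q hp hq => exact hp.add hq
  | mul_X p i hp => exact hp.mul (hX i)

theorem mem_radical_gapAlg [Finite σ] (hg : ∀ i, 0 < g i) (T : Set (gapAlg g)) (u : gapAlg g)
    (h : ∀ v : σ → ℂ, (∀ t ∈ T, aeval v t.1 = 0) → aeval v u.1 = 0) :
    u ∈ (Ideal.span T).radical := by
  have := isIntegral_gapAlg hg
  rw [Ideal.radical_eq_sInf, Ideal.mem_sInf]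
  rintro p ⟨hTp, hp⟩
  obtain ⟨q, -, hq, rfl⟩ := Ideal.exists_ideal_over_prime_of_isIntegral_of_isPrime
    (S := MvPolynomial σ ℂ) p ⊥ (by
      intro f hf
      rw [Ideal.mem_comap, Ideal.mem_bot] at hf
      have : f = 0 := Subtype.ext hf
      rw [this]
      exact p.zero_mem)
  have hu : u.1 ∈ (Ideal.span (Subtype.val '' T)).radical := by
    rw [← vanishingIdeal_zeroLocus_eq_radical (K := ℂ), mem_vanishingIdeal_iff]
    intro v hv
    rw [mem_zeroLocus_iff] at hv
    exact h v fun t ht => hv _ (Ideal.subset_span ⟨t, ht, rfl⟩)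
  have hle : Ideal.span (Subtype.val '' T) ≤ q := by
    rw [Ideal.span_le]
    rintro _ ⟨t, ht, rfl⟩
    exact hTp (Ideal.subset_span ht)
  exact (hq.radical_le_iff.2 hle) hu

end Gap

theorem eq_zero_of_sum_pow_eq_zero {ι : Type*} (s : Finset ι) (v : ι → ℂ) {c : ℕ} (hc : 1 ≤ c)
    (h : ∀ k < s.card, ∑ i ∈ s, v i ^ (c + k) = 0) : ∀ i ∈ s, v i = 0 := by
  classical
  by_contra! hne
  obtain ⟨i0, hi0, hv0⟩ := hne
  set T := (s.image v).erase 0 with hT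
  have ht0 : v i0 ∈ T := Finset.mem_erase.2 ⟨hv0, Finset.mem_image_of_mem _ hi0⟩
  set f : Polynomial ℂ := ∏ t ∈ T.erase (v i0), (Polynomial.X - Polynomial.C t) with hf
  have hdeg : f.natDegree < s.card := by
    rw [hf, Polynomial.natDegree_prod_of_monic _ _ (fun t _ => Polynomial.monic_X_sub_C t)]
    simp only [Polynomial.natDegree_X_sub_C, Finset.sum_const, smul_eq_mul, mul_one]
    rw [Finset.card_erase_of_mem ht0]
    have h1 : T.card ≤ s.card := (Finset.card_erase_le).trans Finset.card_image_le
    have h2 : 0 < T.card := Finset.card_pos.2 ⟨_, ht0⟩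
    omega
  have h1 : ∑ i ∈ s, v i ^ c * f.eval (v i) = 0 := by
    simp_rw [Polynomial.eval_eq_sum_range' hdeg, Finset.mul_sum]
    rw [Finset.sum_comm]
    refine Finset.sum_eq_zero fun k hk => ?_
    have := h k (Finset.mem_range.1 hk)
    calc _ = f.coeff k * ∑ i ∈ s, v i ^ (c + k) := by
          rw [Finset.mul_sum]; refine Finset.sum_congr rfl fun i _ => by rw [pow_add]; ring
      _ = 0 := by rw [this, mul_zero]
  have h2 : ∀ i ∈ s, v i ^ c * f.eval (v i) =
      if v i = v i0 then v i0 ^ c * f.eval (v i0) else 0 := by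
    intro i hi
    split_ifs with h
    · rw [h]
    · by_cases h0 : v i = 0
      · rw [h0, zero_pow (by omega), zero_mul]
      · have : f.eval (v i) = 0 := by
          rw [hf, Polynomial.eval_prod]
          refine Finset.prod_eq_zero (i := v i) ?_ (by simp)
          exact Finset.mem_erase.2 ⟨h, Finset.mem_erase.2 ⟨h0, Finset.mem_image_of_mem _ hi⟩⟩
        rw [this, mul_zero]
  rw [Finset.sum_congr rfl h2, ← Finset.sum_filter, Finset.sum_const, nsmul_eq_mul] at h1
  have hf0 : f.eval (v i0) ≠ 0 := by
    rw [hf, Polynomial.eval_prod, Finset.prod_ne_zero_iff]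
    intro t ht
    have := (Finset.mem_erase.1 ht).1
    simpa [sub_eq_zero] using this.symm
  have hcard : ((s.filter fun i => v i = v i0).card : ℂ) ≠ 0 := by
    rw [Nat.cast_ne_zero]
    exact (Finset.card_pos.2 ⟨i0, by simp [hi0]⟩).ne'
  exact (mul_ne_zero hcard (mul_ne_zero (pow_ne_zero _ hv0) hf0)) h1

section
variable {σ : Type*} [Finite σ] {g : σ → ℕ}

theorem WReg.gap_exchange (hg : ∀ i, 0 < g i) {l : List (gapAlg g)} {x y : gapAlg g}
    (h : WReg ⊥ (l ++ [x]))
    (hv : ∀ v : σ → ℂ, (∀ t ∈ l, aeval v t.1 = 0) → aeval v y.1 = 0 → aeval v x.1 = 0) :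
    WReg ⊥ (l ++ [y]) := by
  have := mem_radical_gapAlg hg {t | t ∈ l ++ [y]} x (by
    intro v hv'
    refine hv v (fun t ht => hv' t ?_) (hv' y ?_)
    · simp [ht]
    · simp)
  obtain ⟨k, hk⟩ := this
  refine h.exchange k ?_
  rw [bot_sup_eq]
  change x ^ k ∈ Ideal.ofList (l ++ [y]) at hk
  rwa [Ideal.ofList_append, Ideal.ofList_singleton] at hk

/-- A block of (powers of) variables in a regular sequence may be replaced by consecutive
power sums of these variables. -/
theorem WReg.block (hg : ∀ i, 0 < g i) {l : List (gapAlg g)} (hl : ∀ x ∈ l, x ∈ gapPos g)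
    (e : ℕ → σ) (m c : ℕ) (hc : 1 ≤ c) (p : ℕ → gapAlg g)
    (hp : ∀ k, c ≤ k → (p k : MvPolynomial σ ℂ) = ∑ i ∈ Finset.range m, X (e i) ^ k)
    (h : WReg ⊥ (l ++ (List.range m).map fun i => gapX g (e i))) :
    WReg ⊥ (l ++ (List.range m).map fun i => p (c + i)) := by
  have hppos : ∀ k, p (c + k) ∈ gapPos g := fun k =>
    ⟨c + k, by omega, by
      rw [hp _ (by omega)]
      exact IsHomogeneous.sum _ _ _ fun i _ => isHomogeneous_X_pow _ _⟩
  have key : ∀ q ≤ m, WReg ⊥ (l ++ ((List.range (m - q)).map fun i => gapX g (e i)) ++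
      (List.range q).map fun i => p (c + i)) := by
    intro q
    induction q with
    | zero => intro _; simpa using h
    | succ q ih =>
      intro hq
      have h1 := ih (by omega)
      obtain ⟨t, ht⟩ : ∃ t, m - q = t + 1 := ⟨m - q - 1, by omega⟩
      have ht' : m - (q + 1) = t := by omega
      rw [ht]  at h1
      rw [ht', List.range_succ, List.map_append, ← List.append_assoc, List.map_singleton]
      apply WReg.gap_exchange hg (x := gapX g (e t))
      · refine WReg.gap_perm ?_ GapHomog.bot ?_ h1
        · rw [List.range_succ, List.map_append, List.map_singleton, ← List.append_assoc,
            List.append_assoc, List.append_assoc _ _ [gapX g (e t)]]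
          exact List.Perm.append_left _ List.perm_append_comm
        · intro x hx
          simp only [List.mem_append, List.mem_map] at hx
          rcases hx with (hx | ⟨i, -, rfl⟩) | ⟨i, -, rfl⟩
          · exact hl x hx
          · exact gapX_mem_gapPos (hg _)
          · exact hppos i
      · intro v hv hy
        have hx : ∀ i < t, v (e i) = 0 := by
          intro i hi
          have := hv (gapX g (e i)) (by simp; exact Or.inr (Or.inl ⟨i, hi, rfl⟩))
          change aeval v (X (e i) ^ g (e i)) = 0 at this
          rw [map_pow, aeval_X] at this
          exact eq_zero_of_pow_eq_zero this
        have hsum : ∀ k < (Finset.Ico t m).card,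
            ∑ i ∈ Finset.Ico t m, v (e i) ^ (c + k) = 0 := by
          intro k hk
          rw [Nat.card_Ico] at hk
          have h0 : aeval v (p (c + k)).1 = 0 := by
            rcases Nat.lt_succ_iff_lt_or_eq.1 (show k < q + 1 by omega) with hk | rfl
            · exact hv _ (by simp; exact Or.inr (Or.inr ⟨k, hk, rfl⟩))
            · exact hy
          rw [hp _ (by omega), map_sum] at h0
          simp only [map_pow, aeval_X] at h0
          rw [Finset.range_eq_Ico, ← Finset.sum_Ico_consecutive _ (Nat.zero_le t) (by omega),
            Finset.sum_eq_zero (s := Finset.Ico 0 t), zero_add] at h0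
          · exact h0
          · intro i hi
            rw [hx i (Finset.mem_Ico.1 hi).2, zero_pow (by omega)]
        have := eq_zero_of_sum_pow_eq_zero _ _ hc hsum t (Finset.mem_Ico.2 ⟨le_rfl, by omega⟩)
        change aeval v (X (e t) ^ g (e t)) = 0
        rw [map_pow, aeval_X, this, zero_pow (hg _).ne']
  have := key m le_rfl
  simpa using this

end

theorem WReg.sup_conductor {A B : Type*} [CommRing A] [CommRing B] {φ : A →+* B}
    (hφ : Function.Injective φ) {x : B} (hx : ∀ b, ∃ a, φ a = x * b) {θ : List A} :
    ∀ {I : Ideal A}, WReg I θ →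
    (∀ l l', θ = l ++ l' → ∀ b, x * b ∈ (I ⊔ Ideal.ofList l).map φ →
      b ∈ (I ⊔ Ideal.ofList l).map φ) →
    WReg (I ⊔ (Ideal.span {x}).comap φ) θ := by
  induction θ with
  | nil => intros; trivial
  | cons t θ ih =>
    intro I h hreg
    refine ⟨?_, ?_⟩
    · intro f hf
      obtain ⟨i, hi, k, hk, e⟩ := Submodule.mem_sup.1 hf
      rw [Ideal.mem_comap, Ideal.mem_span_singleton'] at hk
      obtain ⟨s, hs⟩ := hk
      have hI : ∀ b ∈ I.map φ, ∃ a ∈ I, φ a = x * b := by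
        intro b hb
        refine Submodule.span_induction (p := fun b _ => ∃ a ∈ I, φ a = x * b) ?_ ?_ ?_ ?_ hb
        · rintro _ ⟨a, ha, rfl⟩
          obtain ⟨y, hy⟩ := hx 1
          exact ⟨y * a, I.mul_mem_left _ ha, by rw [map_mul, hy]; ring⟩
        · exact ⟨0, I.zero_mem, by simp⟩
        · rintro u v - - ⟨a, ha, e⟩ ⟨a', ha', e'⟩
          exact ⟨a + a', I.add_mem ha ha', by rw [map_add, e, e', mul_add]⟩
        · rintro u v hv ⟨a, ha, e⟩
          -- multiply representatives of generators
          refine Submodule.span_induction (p := fun v _ => ∀ u, ∃ a ∈ I, φ a = x * (u * v))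
            ?_ ?_ ?_ ?_ hv u
          · rintro _ ⟨a, ha, rfl⟩ u
            obtain ⟨y, hy⟩ := hx u
            exact ⟨y * a, I.mul_mem_left _ ha, by rw [map_mul, hy]; ring⟩
          · intro u; exact ⟨0, I.zero_mem, by simp⟩
          · intro w v _ _ h1 h2 u
            obtain ⟨a, ha, e⟩ := h1 u
            obtain ⟨a', ha', e'⟩ := h2 u
            exact ⟨a + a', I.add_mem ha ha', by rw [map_add, e, e']; ring⟩
          · intro w v _ h1 u
            obtain ⟨a, ha, e⟩ := h1 (u * w)
            exact ⟨a, ha, by rw [e, smul_eq_mul]; ring⟩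
      have hs' : s ∈ (I ⊔ Ideal.ofList [t]).map φ := by
        apply hreg [t] θ rfl
        have : x * s = φ t * φ f - φ i := by
          rw [← map_mul, ← e, map_add, ← hs]; ring
        rw [this]
        refine Ideal.sub_mem _ ?_ ?_
        · refine Ideal.mul_mem_right _ _ (Ideal.mem_map_of_mem _ (Ideal.mem_sup_right ?_))
          rw [Ideal.ofList_singleton]
          exact Ideal.mem_span_singleton_self _
        · exact Ideal.mem_map_of_mem _ (Ideal.mem_sup_left hi)
      rw [Ideal.ofList_singleton, Ideal.map_sup, Ideal.map_span, Set.image_singleton] at hs'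
      obtain ⟨s0, hs0, w, hw, e'⟩ := Submodule.mem_sup.1 hs'
      obtain ⟨s1, rfl⟩ := Ideal.mem_span_singleton'.1 hw
      obtain ⟨i', hi', e0⟩ := hI s0 hs0
      obtain ⟨a1, e1⟩ := hx s1
      have h2 : f - a1 ∈ I := by
        apply h.1
        have : t * (f - a1) = i + i' := by
          apply hφ
          rw [mul_sub, ← e]
          simp only [map_sub, map_add, map_mul, ← hs, e0, e1, ← e']
          ring
        rw [this]
        exact I.add_mem hi hi'
      have : f = (f - a1) + a1 := by ring
      rw [this]
      refine Ideal.add_mem _ (Ideal.mem_sup_left h2) (Ideal.mem_sup_right ?_)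
      rw [Ideal.mem_comap, e1]
      exact Ideal.mul_mem_right _ _ (Ideal.mem_span_singleton_self _)
    · rw [sup_right_comm]
      apply ih h.2
      intro l l' hll b hb
      have := hreg (t :: l) l' (by rw [hll]; rfl)
      rw [Ideal.ofList_cons, ← sup_assoc] at this
      exact this b hb

section
variable (r s : ℕ)

/-- The polynomial ring in two blocks of variables. -/
abbrev Syz := MvPolynomial (Fin (r + 1) ⊕ Fin (s + 1)) ℂ

/-- Power sums in the first block. -/
def py (k : ℕ) : Syz r s := ∑ j : Fin (r + 1), X (Sum.inl j) ^ k

/-- Power sums in the second block. -/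
def pz (k : ℕ) : Syz r s := ∑ l : Fin (s + 1), X (Sum.inr l) ^ k

theorem isHomogeneous_py (k : ℕ) : (py r s k).IsHomogeneous k :=
  IsHomogeneous.sum _ _ _ fun _ _ => isHomogeneous_X_pow _ _

theorem isHomogeneous_pz (k : ℕ) : (pz r s k).IsHomogeneous k :=
  IsHomogeneous.sum _ _ _ fun _ _ => isHomogeneous_X_pow _ _

/-- The gap function which is `1` on the first block and `c` on the second one. -/
def gp (c : ℕ) : Fin (r + 1) ⊕ Fin (s + 1) → ℕ := Sum.elim (fun _ => 1) (fun _ => c)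

/-- The initial parameters, before degeneration. -/
def thX (k : ℕ) : Syz r s := if k < r + 1 then py r s (k + 1) else pz r s (k + 1)

theorem isHomogeneous_thX (k : ℕ) : (thX r s k).IsHomogeneous (k + 1) := by
  unfold thX
  split_ifs
  · exact isHomogeneous_py _ _ _
  · exact isHomogeneous_pz _ _ _

variable {r s}

theorem py_mem_gapAlg {c k : ℕ} (hk : 1 ≤ k) : py r s k ∈ gapAlg (gp r s c) :=
  Subalgebra.sum_mem _ fun _ _ => X_pow_mem_gapAlg (by simpa [gp] using hk)

theorem pz_mem_gapAlg {c k : ℕ} (hk : c ≤ k) : pz r s k ∈ gapAlg (gp r s c) :=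
  Subalgebra.sum_mem _ fun _ _ => X_pow_mem_gapAlg (by simpa [gp] using hk)

theorem thX_mem_gapAlg {c : ℕ} (hc : c ≤ r + 2) (k : ℕ) : thX r s k ∈ gapAlg (gp r s c) := by
  unfold thX
  split_ifs
  · exact py_mem_gapAlg (by omega)
  · exact pz_mem_gapAlg (by omega)

/-- The parameters as elements of the gap algebra. -/
def thG (c : ℕ) (hc : c ≤ r + 2) (k : ℕ) : gapAlg (gp r s c) := ⟨thX r s k, thX_mem_gapAlg hc k⟩

theorem gp_pos {c : ℕ} (hc : 1 ≤ c) (i) : 0 < gp r s c i := by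
  rcases i with i | i
  · simp [gp]
  · exact hc

theorem thG_mem_gapPos {c : ℕ} (hc : c ≤ r + 2) (k : ℕ) :
    thG (s := s) c hc k ∈ gapPos (gp r s c) :=
  ⟨k + 1, by omega, isHomogeneous_thX r s k⟩

theorem wreg_thG {c : ℕ} (hc1 : 1 ≤ c) (hc : c ≤ r + 2) :
    WReg (⊥ : Ideal (gapAlg (gp r s c))) ((List.range (r + 1 + (s + 1))).map (thG c hc)) := by
  set ey : ℕ → Fin (r + 1) ⊕ Fin (s + 1) := fun i => Sum.inl (Fin.ofNat (r + 1) i) with hey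
  set ez : ℕ → Fin (r + 1) ⊕ Fin (s + 1) := fun i => Sum.inr (Fin.ofNat (s + 1) i) with hez
  have hy : ∀ k, py r s k = ∑ i ∈ Finset.range (r + 1), X (ey i) ^ k := by
    intro k
    rw [← Fin.sum_univ_eq_sum_range (fun i => (X (ey i) : Syz r s) ^ k)]
    simp [py, ey]
  have hz : ∀ k, pz r s k = ∑ i ∈ Finset.range (s + 1), X (ez i) ^ k := by
    intro k
    rw [← Fin.sum_univ_eq_sum_range (fun i => (X (ez i) : Syz r s) ^ k)]
    simp [pz, ez]
  have h0 : WReg (⊥ : Ideal (gapAlg (gp r s c)))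
      (((List.range (s + 1)).map ez ++ (List.range (r + 1)).map ey).map (gapX (gp r s c))) := by
    apply wreg_gapX
    rw [List.nodup_append]
    have hinj : ∀ n : ℕ, ∀ i < n + 1, ∀ j < n + 1,
        Fin.ofNat (n + 1) i = Fin.ofNat (n + 1) j → i = j := by
      intro n i hi j hj h
      have := congrArg Fin.val h
      simpa [Fin.ofNat, Nat.mod_eq_of_lt hi, Nat.mod_eq_of_lt hj] using this
    refine ⟨?_, ?_, ?_⟩
    · refine List.Nodup.map_on ?_ List.nodup_range
      intro i hi j hj h
      exact hinj s i (List.mem_range.1 hi) j (List.mem_range.1 hj) (Sum.inr_injective h)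
    · refine List.Nodup.map_on ?_ List.nodup_range
      intro i hi j hj h
      exact hinj r i (List.mem_range.1 hi) j (List.mem_range.1 hj) (Sum.inl_injective h)
    · intro a ha b hb
      obtain ⟨i, -, rfl⟩ := List.mem_map.1 ha
      obtain ⟨j, -, rfl⟩ := List.mem_map.1 hb
      simp [ey, ez]
  rw [List.map_append, List.map_map, List.map_map] at h0
  have hX : ∀ i, gapX (gp r s c) i ∈ gapPos (gp r s c) := fun i => gapX_mem_gapPos (gp_pos hc1 i)
  have h1 := WReg.block (gp_pos hc1) (by
      intro x hx
      obtain ⟨i, -, rfl⟩ := List.mem_map.1 hx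
      exact hX _) ey (r + 1) 1 le_rfl
    (fun k => if hk : 1 ≤ k then ⟨py r s k, py_mem_gapAlg hk⟩ else 0)
    (fun k hk => by simp [hk, ← hy]) h0
  have h2 := WReg.gap_perm List.perm_append_comm GapHomog.bot (by
      intro x hx
      rcases List.mem_append.1 hx with hx | hx
      · obtain ⟨i, -, rfl⟩ := List.mem_map.1 hx
        exact hX _
      · obtain ⟨i, -, rfl⟩ := List.mem_map.1 hx
        refine ⟨1 + i, by omega, ?_⟩
        simpa using isHomogeneous_py r s (1 + i)) h1
  have h3 := WReg.block (gp_pos hc1) (by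
      intro x hx
      obtain ⟨i, -, rfl⟩ := List.mem_map.1 hx
      refine ⟨1 + i, by omega, ?_⟩
      simpa using isHomogeneous_py r s (1 + i)) ez (s + 1) (r + 2) (by omega)
    (fun k => if hk : c ≤ k then ⟨pz r s k, pz_mem_gapAlg hk⟩ else 0)
    (fun k hk => by simp [hc.trans hk, ← hz]) h2
  rw [List.range_add, List.map_append, List.map_map]
  convert h3 using 2
  · apply List.map_congr_left
    intro i hi
    apply Subtype.ext
    have := List.mem_range.1 hi
    simp [thG, thX, this, add_comm]
  · apply List.map_congr_left
    intro i hi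
    apply Subtype.ext
    have : c ≤ r + 2 + i := by omega
    have h' : ¬ r + 1 + i < r + 1 := by omega
    have h'' : r + 1 + i + 1 = r + 2 + i := by omega
    simp only [thG, thX, this, h', h'', Function.comp_apply, if_false, dif_pos]

variable (r s) in
/-- The product of the variables of the second block, to the power `2 (r + 1)`. -/
def xX : Syz r s := ∏ l : Fin (s + 1), X (Sum.inr l) ^ (2 * (r + 1))

theorem isHomogeneous_xX : (xX r s).IsHomogeneous (2 * (r + 1) * (s + 1)) := by
  have := IsHomogeneous.prod (Finset.univ : Finset (Fin (s + 1)))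
    (fun l => (X (Sum.inr l) ^ (2 * (r + 1)) : Syz r s)) (fun _ => 2 * (r + 1))
    (fun l _ => isHomogeneous_X_pow _ _)
  simpa [xX, mul_comm] using this

theorem gapAlg_one (f : Syz r s) : f ∈ gapAlg (gp r s 1) :=
  gapAlg_of_le_one (by rintro (i | i) <;> simp [gp]) f

/-- The product `xX` as an element of the gap algebra with trivial gaps. -/
def xG : gapAlg (gp r s 1) := ⟨xX r s, gapAlg_one _⟩

theorem wreg_thG_append_xG :
    WReg (⊥ : Ideal (gapAlg (gp r s 1)))
      ((List.range (r + 1 + s)).map (thG 1 (by omega)) ++ [xG]) := by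
  have h := wreg_thG (r := r) (s := s) (c := 1) le_rfl (by omega)
  rw [← add_assoc, List.range_succ, List.map_append, List.map_singleton] at h
  apply WReg.gap_exchange (gp_pos le_rfl) h
  intro v hv hx
  change aeval v (xX r s) = 0 at hx
  rw [xX, map_prod, Finset.prod_eq_zero_iff] at hx
  obtain ⟨l0, -, hl0⟩ := hx
  rw [map_pow, aeval_X] at hl0
  replace hl0 := eq_zero_of_pow_eq_zero hl0
  have hall := eq_zero_of_sum_pow_eq_zero (Finset.univ.erase l0) (fun l => v (Sum.inr l))
    (c := r + 2) (by omega) (by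
      intro k hk
      simp only [Finset.mem_univ, Finset.card_erase_of_mem, Finset.card_univ, Fintype.card_fin,
        Nat.add_sub_cancel] at hk
      have := hv (thG 1 (by omega) (r + 1 + k)) (List.mem_map_of_mem (by simp [hk]))
      simp only [thG, thX, add_lt_iff_neg_left, Nat.not_lt_zero, if_false, pz, map_sum, map_pow,
        aeval_X] at this
      rw [← Finset.add_sum_erase _ _ (Finset.mem_univ l0), hl0, zero_pow (by omega),
        zero_add] at this
      rw [← this]
      refine Finset.sum_congr rfl fun l _ => ?_
      congr 1
      omega)
  have hz : ∀ l, v (Sum.inr l) = 0 := by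
    intro l
    by_cases h : l = l0
    · rw [h, hl0]
    · exact hall l (Finset.mem_erase.2 ⟨h, Finset.mem_univ _⟩)
  have h' : ¬ r + 1 + s < r + 1 := by omega
  simp [thG, thX, pz, hz, -Order.add_one_le_iff, -Order.lt_add_one_iff, h']

theorem xX_mul_mem (f : Syz r s) {c : ℕ} (hc : c ≤ 2 * (r + 1)) :
    xX r s * f ∈ gapAlg (gp r s c) := by
  classical
  have hmon : xX r s =
      monomial (∑ l : Fin (s + 1), Finsupp.single (Sum.inr l) (2 * (r + 1))) (1 : ℂ) := by
    rw [xX, monomial_sum_one]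
    simp_rw [X_pow_eq_monomial]
  intro ν hν i
  rw [hmon] at hν
  rw [mem_support_iff, coeff_monomial_mul'] at hν
  split_ifs at hν with hle
  · have := hle i
    rw [Finsupp.finsetSum_apply] at this
    rcases i with i | i
    · simp only [gp, Sum.elim_inl]
      omega
    · simp only [gp, Sum.elim_inr]
      right
      rw [Finset.sum_eq_single i (by
        intro b _ hb
        rw [Finsupp.single_eq_of_ne]
        simpa using hb.symm) (by simp), Finsupp.single_eq_same] at this
      omega
  · exact absurd rfl hν

variable (r s) in
/-- The multiples of `xX` in the gap algebra. -/
def xIdeal : Ideal (gapAlg (gp r s (r + 2))) where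
  carrier := {f | xX r s ∣ f.1}
  add_mem' := fun ha hb => dvd_add ha hb
  zero_mem' := dvd_zero _
  smul_mem' := fun c _ hx => Dvd.dvd.mul_left hx c.1

/-- The inclusion of the gap algebra into the whole polynomial ring. -/
def gapIncl : gapAlg (gp r s (r + 2)) →+* gapAlg (gp r s 1) :=
  (Subalgebra.inclusion (fun f _ => gapAlg_one f)).toRingHom

theorem gapIncl_coe (f : gapAlg (gp r s (r + 2))) : (gapIncl f).1 = f.1 := rfl

theorem gapIncl_injective : Function.Injective (gapIncl (r := r) (s := s)) :=
  fun _ _ h => Subtype.ext (congrArg Subtype.val h :)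

theorem map_thG_eq : (List.range (r + 1 + s)).map (thG (s := s) 1 (by omega)) =
    ((List.range (r + 1 + s)).map (thG (r + 2) le_rfl)).map gapIncl := by
  rw [List.map_map]; rfl

theorem xG_regular {l l' : List (gapAlg (gp r s (r + 2)))}
    (hll : (List.range (r + 1 + s)).map (thG (r + 2) le_rfl) = l ++ l') (b : gapAlg (gp r s 1))
    (hb : xG * b ∈ (Ideal.ofList l).map gapIncl) : b ∈ (Ideal.ofList l).map gapIncl := by
  rw [Ideal.map_ofList] at hb ⊢
  have h2 := wreg_thG_append_xG (r := r) (s := s)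
  have e := map_thG_eq (r := r) (s := s)
  rw [e, hll, List.map_append, List.append_assoc] at h2
  have hpos : ∀ x ∈ List.map gapIncl l ++
      (List.map gapIncl l' ++ [xG]), x ∈ gapPos (gp r s 1) := by
    intro x hx
    rw [← List.append_assoc, ← List.map_append, ← hll, ← e, List.mem_append,
      List.mem_singleton] at hx
    rcases hx with hx | rfl
    · obtain ⟨i, -, rfl⟩ := List.mem_map.1 hx
      exact thG_mem_gapPos _ _
    · exact ⟨_, by positivity, isHomogeneous_xX⟩
  have h3 := WReg.gap_perm (List.Perm.append_left _ List.perm_append_comm)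
    GapHomog.bot hpos h2
  rw [wreg_append, bot_sup_eq] at h3
  exact h3.2.1 b hb

/-- The parameters form a regular sequence on the gap algebra modulo the multiples of `xX`. -/
theorem wreg_thG_xIdeal :
    WReg (xIdeal r s) ((List.range (r + 1 + s)).map (thG (r + 2) le_rfl)) := by
  have h1 := wreg_thG (r := r) (s := s) (c := r + 2) (by omega) le_rfl
  rw [← add_assoc, List.range_succ, List.map_append, wreg_append] at h1
  have h := WReg.sup_conductor (φ := gapIncl) gapIncl_injective (x := xG) (by
      intro b
      exact ⟨⟨xX r s * b.1, xX_mul_mem _ (by omega)⟩, Subtype.ext (gapIncl_coe _)⟩) h1.1 (by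
      intro l l' hll b hb
      rw [bot_sup_eq] at hb ⊢
      exact xG_regular hll b hb)
  rw [bot_sup_eq] at h
  have e : Ideal.comap gapIncl (Ideal.span {xG}) = xIdeal r s := by
    ext f
    rw [Ideal.mem_comap, Ideal.mem_span_singleton]
    constructor
    · rintro ⟨b, hb⟩
      exact ⟨b.1, (congrArg Subtype.val hb :)⟩
    · rintro ⟨b, hb⟩
      exact ⟨⟨b, gapAlg_one b⟩, Subtype.ext hb⟩
  rwa [e] at h

end

section
variable {r s : ℕ}

/-- The action of a pair of permutations on the two blocks of variables. -/
def act (p : Equiv.Perm (Fin (r + 1)) × Equiv.Perm (Fin (s + 1))) : Syz r s →ₐ[ℂ] Syz r s :=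
  rename (Equiv.sumCongr p.1 p.2)

variable (r s) in
/-- The polynomials symmetric in both blocks of variables. -/
def symSub : Subalgebra ℂ (Syz r s) where
  carrier := {f | ∀ p, act p f = f}
  mul_mem' ha hb p := by rw [map_mul, ha p, hb p]
  add_mem' ha hb p := by rw [map_add, ha p, hb p]
  algebraMap_mem' c p := by simp

theorem act_act (p q : Equiv.Perm (Fin (r + 1)) × Equiv.Perm (Fin (s + 1))) (f : Syz r s) :
    act p (act q f) = act (p * q) f := by
  unfold act
  rw [rename_rename]
  congr 1
  congr 1
  funext i
  rcases i with i | i <;> simp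

variable (r s) in
/-- The averaging operator. -/
def rey : Syz r s →ₗ[ℂ] Syz r s :=
  (Fintype.card (Equiv.Perm (Fin (r + 1)) × Equiv.Perm (Fin (s + 1))) : ℂ)⁻¹ •
    ∑ p : Equiv.Perm (Fin (r + 1)) × Equiv.Perm (Fin (s + 1)), (act p).toLinearMap

theorem rey_apply (f : Syz r s) : rey r s f =
    (Fintype.card (Equiv.Perm (Fin (r + 1)) × Equiv.Perm (Fin (s + 1))) : ℂ)⁻¹ •
      ∑ p, act p f := by
  simp [rey]

theorem rey_mem_symSub (f : Syz r s) : rey r s f ∈ symSub r s := by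
  intro q
  rw [rey_apply, map_smul, map_sum]
  congr 1
  simp_rw [act_act]
  exact Fintype.sum_equiv (Equiv.mulLeft q) _ _ (fun p => rfl)

theorem rey_mul {t : Syz r s} (ht : t ∈ symSub r s) (f : Syz r s) :
    rey r s (t * f) = t * rey r s f := by
  rw [rey_apply, rey_apply, mul_smul_comm, Finset.mul_sum]
  congr 1
  refine Finset.sum_congr rfl fun p _ => ?_
  rw [map_mul, ht p]

theorem rey_of_mem {f : Syz r s} (hf : f ∈ symSub r s) : rey r s f = f := by
  rw [rey_apply, Finset.sum_congr rfl (fun p _ => hf p), Finset.sum_const, ← Nat.cast_smul_eq_nsmul ℂ,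
    smul_smul, Finset.card_univ, inv_mul_cancel₀, one_smul]
  exact Nat.cast_ne_zero.2 Fintype.card_ne_zero

theorem act_isHomogeneous {f : Syz r s} {k : ℕ} (hf : f.IsHomogeneous k) (p) :
    (act p f).IsHomogeneous k := hf.rename_isHomogeneous

theorem rey_isHomogeneous {f : Syz r s} {k : ℕ} (hf : f.IsHomogeneous k) :
    (rey r s f).IsHomogeneous k := by
  rw [rey_apply]
  exact (homogeneousSubmodule _ ℂ k).smul_mem _
    (Submodule.sum_mem _ fun p _ => act_isHomogeneous hf p)

theorem act_mem_gapAlg {c : ℕ} {f : Syz r s} (hf : f ∈ gapAlg (gp r s c)) (p) :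
    act p f ∈ gapAlg (gp r s c) := by
  classical
  intro ν hν i
  rw [act, support_rename_of_injective (Equiv.injective _), Finset.mem_image] at hν
  obtain ⟨μ, hμ, rfl⟩ := hν
  rw [Finsupp.mapDomain_equiv_apply]
  have h := hf μ hμ ((Equiv.sumCongr p.1 p.2).symm i)
  rcases i with i | i <;> exact h

theorem rey_mem_gapAlg {c : ℕ} {f : Syz r s} (hf : f ∈ gapAlg (gp r s c)) :
    rey r s f ∈ gapAlg (gp r s c) := by
  rw [rey_apply]
  exact Subalgebra.smul_mem _ (Subalgebra.sum_mem _ fun p _ => act_mem_gapAlg hf p) _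

theorem homogeneousComponent_mem_symSub {f : Syz r s} (hf : f ∈ symSub r s) (k : ℕ) :
    homogeneousComponent k f ∈ symSub r s := by
  intro p
  unfold act
  have := rename_homogeneousComponent (φ := Equiv.sumCongr p.1 p.2) k f
  rw [this]
  exact congrArg _ (hf p)

theorem py_mem_symSub (k : ℕ) : py r s k ∈ symSub r s := by
  intro p
  simp only [py, act, map_sum, map_pow, rename_X]
  exact Fintype.sum_equiv p.1 _ _ (fun _ => by simp)

theorem pz_mem_symSub (k : ℕ) : pz r s k ∈ symSub r s := by
  intro p
  simp only [pz, act, map_sum, map_pow, rename_X]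
  exact Fintype.sum_equiv p.2 _ _ (fun _ => by simp)

theorem thX_mem_symSub (k : ℕ) : thX r s k ∈ symSub r s := by
  unfold thX
  split_ifs
  · exact py_mem_symSub _
  · exact pz_mem_symSub _

theorem xX_mem_symSub : xX r s ∈ symSub r s := by
  intro p
  simp only [xX, act, map_prod, map_pow, rename_X]
  exact Fintype.prod_equiv p.2 _ _ (fun _ => by simp)

theorem xX_ne_zero : xX r s ≠ 0 :=
  Finset.prod_ne_zero_iff.2 fun _ _ => pow_ne_zero _ (X_ne_zero _)

end

section
variable {σ : Type*} {g : σ → ℕ}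

open Classical in
/-- The monomials in `gapAlg g`. -/
def gapMon (g : σ → ℕ) (ν : σ →₀ ℕ) : gapAlg g :=
  if h : ∀ i, ν i = 0 ∨ g i ≤ ν i then ⟨monomial ν 1, monomial_mem_gapAlg 1 h⟩ else 0

theorem gapMon_coe {ν : σ →₀ ℕ} (h : ∀ i, ν i = 0 ∨ g i ≤ ν i) :
    (gapMon g ν).1 = monomial ν 1 := by
  rw [gapMon, dif_pos h]

theorem gap_eq_sum (f : gapAlg g) : f = ∑ ν ∈ f.1.support, coeff ν f.1 • gapMon g ν := by
  apply Subtype.ext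
  rw [AddSubmonoidClass.coe_finsetSum]
  conv_lhs => rw [f.1.as_sum]
  refine Finset.sum_congr rfl fun ν hν => ?_
  rw [Subalgebra.coe_smul, gapMon_coe (f.2 ν hν), smul_monomial, smul_eq_mul, mul_one]

theorem gap_quotient_finite [Finite σ] {J : Ideal (gapAlg g)} (h : ∀ i, gapX g i ∈ J.radical) :
    Module.Finite ℂ (gapAlg g ⧸ J) := by
  classical
  have := Fintype.ofFinite σ
  choose e he using h
  set M := ∑ i, e i with hM
  have hM' : ∀ i, gapX g i ^ M ∈ J := fun i => by
    rw [hM, ← Finset.add_sum_erase _ _ (Finset.mem_univ i), pow_add]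
    exact J.mul_mem_right _ (he i)
  set B : σ →₀ ℕ := Finsupp.equivFunOnFinite.symm fun i => g i * (M + 1) with hB
  refine ⟨⟨((Set.finite_Iic B).image fun ν => Ideal.Quotient.mkₐ ℂ J (gapMon g ν)).toFinset,
    ?_⟩⟩
  rw [eq_top_iff, Set.Finite.coe_toFinset]
  intro q _
  obtain ⟨f, rfl⟩ := Ideal.Quotient.mkₐ_surjective ℂ J q
  rw [gap_eq_sum f, map_sum]
  refine Submodule.sum_mem _ fun ν hν => ?_
  rw [map_smul]
  refine Submodule.smul_mem _ _ ?_
  by_cases hle : ν ≤ B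
  · exact Submodule.subset_span ⟨ν, hle, rfl⟩
  · obtain ⟨i, hi⟩ : ∃ i, B i < ν i := by
      by_contra! hcon
      exact hle hcon
    simp only [hB, Finsupp.equivFunOnFinite_symm_apply_apply] at hi
    have hgap := f.2 ν hν
    have hgap' : ∀ j, (ν - Finsupp.single i (g i * M)) j = 0 ∨
        g j ≤ (ν - Finsupp.single i (g i * M)) j := by
      intro j
      have := hgap j
      rw [Finsupp.tsub_apply, Finsupp.single_apply]
      split_ifs with hj
      · subst hj
        right
        rw [mul_add] at hi
        omega
      · simpa using this
    have e : gapMon g ν = gapX g i ^ M * gapMon g (ν - Finsupp.single i (g i * M)) := by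
      apply Subtype.ext
      rw [Subalgebra.coe_mul, Subalgebra.coe_pow, gapMon_coe hgap, gapMon_coe hgap']
      change _ = (X i ^ g i) ^ M * _
      rw [← pow_mul, X_pow_eq_monomial, monomial_mul, mul_one, add_tsub_cancel_of_le]
      rw [Finsupp.single_le_iff]
      rw [mul_add] at hi
      omega
    have : Ideal.Quotient.mkₐ ℂ J (gapMon g ν) = 0 := by
      rw [e, Ideal.Quotient.mkₐ_eq_mk, Ideal.Quotient.eq_zero_iff_mem]
      exact J.mul_mem_right _ (hM' i)
    rw [this]
    exact Submodule.zero_mem _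

end

section
variable {r s : ℕ}

variable (r s) in
/-- The ideal of the gap algebra generated by the parameters and the multiples of `xX`. -/
def thIdeal : Ideal (gapAlg (gp r s (r + 2))) :=
  xIdeal r s ⊔ Ideal.ofList ((List.range (r + 1 + s)).map (thG (r + 2) le_rfl))

theorem gapX_mem_radical (i) : gapX (gp r s (r + 2)) i ∈ (thIdeal r s).radical := by
  have h := mem_radical_gapAlg (gp_pos (by omega))
    ({f | ∃ k < r + 1 + s, f = thG (r + 2) le_rfl k} ∪ {f | f.1 = xX r s})
    (gapX (gp r s (r + 2)) i) (by
      intro v hv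
      obtain ⟨x', hx'⟩ : ∃ x' : gapAlg (gp r s (r + 2)), x'.1 = xX r s :=
        ⟨⟨xX r s * 1, xX_mul_mem 1 (by omega)⟩, mul_one _⟩
      have hx : aeval v (xX r s) = 0 := by
        rw [← hx']
        exact hv x' (Or.inr hx')
      have hth : ∀ k < r + 1 + s, aeval v (thX r s k) = 0 := fun k hk =>
        hv (thG (r + 2) le_rfl k) (Or.inl ⟨k, hk, rfl⟩)
      have hy : ∀ j, v (Sum.inl j) = 0 := by
        intro j
        refine eq_zero_of_sum_pow_eq_zero Finset.univ (fun j => v (Sum.inl j)) le_rfl ?_ j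
          (Finset.mem_univ j)
        intro k hk
        simp only [Finset.card_univ, Fintype.card_fin] at hk
        have := hth k (by omega)
        rw [thX, if_pos hk, py, map_sum] at this
        simpa [add_comm] using this
      rw [xX, map_prod, Finset.prod_eq_zero_iff] at hx
      obtain ⟨l0, -, hl0⟩ := hx
      rw [map_pow, aeval_X] at hl0
      replace hl0 := eq_zero_of_pow_eq_zero hl0
      have hall := eq_zero_of_sum_pow_eq_zero (Finset.univ.erase l0) (fun l => v (Sum.inr l))
        (c := r + 2) (by omega) (by
          intro k hk
          simp only [Finset.mem_univ, Finset.card_erase_of_mem, Finset.card_univ,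
            Fintype.card_fin, Nat.add_sub_cancel] at hk
          have := hth (r + 1 + k) (by omega)
          simp only [thX, add_lt_iff_neg_left, Nat.not_lt_zero, if_false, pz, map_sum, map_pow,
            aeval_X] at this
          rw [← Finset.add_sum_erase _ _ (Finset.mem_univ l0), hl0, zero_pow (by omega),
            zero_add] at this
          rw [← this]
          refine Finset.sum_congr rfl fun l _ => ?_
          congr 1
          omega)
      have hv0 : v i = 0 := by
        rcases i with i | l
        · exact hy i
        · by_cases h : l = l0
          · rw [h, hl0]
          · exact hall l (Finset.mem_erase.2 ⟨h, Finset.mem_univ _⟩)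
      change aeval v (X i ^ gp r s (r + 2) i) = 0
      rw [map_pow, aeval_X, hv0, zero_pow (gp_pos (by omega) i).ne'])
  refine Ideal.radical_mono ?_ h
  rw [Ideal.span_le]
  rintro f (⟨k, hk, rfl⟩ | hf)
  · exact Ideal.mem_sup_right (Ideal.subset_span (List.mem_map_of_mem (by simpa using hk)))
  · exact Ideal.mem_sup_left (Dvd.intro 1 (by rw [mul_one]; exact hf.symm))

theorem mem_thIdeal {f : gapAlg (gp r s (r + 2))} (hf : f ∈ thIdeal r s) :
    ∃ (h : Syz r s) (w : Fin (r + 1 + s) → Syz r s), (∀ i, w i ∈ gapAlg (gp r s (r + 2))) ∧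
      f.1 = xX r s * h + ∑ i : Fin (r + 1 + s), thX r s i * w i := by
  obtain ⟨u, ⟨h, hu⟩, v, hv, rfl⟩ := Submodule.mem_sup.1 hf
  suffices ∃ w : Fin (r + 1 + s) → Syz r s, (∀ i, w i ∈ gapAlg (gp r s (r + 2))) ∧
      v.1 = ∑ i : Fin (r + 1 + s), thX r s i * w i by
    obtain ⟨w, hw, e⟩ := this
    exact ⟨h, w, hw, by rw [Subalgebra.coe_add, hu, e]⟩
  refine Submodule.span_induction (p := fun v _ => ∃ w : Fin (r + 1 + s) → Syz r s,
    (∀ i, w i ∈ gapAlg (gp r s (r + 2))) ∧ v.1 = ∑ i : Fin (r + 1 + s), thX r s i * w i) ?_ ?_ ?_ ?_ hv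
  · intro x hx
    obtain ⟨k, hk, rfl⟩ := List.mem_map.1 hx
    rw [List.mem_range] at hk
    refine ⟨fun i => if i = ⟨k, hk⟩ then 1 else 0, fun i => ?_, ?_⟩
    · dsimp only
      split_ifs
      · exact Subalgebra.one_mem _
      · exact Subalgebra.zero_mem _
    · simp [thG]
  · exact ⟨fun _ => 0, fun _ => Subalgebra.zero_mem _, by simp⟩
  · rintro x y - - ⟨w, hw, e⟩ ⟨w', hw', e'⟩
    refine ⟨fun i => w i + w' i, fun i => Subalgebra.add_mem _ (hw i) (hw' i), ?_⟩
    rw [Subalgebra.coe_add, e, e', ← Finset.sum_add_distrib]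
    exact Finset.sum_congr rfl fun i _ => by ring
  · rintro a x - ⟨w, hw, e⟩
    refine ⟨fun i => a.1 * w i, fun i => Subalgebra.mul_mem _ a.2 (hw i), ?_⟩
    rw [smul_eq_mul, Subalgebra.coe_mul, e, Finset.mul_sum]
    exact Finset.sum_congr rfl fun i _ => by ring

end

section
variable {r s : ℕ}

/-- The family of products of parameters with module generators. -/
def tb {R : Type*} [CommSemiring R] {N : ℕ} {ι : Type*} (t : Fin N → R) (β : ι → R)
    (p : (Fin N → ℕ) × ι) : R :=
  (∏ i, t i ^ p.1 i) * β p.2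

/-- The weight of an exponent vector. -/
def wt {N : ℕ} {ι : Type*} (d : ι → ℕ) (p : (Fin N → ℕ) × ι) : ℕ :=
  ∑ i : Fin N, (i.1 + 1) * p.1 i + d p.2

theorem tb_isHomogeneous {σ : Type*} {N : ℕ} {ι : Type*} {t : Fin N → MvPolynomial σ ℂ}
    (ht : ∀ i, (t i).IsHomogeneous (i.1 + 1)) {β : ι → MvPolynomial σ ℂ} {d : ι → ℕ}
    (hβ : ∀ j, (β j).IsHomogeneous (d j)) (p) : (tb t β p).IsHomogeneous (wt d p) :=
  (IsHomogeneous.prod _ _ _ fun i _ => (ht i).pow _).mul (hβ _)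

variable (r s) in
/-- Good families of homogeneous symmetric elements of the gap algebra. -/
structure IsGapBasis {ι : Type*} (d : ι → ℕ) (β : ι → Syz r s) : Prop where
  mem_gap : ∀ j, β j ∈ gapAlg (gp r s (r + 2))
  mem_sym : ∀ j, β j ∈ symSub r s
  homog : ∀ j, (β j).IsHomogeneous (d j)
  indep : ∀ (w : (Fin (r + 1 + s) → ℕ) × ι →₀ ℂ),
    xX r s ∣ Finsupp.linearCombination ℂ (tb (fun i : Fin (r + 1 + s) => thX r s i) β) w → w = 0
  span : ∀ (k : ℕ) (f : Syz r s), f ∈ gapAlg (gp r s (r + 2)) → f ∈ symSub r s →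
    f.IsHomogeneous k → ∃ h ∈ symSub r s, f - xX r s * h ∈
      Submodule.span ℂ (tb (fun i : Fin (r + 1 + s) => thX r s i) β '' {p | wt d p = k})

theorem homogeneousComponent_mul_eq {σ : Type*} {t w : MvPolynomial σ ℂ} {d k : ℕ}
    (ht : t.IsHomogeneous d) : ∃ w', homogeneousComponent k (t * w) = t * w' ∧
      (w' = 0 ∨ (d ≤ k ∧ w' = homogeneousComponent (k - d) w)) := by
  rw [mul_comm]
  rcases lt_or_ge k d with h | h
  · exact ⟨0, by rw [homogeneousComponent_mul_of_lt ht h, mul_zero], Or.inl rfl⟩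
  · refine ⟨_, ?_, Or.inr ⟨h, rfl⟩⟩
    obtain ⟨k, rfl⟩ := Nat.exists_eq_add_of_le' h
    rw [homogeneousComponent_add_mul ht, mul_comm, Nat.add_sub_cancel]

theorem gap_span_aux {ι : Type*} {d : ι → ℕ} {β : ι → Syz r s}
    (hsym : ∀ j, β j ∈ symSub r s) (hhom : ∀ j, (β j).IsHomogeneous (d j))
    (hmod : ∀ (k : ℕ) (f : Syz r s), f ∈ gapAlg (gp r s (r + 2)) → f ∈ symSub r s →
      f.IsHomogeneous k → ∃ (c : ι →₀ ℂ) (h : Syz r s) (w : Fin (r + 1 + s) → Syz r s),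
        (∀ i, w i ∈ gapAlg (gp r s (r + 2))) ∧
        f = Finsupp.linearCombination ℂ β c + xX r s * h +
          ∑ i : Fin (r + 1 + s), thX r s i * w i)
    (k : ℕ) : ∀ (f : Syz r s), f ∈ gapAlg (gp r s (r + 2)) → f ∈ symSub r s →
    f.IsHomogeneous k → ∃ h ∈ symSub r s, f - xX r s * h ∈
      Submodule.span ℂ (tb (fun i : Fin (r + 1 + s) => thX r s i) β '' {p | wt d p = k}) := by
  induction k using Nat.strong_induction_on with
  | _ k ih =>
  intro f hf hfs hfk
  obtain ⟨c, h, w, hw, e⟩ := hmod k f hf hfs hfk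
  -- take the component of degree `k`
  obtain ⟨h1, e1, -⟩ := homogeneousComponent_mul_eq (k := k) (w := h) (isHomogeneous_xX (r := r) (s := s))
  choose w1 e2 hw1 using fun i : Fin (r + 1 + s) =>
    homogeneousComponent_mul_eq (k := k) (w := w i) (isHomogeneous_thX r s i)
  set b := homogeneousComponent k (Finsupp.linearCombination ℂ β c) with hb
  have ef : f = b + xX r s * rey r s h1 + ∑ i : Fin (r + 1 + s), thX r s i * rey r s (w1 i) := by
    have h2 : f = b + xX r s * h1 + ∑ i : Fin (r + 1 + s), thX r s i * w1 i := by
      rw [← homogeneousComponent_eq_self hfk]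
      conv_lhs => rw [e]
      rw [map_add, map_add, e1, map_sum, Finset.sum_congr rfl fun i _ => e2 i]
    have hbs : b ∈ symSub r s := by
      apply homogeneousComponent_mem_symSub
      rw [Finsupp.linearCombination_apply]
      exact Subalgebra.sum_mem _ fun j _ => Subalgebra.smul_mem _ (hsym j) _
    have h3 := congrArg (rey r s) h2
    rw [rey_of_mem hfs, map_add, map_add, rey_of_mem hbs, rey_mul xX_mem_symSub, map_sum] at h3
    simp_rw [rey_mul (thX_mem_symSub _)] at h3
    exact h3
  have hih : ∀ i : Fin (r + 1 + s), ∃ g ∈ symSub r s,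
      thX r s i * rey r s (w1 i) - xX r s * g ∈ Submodule.span ℂ
        (tb (fun i : Fin (r + 1 + s) => thX r s i) β '' {p | wt d p = k}) := by
    intro i
    rcases hw1 i with h0 | ⟨hik, h0⟩
    · exact ⟨0, Subalgebra.zero_mem _, by rw [h0]; simp⟩
    · obtain ⟨g, hg, hgs⟩ := ih (k - (i + 1)) (by omega) (rey r s (w1 i))
        (rey_mem_gapAlg (by rw [h0]; exact homogeneousComponent_mem_gapAlg (hw i) _))
        (rey_mem_symSub _)
        (rey_isHomogeneous (by rw [h0]; exact homogeneousComponent_isHomogeneous _ _))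
      refine ⟨thX r s i * g, Subalgebra.mul_mem _ (thX_mem_symSub _) hg, ?_⟩
      have : thX r s i * rey r s (w1 i) - xX r s * (thX r s i * g) =
          LinearMap.mulLeft ℂ (thX r s i) (rey r s (w1 i) - xX r s * g) := by
        rw [LinearMap.mulLeft_apply]; ring
      rw [this]
      have h4 := Submodule.mem_map_of_mem (f := LinearMap.mulLeft ℂ (thX r s i)) hgs
      rw [Submodule.map_span] at h4
      refine Submodule.span_mono ?_ h4
      rintro _ ⟨_, ⟨p, hp, rfl⟩, rfl⟩
      refine ⟨(p.1 + Pi.single i 1, p.2), ?_, ?_⟩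
      · simp only [Set.mem_ofPred_eq, wt] at hp ⊢
        simp only [Pi.add_apply, mul_add, Finset.sum_add_distrib]
        have : ∑ x : Fin (r + 1 + s), (x.1 + 1) * (Pi.single i 1 : Fin (r + 1 + s) → ℕ) x = i + 1 := by
          rw [Finset.sum_eq_single i] <;> simp +contextual
        rw [this]
        omega
      · simp only [tb, LinearMap.mulLeft_apply, Pi.add_apply, pow_add, Finset.prod_mul_distrib]
        have : ∏ x : Fin (r + 1 + s), thX r s x ^ (Pi.single i 1 : Fin (r + 1 + s) → ℕ) x = thX r s i := by
          rw [Finset.prod_eq_single i] <;> simp +contextual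
        rw [this]
        ring
  choose g hg hgs using hih
  refine ⟨rey r s h1 + ∑ i, g i, Subalgebra.add_mem _ (rey_mem_symSub _)
    (Subalgebra.sum_mem _ fun i _ => hg i), ?_⟩
  have e5 : f - xX r s * (rey r s h1 + ∑ i, g i) =
      b + ∑ i : Fin (r + 1 + s), (thX r s i * rey r s (w1 i) - xX r s * g i) := by
    conv_lhs => rw [ef]
    rw [Finset.sum_sub_distrib, mul_add, Finset.mul_sum]
    ring
  rw [e5]
  refine Submodule.add_mem _ ?_ (Submodule.sum_mem _ fun i _ => hgs i)
  rw [hb, Finsupp.linearCombination_apply, Finsupp.sum, map_sum]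
  refine Submodule.sum_mem _ fun j _ => ?_
  rw [map_smul, homogeneousComponent_of_mem (hhom j)]
  refine Submodule.smul_mem _ _ ?_
  split_ifs with hj
  · refine Submodule.subset_span ⟨(0, j), ?_, ?_⟩
    · simp [wt, hj]
    · simp [tb]
  · exact Submodule.zero_mem _

variable (r s) in
theorem exists_gapBasis : ∃ (ι : Type) (_ : Fintype ι) (d : ι → ℕ) (β : ι → Syz r s),
    IsGapBasis r s d β := by
  set J := thIdeal r s with hJ
  have hfin : Module.Finite ℂ (gapAlg (gp r s (r + 2)) ⧸ J) := gap_quotient_finite gapX_mem_radical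
  let T : Set (gapAlg (gp r s (r + 2)) ⧸ J) :=
    {q | ∃ f : gapAlg (gp r s (r + 2)), ∃ k, f.1 ∈ symSub r s ∧ f.1.IsHomogeneous k ∧
      Ideal.Quotient.mkₐ ℂ J f = q}
  obtain ⟨B, hBT, hspan, hli⟩ := exists_linearIndependent ℂ T
  have hBfin : Finite B := hli.finite
  choose β d hβs hβd hβq using fun q : B => hBT q.2
  let e := Finite.equivFin B
  have hli' : LinearIndependent ℂ (fun j => Ideal.Quotient.mkₐ ℂ J (β (e.symm j))) := by
    have h0 : (fun j => Ideal.Quotient.mkₐ ℂ J (β (e.symm j))) = Subtype.val ∘ e.symm := by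
      funext j
      exact hβq _
    rw [h0]
    exact hli.comp e.symm e.symm.injective
  refine ⟨Fin (Nat.card B), inferInstance, fun j => d (e.symm j), fun j => (β (e.symm j)).1,
    fun j => (β _).2, fun j => hβs _, fun j => hβd _, ?_, ?_⟩
  · have h0 : List.ofFn (fun i : Fin (r + 1 + s) => thG (r := r) (s := s) (r + 2) le_rfl (i : ℕ)) =
        (List.range (r + 1 + s)).map (thG (r + 2) le_rfl) := by
      rw [List.ofFn_eq_map, ← List.map_coe_finRange_eq_range, List.map_map]
      rfl
    have h1 : IndepMod ℂ (xIdeal r s ⊔ Ideal.ofList (List.ofFn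
        (fun i : Fin (r + 1 + s) => thG (r + 2) le_rfl (i : ℕ)))) (fun j => β (e.symm j)) := by
      intro w hw
      rw [linearIndependent_iff] at hli'
      apply hli'
      have : Finsupp.linearCombination ℂ (fun j => Ideal.Quotient.mkₐ ℂ J (β (e.symm j))) w =
          Ideal.Quotient.mkₐ ℂ J (Finsupp.linearCombination ℂ (fun j => β (e.symm j)) w) := by
        rw [Finsupp.linearCombination_apply, Finsupp.linearCombination_apply, map_finsuppSum]
        simp only [map_smul]
      rw [this, Ideal.Quotient.mkₐ_eq_mk, Ideal.Quotient.eq_zero_iff_mem]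
      rw [h0] at hw
      exact hw
    have h2 := WReg.indepMod (by
      rw [h0]
      exact wreg_thG_xIdeal) h1
    intro w hw
    apply h2 w
    change xX r s ∣ (Finsupp.linearCombination ℂ _ w : gapAlg (gp r s (r + 2))).1
    convert hw using 1
    rw [Finsupp.linearCombination_apply, Finsupp.linearCombination_apply, Finsupp.sum, Finsupp.sum,
      AddSubmonoidClass.coe_finsetSum]
    refine Finset.sum_congr rfl fun p _ => ?_
    rw [Subalgebra.coe_smul, Subalgebra.coe_mul, tb]
    congr 2
    exact map_prod (gapAlg (gp r s (r + 2))).val _ _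
  · refine fun k => gap_span_aux (fun j => hβs _) (fun j => hβd _) ?_ k
    intro k f hf hfs hfk
    have h1 : Ideal.Quotient.mkₐ ℂ J ⟨f, hf⟩ ∈ Submodule.span ℂ
        (Set.range fun j => Ideal.Quotient.mkₐ ℂ J (β (e.symm j))) := by
      have h2 : Set.range (fun j => Ideal.Quotient.mkₐ ℂ J (β (e.symm j))) = B := by
        ext q
        constructor
        · rintro ⟨j, rfl⟩
          simp only [hβq]
          exact (e.symm j).2
        · intro hq
          exact ⟨e ⟨q, hq⟩, by simp only [Equiv.symm_apply_apply, hβq]⟩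
      rw [h2, hspan]
      exact Submodule.subset_span ⟨⟨f, hf⟩, k, hfs, hfk, rfl⟩
    rw [Finsupp.mem_span_range_iff_exists_finsupp] at h1
    obtain ⟨c, hc⟩ := h1
    have h3 : (⟨f, hf⟩ - Finsupp.linearCombination ℂ (fun j => β (e.symm j)) c :
        gapAlg (gp r s (r + 2))) ∈ J := by
      rw [← Ideal.Quotient.eq_zero_iff_mem, ← Ideal.Quotient.mkₐ_eq_mk ℂ, map_sub, ← hc,
        Finsupp.linearCombination_apply, map_finsuppSum]
      simp only [map_smul, sub_self]
    obtain ⟨h, w, hw, e4⟩ := mem_thIdeal h3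
    refine ⟨c, h, w, hw, ?_⟩
    have e5 : Finsupp.linearCombination ℂ (fun j => (β (e.symm j)).1) c =
        (Finsupp.linearCombination ℂ (fun j => β (e.symm j)) c).1 := by
      rw [Finsupp.linearCombination_apply, Finsupp.linearCombination_apply, Finsupp.sum,
        Finsupp.sum, AddSubmonoidClass.coe_finsetSum]
      rfl
    rw [Subalgebra.coe_sub, sub_eq_iff_eq_add] at e4
    rw [e5, add_assoc, add_comm]
    exact e4

end

section
variable {κ A : Type*} [Fintype κ] [DecidableEq κ] [CommRing A] [Algebra ℂ A]

/-- The symmetrization of the monomial with exponents `lam`. -/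
def monSym (v : κ → A) (lam : κ → ℕ) : A := ∑ σ : Equiv.Perm κ, ∏ l, v (σ l) ^ lam l

omit [Algebra ℂ A] in
theorem monSym_comp (v : κ → A) (lam : κ → ℕ) (τ : Equiv.Perm κ) :
    monSym v (lam ∘ τ) = monSym v lam := by
  unfold monSym
  rw [← Equiv.sum_comp (Equiv.mulRight τ)]
  refine Finset.sum_congr rfl fun σ _ => ?_
  rw [← Equiv.prod_comp τ (fun l => v (σ l) ^ lam l)]
  rfl

omit [Algebra ℂ A] in
theorem powerSum_mul_monSym (v : κ → A) (lam : κ → ℕ) (u : ℕ) :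
    (∑ i, v i ^ u) * monSym v lam = ∑ l, monSym v (lam + Pi.single l u) := by
  unfold monSym
  rw [Finset.sum_comm, Finset.mul_sum]
  refine Finset.sum_congr rfl fun σ _ => ?_
  rw [← Equiv.sum_comp σ, Finset.sum_mul]
  refine Finset.sum_congr rfl fun l _ => ?_
  simp only [Pi.add_apply, pow_add, Finset.prod_mul_distrib]
  rw [mul_comm]
  congr 1
  rw [Finset.prod_eq_single l]
  · simp
  · intro b _ hb
    simp [hb]
  · simp

theorem monSym_mem (B : Subalgebra ℂ A) (v : κ → A) (c : ℕ)
    (hB : ∀ i, c ≤ i → ∑ l, v l ^ i ∈ B) (lam : κ → ℕ) (h : ∀ l, lam l = 0 ∨ c ≤ lam l) :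
    monSym v lam ∈ B := by
  induction hk : (Finset.univ.filter fun l => lam l ≠ 0).card using Nat.strong_induction_on
    generalizing lam with
  | _ k ih =>
  by_cases h0 : ∀ l, lam l = 0
  · have : monSym v lam = ((Fintype.card (Equiv.Perm κ) : ℕ) : A) := by
      simp [monSym, h0]
    rw [this]
    exact natCast_mem B _
  · push Not at h0
    obtain ⟨l0, hl0⟩ := h0
    set lam0 := Function.update lam l0 0 with hlam0
    have hlt : (Finset.univ.filter fun l => lam0 l ≠ 0).card < k := by
      rw [← hk]
      apply Finset.card_lt_card
      rw [Finset.ssubset_iff_of_subset]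
      · exact ⟨l0, by simpa using hl0, by simp [hlam0]⟩
      · intro l
        simp only [Finset.mem_filter, Finset.mem_univ, true_and, hlam0]
        by_cases hl : l = l0
        · subst hl; simp
        · rw [Function.update_of_ne hl]
          exact id
    have h0' : ∀ l, lam0 l = 0 ∨ c ≤ lam0 l := by
      intro l
      by_cases hl : l = l0
      · subst hl; simp [hlam0]
      · rw [hlam0, Function.update_of_ne hl]
        exact h l
    have hc : c ≤ lam l0 := (h l0).resolve_left hl0
    have h1 : (∑ i, v i ^ lam l0) * monSym v lam0 ∈ B :=
      B.mul_mem (hB _ hc) (ih _ hlt lam0 h0' rfl)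
    rw [powerSum_mul_monSym, ← Finset.sum_filter_add_sum_filter_not _ (fun l => lam0 l ≠ 0)] at h1
    have h2 : ∑ l with lam0 l ≠ 0, monSym v (lam0 + Pi.single l (lam l0)) ∈ B := by
      refine B.sum_mem fun l hl => ?_
      have hl' : lam0 l ≠ 0 := (Finset.mem_filter.1 hl).2
      refine ih _ hlt _ ?_ ?_
      · intro j
        by_cases hj : j = l
        · subst hj
          right
          simp only [Pi.add_apply, Pi.single_eq_same]
          omega
        · simpa [hj] using h0' j
      · congr 1
        ext j
        simp only [Finset.mem_filter, Finset.mem_univ, true_and, Pi.add_apply]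
        by_cases hj : j = l
        · subst hj
          simp [hl']
        · simp [hj]
    have h3 : ∑ l with ¬ lam0 l ≠ 0, monSym v (lam0 + Pi.single l (lam l0)) =
        (((Finset.univ.filter fun l => ¬ lam0 l ≠ 0).card : ℕ) : ℂ) • monSym v lam := by
      rw [Nat.cast_smul_eq_nsmul, ← Finset.sum_const]
      refine Finset.sum_congr rfl fun l hl => ?_
      have hl' : lam0 l = 0 := not_not.1 (Finset.mem_filter.1 hl).2
      rw [← monSym_comp v lam (Equiv.swap l l0)]
      congr 1
      funext j
      simp only [Pi.add_apply, Function.comp_apply]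
      by_cases hj : j = l
      · subst hj
        simp [hl']
      · by_cases hj0 : j = l0
        · subst hj0
          rw [Equiv.swap_apply_right]
          simp only [hlam0, Function.update_self, zero_add]
          rw [Pi.single_eq_of_ne hj]
          rw [hlam0, Function.update_of_ne (Ne.symm hj)] at hl'
          exact hl'.symm
        · rw [Equiv.swap_apply_of_ne_of_ne hj hj0, Pi.single_eq_of_ne hj, hlam0,
            Function.update_of_ne hj0, add_zero]
    have h4 := B.sub_mem h1 h2
    rw [add_sub_cancel_left, h3] at h4
    have hne : (((Finset.univ.filter fun l => ¬ lam0 l ≠ 0).card : ℕ) : ℂ) ≠ 0 := by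
      rw [Nat.cast_ne_zero]
      exact Finset.card_ne_zero_of_mem (a := l0) (by simp [hlam0])
    have h5 := B.smul_mem h4 (((Finset.univ.filter fun l => ¬ lam0 l ≠ 0).card : ℕ) : ℂ)⁻¹
    rwa [smul_smul, inv_mul_cancel₀ hne, one_smul] at h5

end

section
variable {κ : Type*} [Fintype κ]

theorem esymm_mem_of_psum_mem (B : Subalgebra ℂ (MvPolynomial κ ℂ))
    (hB : ∀ i, 1 ≤ i → i ≤ Fintype.card κ → psum κ ℂ i ∈ B) (k : ℕ) : esymm κ ℂ k ∈ B := by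
  induction k using Nat.strong_induction_on with
  | _ k ih =>
  rcases Nat.eq_zero_or_pos k with rfl | hk
  · rw [esymm_zero]; exact B.one_mem
  by_cases hkc : k ≤ Fintype.card κ
  · have h := mul_esymm_eq_sum κ ℂ k
    have h1 : (k : MvPolynomial κ ℂ) * esymm κ ℂ k ∈ B := by
      rw [h]
      refine B.mul_mem (B.pow_mem (B.neg_mem B.one_mem) _) (B.sum_mem fun a ha => ?_)
      obtain ⟨ha, hak⟩ := Finset.mem_filter.1 ha
      rw [Finset.HasAntidiagonal.mem_antidiagonal] at ha
      exact B.mul_mem (B.mul_mem (B.pow_mem (B.neg_mem B.one_mem) _) (ih _ hak))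
        (hB _ (by omega) (by omega))
    have h2 := B.smul_mem h1 (k : ℂ)⁻¹
    have hk0 : (k : ℂ) ≠ 0 := by exact_mod_cast hk.ne'
    rwa [← map_natCast (C : ℂ →+* MvPolynomial κ ℂ), ← smul_eq_C_mul, smul_smul,
      inv_mul_cancel₀ hk0, one_smul] at h2
  · rw [esymm, Finset.powersetCard_eq_empty.2 (by rw [Finset.card_univ]; omega),
      Finset.sum_empty]
    exact B.zero_mem

theorem psum_mem_of_psum_mem (B : Subalgebra ℂ (MvPolynomial κ ℂ))
    (hB : ∀ i, 1 ≤ i → i ≤ Fintype.card κ → psum κ ℂ i ∈ B) (k : ℕ) : psum κ ℂ k ∈ B := by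
  induction k using Nat.strong_induction_on with
  | _ k ih =>
  rcases Nat.eq_zero_or_pos k with rfl | hk
  · rw [psum_zero]; exact natCast_mem B _
  rw [psum_eq_mul_esymm_sub_sum κ ℂ k hk]
  refine B.sub_mem (B.mul_mem (B.mul_mem (B.pow_mem (B.neg_mem B.one_mem) _) (natCast_mem B _))
    (esymm_mem_of_psum_mem B hB k)) (B.sum_mem fun a ha => ?_)
  obtain ⟨ha, hak⟩ := Finset.mem_filter.1 ha
  rw [Finset.HasAntidiagonal.mem_antidiagonal] at ha
  simp only [Set.mem_Ioo] at hak
  exact B.mul_mem (B.mul_mem (B.pow_mem (B.neg_mem B.one_mem) _) (esymm_mem_of_psum_mem B hB _))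
    (ih _ (by omega))

end

section
variable {r s : ℕ}

theorem py_mem_of_mem (B : Subalgebra ℂ (Syz r s))
    (hy : ∀ i, 1 ≤ i → i ≤ r + 1 → py r s i ∈ B) (k : ℕ) : py r s k ∈ B := by
  have e : ∀ i, (rename Sum.inl : MvPolynomial (Fin (r + 1)) ℂ →ₐ[ℂ] Syz r s)
      (psum (Fin (r + 1)) ℂ i) = py r s i := by
    intro i
    simp [psum, py]
  have := psum_mem_of_psum_mem (κ := Fin (r + 1))
    (B.comap (rename Sum.inl : MvPolynomial (Fin (r + 1)) ℂ →ₐ[ℂ] Syz r s)) (by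
      intro i h1 h2
      rw [Subalgebra.mem_comap, e]
      exact hy i h1 (by simpa using h2)) k
  rwa [Subalgebra.mem_comap, e] at this

/-- Symmetric elements of the gap algebra are generated by power sums. -/
theorem gap_generated (B : Subalgebra ℂ (Syz r s))
    (hy : ∀ i, 1 ≤ i → i ≤ r + 1 → py r s i ∈ B) (hz : ∀ i, r + 2 ≤ i → pz r s i ∈ B)
    {f : Syz r s} (hf : f ∈ gapAlg (gp r s (r + 2))) (hs : f ∈ symSub r s) : f ∈ B := by
  rw [← rey_of_mem hs, f.as_sum, map_sum]
  refine B.sum_mem fun ν hν => ?_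
  rw [rey_apply]
  refine B.smul_mem ?_ _
  have hg := hf ν hν
  have e : ∑ p : Equiv.Perm (Fin (r + 1)) × Equiv.Perm (Fin (s + 1)),
      act p (monomial ν (coeff ν f)) = coeff ν f •
        (monSym (fun j => (X (Sum.inl j) : Syz r s)) (fun j => ν (Sum.inl j)) *
          monSym (fun l => (X (Sum.inr l) : Syz r s)) (fun l => ν (Sum.inr l))) := by
    unfold monSym
    rw [Finset.sum_mul_sum, ← Finset.sum_product', Finset.smul_sum]
    refine Finset.sum_congr rfl fun p _ => ?_
    rw [monomial_eq, smul_eq_C_mul, act, map_mul, rename_C, Finsupp.prod_fintype _ _ (by simp),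
      map_prod, Fintype.prod_sum_type]
    simp
  rw [e]
  refine B.smul_mem (B.mul_mem (monSym_mem B _ 1 ?_ _ ?_) (monSym_mem B _ (r + 2) ?_ _ ?_)) _
  · exact fun i _ => py_mem_of_mem B hy i
  · exact fun j => hg (Sum.inl j)
  · exact fun i hi => hz i hi
  · exact fun j => hg (Sum.inr j)

end

section
variable (V : Type*) [AddCommGroup V] [Module ℂ V]

/-- Polynomial curves `ℂ → V`. -/
def curves : Submodule ℂ (ℂ → V) :=
  Submodule.span ℂ {F | ∃ (k : ℕ) (v : V), F = fun δ => δ ^ k • v}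

variable {V}

theorem pow_smul_mem_curves (k : ℕ) (v : V) : (fun δ : ℂ => δ ^ k • v) ∈ curves V :=
  Submodule.subset_span ⟨k, v, rfl⟩

theorem const_mem_curves (v : V) : (fun _ : ℂ => v) ∈ curves V := by
  simpa using pow_smul_mem_curves 0 v

theorem map_mem_curves {W : Type*} [AddCommGroup W] [Module ℂ W] (φ : V →ₗ[ℂ] W) {F : ℂ → V}
    (hF : F ∈ curves V) : (fun δ => φ (F δ)) ∈ curves W := by
  refine Submodule.span_induction (p := fun F _ => (fun δ => φ (F δ)) ∈ curves W)
    ?_ ?_ ?_ ?_ hF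
  · rintro _ ⟨k, v, rfl⟩
    simpa using pow_smul_mem_curves k (φ v)
  · convert (curves W).zero_mem using 1
    funext δ
    simp
  · intro F G _ _ h1 h2
    convert (curves W).add_mem h1 h2 using 1
    funext δ
    simp
  · intro c F _ h
    convert (curves W).smul_mem c h using 1
    funext δ
    simp

theorem mul_mem_curves {A : Type*} [CommRing A] [Algebra ℂ A] {F G : ℂ → A}
    (hF : F ∈ curves A) (hG : G ∈ curves A) : F * G ∈ curves A := by
  refine Submodule.span_induction₂ (p := fun F G _ _ => F * G ∈ curves A)
    ?_ ?_ ?_ ?_ ?_ ?_ ?_ hF hG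
  · rintro _ _ ⟨k, v, rfl⟩ ⟨l, w, rfl⟩
    convert pow_smul_mem_curves (k + l) (v * w) using 1
    funext δ
    simp [pow_add, smul_smul, mul_comm]
  · intro G _
    simp
  · intro G _
    simp
  · intro F G H _ _ _ h1 h2
    rw [add_mul]
    exact (curves A).add_mem h1 h2
  · intro F G H _ _ _ h1 h2
    rw [mul_add]
    exact (curves A).add_mem h1 h2
  · intro c F G _ _ h
    rw [smul_mul_assoc]
    exact (curves A).smul_mem c h
  · intro c F G _ _ h
    rw [mul_smul_comm]
    exact (curves A).smul_mem c h

/-- The algebra of polynomial curves. -/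
def curveAlg (A : Type*) [CommRing A] [Algebra ℂ A] : Subalgebra ℂ (ℂ → A) :=
  (curves A).toSubalgebra (const_mem_curves 1) fun _ _ => mul_mem_curves

theorem mem_curveAlg {A : Type*} [CommRing A] [Algebra ℂ A] {F : ℂ → A} :
    F ∈ curveAlg A ↔ F ∈ curves A := Iff.rfl

theorem exists_polynomial_of_mem_curves {F : ℂ → ℂ} (hF : F ∈ curves ℂ) :
    ∃ P : Polynomial ℂ, ∀ δ, P.eval δ = F δ := by
  refine Submodule.span_induction (p := fun F _ => ∃ P : Polynomial ℂ, ∀ δ, P.eval δ = F δ)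
    ?_ ?_ ?_ ?_ hF
  · rintro _ ⟨k, v, rfl⟩
    exact ⟨Polynomial.X ^ k * Polynomial.C v, fun δ => by simp; ring⟩
  · exact ⟨0, by simp⟩
  · rintro F G _ _ ⟨P, hP⟩ ⟨Q, hQ⟩
    exact ⟨P + Q, by simp [hP, hQ]⟩
  · rintro c F _ ⟨P, hP⟩
    exact ⟨Polynomial.C c * P, by simp [hP]⟩

theorem linearIndependent_curves {ι : Type*} [Finite ι] (F : ι → ℂ → V)
    (hF : ∀ i, F i ∈ curves V) (h0 : LinearIndependent ℂ (fun i => F i 0)) :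
    ∃ D : Set ℂ, D.Finite ∧ ∀ δ ∉ D, LinearIndependent ℂ (fun i => F i δ) := by
  classical
  have := Fintype.ofFinite ι
  obtain ⟨φ, hφ⟩ : ∃ φ : V →ₗ[ℂ] (ι → ℂ), ∀ i, φ (F i 0) = Pi.single i 1 := by
    obtain ⟨g, hg⟩ := LinearMap.exists_leftInverse_of_injective
      (Fintype.linearCombination ℂ (fun i => F i 0)) (by
        exact LinearMap.ker_eq_bot'.2 fun g hg => funext fun i =>
          Fintype.linearIndependent_iff.1 h0 g (by simpa [Fintype.linearCombination_apply] using hg) i)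
    refine ⟨g, fun i => ?_⟩
    have := LinearMap.congr_fun hg (Pi.single i 1)
    simpa using this
  choose P hP using fun i j => exists_polynomial_of_mem_curves
    (map_mem_curves (LinearMap.proj j ∘ₗ φ) (hF i))
  have hdet : ∀ δ, (Matrix.of P).det.eval δ = (Matrix.of fun i j => φ (F i δ) j).det := by
    intro δ
    rw [← Polynomial.coe_evalRingHom, RingHom.map_det]
    congr 1
    ext i j
    exact hP i j δ
  have hne : (Matrix.of P).det ≠ 0 := by
    intro h
    have := hdet 0
    rw [h] at this
    have h1 : (Matrix.of fun i j => φ (F i 0) j) = (1 : Matrix ι ι ℂ) := by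
      ext i j
      rw [Matrix.of_apply, hφ, Matrix.one_apply, Pi.single_apply]
      simp only [eq_comm]
    rw [h1] at this
    simp at this
  refine ⟨{δ | (Matrix.of P).det.IsRoot δ}, Polynomial.finite_setOfPred_isRoot hne, fun δ hδ => ?_⟩
  have hd : (Matrix.of fun i j => φ (F i δ) j).det ≠ 0 := by
    rw [← hdet]
    exact hδ
  have := Matrix.linearIndependent_rows_of_det_ne_zero hd
  exact LinearIndependent.of_comp φ this

/-- Semicontinuity of the dimension of kernels in a linear pencil. -/
theorem finrank_ker_pencil {U U' : Type*} [AddCommGroup U] [Module ℂ U] [AddCommGroup U']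
    [Module ℂ U'] [Module.Finite ℂ U] (L0 L1 : U →ₗ[ℂ] U') :
    ∃ D : Set ℂ, D.Finite ∧ ∀ b ∉ D,
      Module.finrank ℂ (LinearMap.ker (L0 + b • L1)) ≤ Module.finrank ℂ (LinearMap.ker L0) := by
  let e := Module.finBasis ℂ (LinearMap.range L0)
  choose u hu using fun i => (e i).2
  obtain ⟨D, hD, h⟩ := linearIndependent_curves
    (fun i => fun b : ℂ => L0 (u i) + b • L1 (u i)) (fun i => by
      refine (curves U').add_mem (const_mem_curves (L0 (u i))) ?_
      simpa using pow_smul_mem_curves 1 (L1 (u i))) (by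
      have := e.linearIndependent.map' (LinearMap.range L0).subtype (Submodule.ker_subtype _)
      have h : (fun i => L0 (u i) + (0 : ℂ) • L1 (u i)) = (LinearMap.range L0).subtype ∘ e := by
        funext i
        simp [hu]
      rw [h]
      exact this)
  refine ⟨D, hD, fun b hb => ?_⟩
  have h1 := h b hb
  have h2 : LinearIndependent ℂ (fun i => (⟨(L0 + b • L1) (u i), u i, rfl⟩ :
      LinearMap.range (L0 + b • L1))) := by
    refine LinearIndependent.of_comp (LinearMap.range (L0 + b • L1)).subtype ?_
    exact h1
  have h3 := h2.fintype_card_le_finrank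
  rw [Fintype.card_fin] at h3
  have h4 := LinearMap.finrank_range_add_finrank_ker (L0 + b • L1)
  have h5 := LinearMap.finrank_range_add_finrank_ker L0
  omega

end

section
variable {r s : ℕ}

/-- The specialization `z_l ↦ y_j`. -/
def spec (l : Fin (s + 1)) (j : Fin (r + 1)) : Syz r s →ₐ[ℂ] Syz r s :=
  aeval (Function.update X (Sum.inr l) (X (Sum.inl j)))

theorem spec_X_inl (l : Fin (s + 1)) (j j' : Fin (r + 1)) :
    spec l j (X (Sum.inl j')) = X (Sum.inl j') := by
  simp [spec]

theorem spec_X_self (l : Fin (s + 1)) (j : Fin (r + 1)) :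
    spec l j (X (Sum.inr l)) = X (Sum.inl j) := by
  simp [spec]

theorem spec_X_of_ne {l l' : Fin (s + 1)} (j : Fin (r + 1)) (h : l' ≠ l) :
    spec l j (X (Sum.inr l')) = X (Sum.inr l') := by
  simp [spec, h]

theorem dvd_sub_spec (l : Fin (s + 1)) (j : Fin (r + 1)) (f : Syz r s) :
    X (Sum.inr l) - X (Sum.inl j) ∣ f - spec l j f := by
  rw [← Ideal.mem_span_singleton, ← Ideal.Quotient.eq]
  have : (Ideal.Quotient.mkₐ ℂ (Ideal.span {(X (Sum.inr l) - X (Sum.inl j) : Syz r s)})) =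
      (Ideal.Quotient.mkₐ ℂ (Ideal.span {(X (Sum.inr l) - X (Sum.inl j) : Syz r s)})).comp
        (spec l j) := by
    apply algHom_ext
    intro v
    rw [AlgHom.comp_apply, Ideal.Quotient.mkₐ_eq_mk]
    rcases v with j' | l'
    · rw [spec_X_inl]
    · by_cases h : l' = l
      · subst h
        rw [spec_X_self, Ideal.Quotient.eq]
        exact Ideal.subset_span rfl
      · rw [spec_X_of_ne j h]
  exact AlgHom.congr_fun this f

theorem spec_eq_zero_iff {l : Fin (s + 1)} {j : Fin (r + 1)} {f : Syz r s} :
    spec l j f = 0 ↔ X (Sum.inr l) - X (Sum.inl j) ∣ f := by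
  constructor
  · intro h
    have := dvd_sub_spec l j f
    rwa [h, sub_zero] at this
  · rintro ⟨g, rfl⟩
    rw [map_mul, map_sub, spec_X_self, spec_X_inl, sub_self, zero_mul]

/-- The quasi-invariance defect along `z_l = y_j`. -/
def defect (b : ℂ) (l : Fin (s + 1)) (j : Fin (r + 1)) : Syz r s →ₗ[ℂ] Syz r s :=
  (spec l j).toLinearMap ∘ₗ (pderiv (Sum.inr l) : Derivation ℂ (Syz r s) (Syz r s)).toLinearMap +
    b • (-((spec l j).toLinearMap ∘ₗ
      (pderiv (Sum.inl j) : Derivation ℂ (Syz r s) (Syz r s)).toLinearMap))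

theorem defect_apply (b : ℂ) (l : Fin (s + 1)) (j : Fin (r + 1)) (f : Syz r s) :
    defect b l j f = spec l j (pderiv (Sum.inr l) f) - b • spec l j (pderiv (Sum.inl j) f) := by
  simp [defect, sub_eq_add_neg]

theorem defect_mul (b : ℂ) (l : Fin (s + 1)) (j : Fin (r + 1)) (f g : Syz r s) :
    defect b l j (f * g) = spec l j f * defect b l j g + spec l j g * defect b l j f := by
  simp only [defect_apply, Derivation.leibniz, map_add, smul_eq_mul, map_mul, smul_eq_C_mul]
  ring

variable (r s) in
/-- The algebra of quasi-invariants. -/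
def quasi (b : ℂ) : Subalgebra ℂ (Syz r s) where
  carrier := {f | ∀ l j, defect b l j f = 0}
  mul_mem' hf hg l j := by rw [defect_mul, hf, hg, mul_zero, mul_zero, add_zero]
  add_mem' hf hg l j := by rw [map_add, hf, hg, add_zero]
  algebraMap_mem' c l j := by simp [defect_apply, algebraMap_eq]

variable (r s) in
/-- Deformed power sums. -/
def dps (b : ℂ) (k : ℕ) : Syz r s := py r s k + b • pz r s k

theorem isHomogeneous_dps (b : ℂ) (k : ℕ) : (dps r s b k).IsHomogeneous k :=
  (isHomogeneous_py r s k).add (by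
    rw [smul_eq_C_mul]
    exact (isHomogeneous_pz r s k).C_mul b)

theorem dps_mem_symSub (b : ℂ) (k : ℕ) : dps r s b k ∈ symSub r s :=
  Subalgebra.add_mem _ (py_mem_symSub k) (Subalgebra.smul_mem _ (pz_mem_symSub k) _)

theorem dps_mem_quasi (b : ℂ) (k : ℕ) : dps r s b k ∈ quasi r s b := by
  classical
  intro l j
  have h1 : pderiv (Sum.inr l) (dps r s b k) = b • ((k : Syz r s) * X (Sum.inr l) ^ (k - 1)) := by
    simp only [dps, py, pz, map_add, Derivation.map_smul, map_sum, Derivation.leibniz_pow, pderiv_X]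
    simp [Pi.single_apply]
  have h2 : pderiv (Sum.inl j) (dps r s b k) = (k : Syz r s) * X (Sum.inl j) ^ (k - 1) := by
    simp only [dps, py, pz, map_add, Derivation.map_smul, map_sum, Derivation.leibniz_pow, pderiv_X]
    simp [Pi.single_apply]
  rw [defect_apply, h1, h2, map_smul, map_mul, map_mul, map_pow, map_pow, spec_X_self, spec_X_inl,
    map_natCast, sub_self]

variable (r s) in
/-- The discriminant-type product of all `z_l - y_j`. -/
def disc : Syz r s := ∏ l : Fin (s + 1), ∏ j : Fin (r + 1), (X (Sum.inr l) - X (Sum.inl j))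

theorem disc_dvd (l : Fin (s + 1)) (j : Fin (r + 1)) :
    (X (Sum.inr l) - X (Sum.inl j) : Syz r s) ∣ disc r s :=
  (Finset.dvd_prod_of_mem (fun j => (X (Sum.inr l) - X (Sum.inl j) : Syz r s))
    (Finset.mem_univ j)).trans
  (Finset.dvd_prod_of_mem (fun l => ∏ j : Fin (r + 1), (X (Sum.inr l) - X (Sum.inl j) : Syz r s))
    (Finset.mem_univ l))

theorem disc_sq_mul_mem_quasi (b : ℂ) (g : Syz r s) : disc r s ^ 2 * g ∈ quasi r s b := by
  intro l j
  have h0 : spec l j (disc r s) = 0 := spec_eq_zero_iff.2 (disc_dvd l j)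
  rw [pow_two, mul_assoc, defect_mul, defect_mul, map_mul, h0]
  simp

theorem act_disc (p) : act p (disc r s) = disc r s := by
  unfold disc act
  simp only [map_prod, map_sub, rename_X, Equiv.sumCongr_apply, Sum.map_inl, Sum.map_inr]
  rw [← Equiv.prod_comp p.2 fun l => ∏ j, (X (Sum.inr l) - X (Sum.inl j) : Syz r s)]
  exact Finset.prod_congr rfl fun l _ =>
    Equiv.prod_comp p.1 fun j => (X (Sum.inr (p.2 l)) - X (Sum.inl j) : Syz r s)

theorem disc_mem_symSub : disc r s ∈ symSub r s := act_disc

theorem isHomogeneous_disc : (disc r s).IsHomogeneous ((r + 1) * (s + 1)) := by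
  have := IsHomogeneous.prod (Finset.univ : Finset (Fin (s + 1)))
    (fun l => (∏ j : Fin (r + 1), (X (Sum.inr l) - X (Sum.inl j)) : Syz r s))
    (fun _ => r + 1) (fun l _ => by
      have := IsHomogeneous.prod (Finset.univ : Finset (Fin (r + 1)))
        (fun j => ((X (Sum.inr l) - X (Sum.inl j)) : Syz r s)) (fun _ => 1)
        (fun j _ => (isHomogeneous_X _ _).sub (isHomogeneous_X _ _))
      simpa using this)
  simpa [disc, mul_comm] using this

theorem linear_ne_zero (l : Fin (s + 1)) (j : Fin (r + 1)) :
    (X (Sum.inr l) - X (Sum.inl j) : Syz r s) ≠ 0 := by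
  rw [sub_ne_zero]
  intro h
  exact absurd (X_injective h) (by simp)

theorem disc_ne_zero : disc r s ≠ 0 :=
  Finset.prod_ne_zero_iff.2 fun l _ => Finset.prod_ne_zero_iff.2 fun j _ => linear_ne_zero l j

/-- Distinct linear forms `z_l - y_j` are pairwise coprime primes. -/
theorem prod_linear_dvd (T : Finset (Fin (s + 1) × Fin (r + 1))) {f : Syz r s}
    (h : ∀ p ∈ T, (X (Sum.inr p.1) - X (Sum.inl p.2) : Syz r s) ∣ f) :
    ∏ p ∈ T, (X (Sum.inr p.1) - X (Sum.inl p.2) : Syz r s) ∣ f := by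
  have hprime : ∀ p : Fin (s + 1) × Fin (r + 1),
      Prime (X (Sum.inr p.1) - X (Sum.inl p.2) : Syz r s) := by
    intro p
    refine ⟨linear_ne_zero _ _, ?_, ?_⟩
    · intro hu
      have := hu.map (spec p.1 p.2)
      rw [map_sub, spec_X_self, spec_X_inl, sub_self] at this
      exact not_isUnit_zero this
    · intro a b hab
      simp only [← spec_eq_zero_iff] at hab ⊢
      rw [map_mul] at hab
      exact mul_eq_zero.1 hab
  have hcop : ∀ p q : Fin (s + 1) × Fin (r + 1), p ≠ q →
      ¬ (X (Sum.inr p.1) - X (Sum.inl p.2) : Syz r s) ∣ X (Sum.inr q.1) - X (Sum.inl q.2) := by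
    rintro ⟨l, j⟩ ⟨l', j'⟩ hpq hd
    rw [← spec_eq_zero_iff, map_sub, spec_X_inl] at hd
    simp only at hd
    by_cases hl : l' = l
    · subst hl
      rw [spec_X_self, sub_eq_zero] at hd
      have := X_injective hd
      simp at this
      exact hpq (by rw [this])
    · rw [spec_X_of_ne j hl] at hd
      exact linear_ne_zero _ _ hd
  refine Finset.prod_dvd_of_isRelPrime ?_ h
  intro p _ q _ hpq
  exact ((hprime p).irreducible.isRelPrime_iff_not_dvd).2 (hcop p q hpq)

theorem disc_dvd_of_forall {f : Syz r s}
    (h : ∀ l j, (X (Sum.inr l) - X (Sum.inl j) : Syz r s) ∣ f) : disc r s ∣ f := by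
  have := prod_linear_dvd Finset.univ (f := f) fun p _ => h p.1 p.2
  rwa [Fintype.prod_prod_type] at this

end

section
variable {r s : ℕ}

/-- The degree in the second block of variables. -/
def zdeg (ν : Fin (r + 1) ⊕ Fin (s + 1) →₀ ℕ) : ℕ := ∑ l, ν (Sum.inr l)

/-- Grading by the degree in the second block of variables. -/
def zgrade : Syz r s →ₐ[ℂ] Polynomial (Syz r s) :=
  aeval (Sum.elim (fun j => Polynomial.C (X (Sum.inl j)))
    (fun l => Polynomial.C (X (Sum.inr l)) * Polynomial.X))

theorem zgrade_monomial (μ : Fin (r + 1) ⊕ Fin (s + 1) →₀ ℕ) (c : ℂ) :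
    zgrade (monomial μ c) = Polynomial.C (monomial μ c) * Polynomial.X ^ zdeg μ := by
  rw [zgrade, aeval_monomial, Finsupp.prod_fintype _ _ (by simp), Fintype.prod_sum_type]
  simp only [Sum.elim_inl, Sum.elim_inr, mul_pow, Finset.prod_mul_distrib, zdeg]
  rw [Finset.prod_pow_eq_pow_sum, monomial_eq, Finsupp.prod_fintype _ _ (by simp),
    Fintype.prod_sum_type]
  simp only [map_mul, map_prod, map_pow]
  have : algebraMap ℂ (Polynomial (Syz r s)) c = Polynomial.C (C c) := rfl
  rw [this]
  ring

theorem coeff_zgrade (f : Syz r s) (e : ℕ) (ν : Fin (r + 1) ⊕ Fin (s + 1) →₀ ℕ) :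
    coeff ν ((zgrade f).coeff e) = if zdeg ν = e then coeff ν f else 0 := by
  classical
  induction f using MvPolynomial.induction_on' with
  | monomial μ c =>
    rw [zgrade_monomial, Polynomial.coeff_C_mul, Polynomial.coeff_X_pow]
    by_cases h : μ = ν
    · subst h
      by_cases h2 : zdeg μ = e
      · simp [h2]
      · simp [h2, Ne.symm h2]
    · split_ifs <;> simp [coeff_monomial, h]
  | add p q hp hq =>
    rw [map_add, Polynomial.coeff_add, coeff_add, hp, hq, coeff_add]
    split_ifs <;> simp

theorem exists_gap_of_mem_quasi_zero {f : Syz r s} (hf : f ∈ quasi r s 0) (h0 : f ≠ 0) :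
    ∃ ν ∈ f.support, ∀ i, ν i = 0 ∨ gp r s (r + 2) i ≤ ν i := by
  have hz : zgrade f ≠ 0 := by
    intro h
    apply h0
    ext ν
    have := coeff_zgrade f (zdeg ν) ν
    rw [h, if_pos rfl] at this
    simpa using this.symm
  set d := (zgrade f).natDegree with hd
  have htop : (zgrade f).coeff d ≠ 0 := Polynomial.leadingCoeff_ne_zero.2 hz
  obtain ⟨ν, hν⟩ := MvPolynomial.exists_coeff_ne_zero htop
  have hν' := coeff_zgrade f d ν
  have hνd : zdeg ν = d := by
    by_contra h
    rw [if_neg h] at hν'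
    exact hν hν'
  rw [if_pos hνd] at hν'
  rw [hν'] at hν
  have hle : ∀ μ, coeff μ f ≠ 0 → zdeg μ ≤ d := by
    intro μ hμ
    apply Polynomial.le_natDegree_of_ne_zero
    intro h
    apply hμ
    have := coeff_zgrade f (zdeg μ) μ
    rw [h, if_pos rfl] at this
    simpa using this.symm
  refine ⟨ν, mem_support_iff.2 hν, ?_⟩
  rintro (j | l)
  · simp only [gp, Sum.elim_inl]
    omega
  · simp only [gp, Sum.elim_inr]
    by_cases hl : ν (Sum.inr l) = 0
    · exact Or.inl hl
    right
    set ν' := ν - Finsupp.single (Sum.inr l) 1 with hνe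
    have hadd : ν' + Finsupp.single (Sum.inr l) 1 = ν := by
      ext i
      by_cases hi : i = Sum.inr l
      · subst hi
        simp [hνe]
        omega
      · simp [hνe, Ne.symm hi]
    have hzadd : ∀ μ : Fin (r + 1) ⊕ Fin (s + 1) →₀ ℕ,
        zdeg (μ + Finsupp.single (Sum.inr l) 1) = zdeg μ + 1 := by
      intro μ
      simp only [zdeg, Finsupp.add_apply, Finset.sum_add_distrib]
      congr 1
      rw [Finset.sum_eq_single l] <;> simp +contextual [eq_comm]
    have hg : coeff ν' (pderiv (Sum.inr l) f) ≠ 0 := by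
      rw [coeff_pderiv, hadd]
      exact mul_ne_zero hν (Nat.cast_add_one_ne_zero _)
    have hdz : zdeg ν' + 1 = d := by rw [← hzadd, hadd, hνd]
    obtain ⟨g, hgf⟩ : ∏ j : Fin (r + 1), (X (Sum.inr l) - X (Sum.inl j) : Syz r s) ∣
        pderiv (Sum.inr l) f := by
      have := prod_linear_dvd ({l} ×ˢ (Finset.univ : Finset (Fin (r + 1))))
        (f := pderiv (Sum.inr l) f) (by
          rintro ⟨l', j⟩ hp
          simp only [Finset.mem_product, Finset.mem_singleton, Finset.mem_univ, and_true] at hp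
          subst hp
          have := hf l' j
          rw [defect_apply, zero_smul, sub_zero, spec_eq_zero_iff] at this
          exact this)
      rwa [Finset.prod_product, Finset.prod_singleton] at this
    have hnd : (zgrade (pderiv (Sum.inr l) f)).natDegree = zdeg ν' := by
      apply le_antisymm
      · rw [Polynomial.natDegree_le_iff_coeff_eq_zero]
        intro e he
        ext μ
        rw [coeff_zgrade, coeff_zero]
        split_ifs with hμ
        · rw [coeff_pderiv]
          by_contra hne
          have := hle _ (left_ne_zero_of_mul hne)
          rw [hzadd] at this
          omega
        · rfl
      · apply Polynomial.le_natDegree_of_ne_zero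
        intro h
        have := coeff_zgrade (pderiv (Sum.inr l) f) (zdeg ν') ν'
        rw [h, if_pos rfl, coeff_zero] at this
        exact hg this.symm
    have hlc : (zgrade (pderiv (Sum.inr l) f)).leadingCoeff =
        X (Sum.inr l) ^ (r + 1) * (zgrade g).leadingCoeff := by
      rw [hgf, map_mul, Polynomial.leadingCoeff_mul, map_prod, Polynomial.leadingCoeff_prod]
      congr 1
      have : ∀ j : Fin (r + 1), (zgrade (X (Sum.inr l) - X (Sum.inl j) : Syz r s)).leadingCoeff =
          X (Sum.inr l) := by
        intro j
        have e : zgrade (X (Sum.inr l) - X (Sum.inl j) : Syz r s) =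
            Polynomial.C (X (Sum.inr l)) * Polynomial.X + Polynomial.C (-X (Sum.inl j)) := by
          simp [zgrade, sub_eq_add_neg]
        rw [e, Polynomial.leadingCoeff_linear (X_ne_zero _)]
      rw [Finset.prod_congr rfl fun j _ => this j]
      simp
    have h1 := coeff_zgrade (pderiv (Sum.inr l) f) (zdeg ν') ν'
    rw [if_pos rfl, ← hnd, Polynomial.coeff_natDegree, hlc, X_pow_eq_monomial,
      coeff_monomial_mul'] at h1
    have h2 : Finsupp.single (Sum.inr l) (r + 1) ≤ ν' := by
      by_contra h
      rw [if_neg h] at h1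
      exact hg h1.symm
    have h3 := h2 (Sum.inr l)
    have h4 := DFunLike.congr_fun hadd (Sum.inr l)
    simp at h3 h4
    omega

variable (r s) in
/-- Keep only the monomials with gap exponents. -/
def gapPart : Syz r s →ₗ[ℂ] Syz r s :=
  (basisMonomials (Fin (r + 1) ⊕ Fin (s + 1)) ℂ).constr ℂ fun ν =>
    open Classical in if ∀ i, ν i = 0 ∨ gp r s (r + 2) i ≤ ν i then monomial ν 1 else 0

open Classical in
theorem gapPart_monomial (ν : Fin (r + 1) ⊕ Fin (s + 1) →₀ ℕ) (c : ℂ) :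
    gapPart r s (monomial ν c) =
      if ∀ i, ν i = 0 ∨ gp r s (r + 2) i ≤ ν i then monomial ν c else 0 := by
  have : monomial ν c = c • basisMonomials (Fin (r + 1) ⊕ Fin (s + 1)) ℂ ν := by
    rw [coe_basisMonomials, smul_monomial, smul_eq_mul, mul_one]
  rw [this, map_smul, gapPart, Module.Basis.constr_basis, smul_ite, smul_zero, smul_monomial,
    smul_eq_mul, mul_one, coe_basisMonomials, smul_monomial, smul_eq_mul, mul_one]

open Classical in
theorem coeff_gapPart (f : Syz r s) (ν : Fin (r + 1) ⊕ Fin (s + 1) →₀ ℕ) :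
    coeff ν (gapPart r s f) = if ∀ i, ν i = 0 ∨ gp r s (r + 2) i ≤ ν i then coeff ν f else 0 := by
  induction f using MvPolynomial.induction_on' with
  | monomial μ c =>
    rw [gapPart_monomial]
    by_cases h : μ = ν
    · subst h
      split_ifs <;> simp
    · split_ifs <;> simp [coeff_monomial, h]
  | add p q hp hq =>
    rw [map_add, coeff_add, hp, hq, coeff_add]
    split_ifs <;> simp

theorem gapPart_mem_gapAlg (f : Syz r s) : gapPart r s f ∈ gapAlg (gp r s (r + 2)) := by
  classical
  intro ν hν
  rw [mem_support_iff, coeff_gapPart] at hν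
  by_contra h
  rw [if_neg h] at hν
  exact hν rfl

theorem gapPart_isHomogeneous {f : Syz r s} {k : ℕ} (hf : f.IsHomogeneous k) :
    (gapPart r s f).IsHomogeneous k := by
  classical
  intro ν hν
  rw [coeff_gapPart] at hν
  split_ifs at hν with h
  · exact hf hν
  · exact absurd rfl hν

theorem gapPart_act (p) (f : Syz r s) : gapPart r s (act p f) = act p (gapPart r s f) := by
  classical
  induction f using MvPolynomial.induction_on' with
  | monomial μ c =>
    rw [act, rename_monomial, gapPart_monomial, gapPart_monomial]
    have : (∀ i, (Finsupp.mapDomain (Equiv.sumCongr p.1 p.2) μ) i = 0 ∨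
        gp r s (r + 2) i ≤ (Finsupp.mapDomain (Equiv.sumCongr p.1 p.2) μ) i) ↔
        ∀ i, μ i = 0 ∨ gp r s (r + 2) i ≤ μ i := by
      rw [← (Equiv.sumCongr p.1 p.2).forall_congr_right]
      refine forall_congr' fun i => ?_
      rw [Finsupp.mapDomain_apply (Equiv.injective _)]
      have : gp r s (r + 2) (Equiv.sumCongr p.1 p.2 i) = gp r s (r + 2) i := by
        rcases i with j | l <;> simp [gp]
      rw [this]
    simp only [this]
    split_ifs
    · rw [rename_monomial]
    · rw [map_zero]
  | add p q hp hq => rw [map_add, map_add, hp, hq, map_add, map_add]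

theorem gapPart_mem_symSub {f : Syz r s} (hf : f ∈ symSub r s) : gapPart r s f ∈ symSub r s := by
  intro p
  rw [← gapPart_act, hf p]

theorem eq_zero_of_gapPart_eq_zero {f : Syz r s} (hf : f ∈ quasi r s 0)
    (h : gapPart r s f = 0) : f = 0 := by
  classical
  by_contra h0
  obtain ⟨ν, hν, hg⟩ := exists_gap_of_mem_quasi_zero hf h0
  have := coeff_gapPart f ν
  rw [h, if_pos hg, coeff_zero] at this
  exact mem_support_iff.1 hν this.symm

end

section
variable (r s : ℕ)

instance finite_homogeneousSubmodule {σ : Type*} [Finite σ] (k : ℕ) :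
    Module.Finite ℂ (homogeneousSubmodule σ ℂ k) :=
  Module.Finite.iff_fg.2 (homogeneousSubmodule_fg (σ := σ) (R := ℂ) k)

/-- Homogeneous symmetric polynomials of degree `k`. -/
def symComp (k : ℕ) : Submodule ℂ (Syz r s) :=
  Subalgebra.toSubmodule (symSub r s) ⊓ homogeneousSubmodule _ ℂ k

/-- Homogeneous symmetric quasi-invariants of degree `k`. -/
def quasiComp (b : ℂ) (k : ℕ) : Submodule ℂ (Syz r s) :=
  Subalgebra.toSubmodule (quasi r s b) ⊓ symComp r s k

/-- Homogeneous symmetric elements of the gap algebra, of degree `k`. -/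
def gapComp (k : ℕ) : Submodule ℂ (Syz r s) :=
  Subalgebra.toSubmodule (gapAlg (gp r s (r + 2))) ⊓ symComp r s k

instance finite_symComp (k : ℕ) : Module.Finite ℂ (symComp r s k) :=
  Submodule.finiteDimensional_of_le (inf_le_right :
    symComp r s k ≤ homogeneousSubmodule (Fin (r + 1) ⊕ Fin (s + 1)) ℂ k)

instance finite_quasiComp (b : ℂ) (k : ℕ) : Module.Finite ℂ (quasiComp r s b k) :=
  Submodule.finiteDimensional_of_le (inf_le_right : quasiComp r s b k ≤ symComp r s k)

instance finite_gapComp (k : ℕ) : Module.Finite ℂ (gapComp r s k) :=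
  Submodule.finiteDimensional_of_le (inf_le_right : gapComp r s k ≤ symComp r s k)

theorem finrank_quasiComp_le (k : ℕ) : ∃ D : Set ℂ, D.Finite ∧ ∀ b ∉ D,
    Module.finrank ℂ (quasiComp r s b k) ≤ Module.finrank ℂ (quasiComp r s 0 k) := by
  let L0 : symComp r s k →ₗ[ℂ] (Fin (s + 1) × Fin (r + 1) → Syz r s) :=
    LinearMap.pi fun p => defect 0 p.1 p.2 ∘ₗ (symComp r s k).subtype
  let L1 : symComp r s k →ₗ[ℂ] (Fin (s + 1) × Fin (r + 1) → Syz r s) :=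
    LinearMap.pi fun p => (defect 1 p.1 p.2 - defect 0 p.1 p.2) ∘ₗ (symComp r s k).subtype
  have key : ∀ b, Module.finrank ℂ (LinearMap.ker (L0 + b • L1)) =
      Module.finrank ℂ (quasiComp r s b k) := by
    intro b
    rw [← Submodule.finrank_map_subtype_eq]
    suffices h : (LinearMap.ker (L0 + b • L1)).map (symComp r s k).subtype = quasiComp r s b k by
      rw [h]
    have hb : ∀ f : symComp r s k, ∀ p, (L0 + b • L1) f p = defect b p.1 p.2 f.1 := by
      intro f p
      simp only [L0, L1, LinearMap.add_apply, LinearMap.smul_apply, Pi.add_apply, Pi.smul_apply,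
        LinearMap.pi_apply, LinearMap.comp_apply, Submodule.subtype_apply, LinearMap.sub_apply,
        defect_apply, zero_smul, one_smul, sub_zero, smul_sub]
      abel
    ext f
    constructor
    · rintro ⟨f, hf, rfl⟩
      refine ⟨fun l j => ?_, f.2⟩
      have := congrFun (LinearMap.mem_ker.1 hf) (l, j)
      rw [hb] at this
      exact this
    · rintro ⟨h1, h2⟩
      refine ⟨⟨f, h2⟩, LinearMap.mem_ker.2 (funext fun p => ?_), rfl⟩
      rw [hb]
      exact h1 p.1 p.2
  obtain ⟨D, hD, h⟩ := finrank_ker_pencil L0 L1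
  refine ⟨D, hD, fun b hb => ?_⟩
  rw [← key b, ← key 0, zero_smul, add_zero]
  exact h b hb

theorem finrank_quasiComp_zero_le (k : ℕ) :
    Module.finrank ℂ (quasiComp r s 0 k) ≤ Module.finrank ℂ (gapComp r s k) := by
  let φ : quasiComp r s 0 k →ₗ[ℂ] gapComp r s k :=
    ((gapPart r s) ∘ₗ (quasiComp r s 0 k).subtype).codRestrict _ fun f =>
      ⟨gapPart_mem_gapAlg _, gapPart_mem_symSub f.2.2.1, gapPart_isHomogeneous f.2.2.2⟩
  refine LinearMap.finrank_le_finrank_of_injective (f := φ) ?_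
  rw [← LinearMap.ker_eq_bot, LinearMap.ker_eq_bot']
  intro f hf
  apply Subtype.ext
  exact eq_zero_of_gapPart_eq_zero f.2.1 (congrArg Subtype.val hf)

variable {r s}

/-- The rescaling `y ↦ δ² y`. -/
def scal (δ : ℂ) : Syz r s →ₐ[ℂ] Syz r s :=
  aeval (Sum.elim (fun j => δ ^ 2 • X (Sum.inl j)) (fun l => X (Sum.inr l)))

theorem scal_X_inl (δ : ℂ) (j : Fin (r + 1)) :
    scal δ (X (Sum.inl j) : Syz r s) = δ ^ 2 • X (Sum.inl j) := by simp [scal]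

theorem scal_X_inr (δ : ℂ) (l : Fin (s + 1)) :
    scal δ (X (Sum.inr l) : Syz r s) = X (Sum.inr l) := by simp [scal]

theorem scal_scal (δ ε : ℂ) (f : Syz r s) : scal δ (scal ε f) = scal (δ * ε) f := by
  have : (scal δ).comp (scal ε) = (scal (δ * ε) : Syz r s →ₐ[ℂ] Syz r s) := by
    apply algHom_ext
    rintro (j | l)
    · rw [AlgHom.comp_apply, scal_X_inl, map_smul, scal_X_inl, scal_X_inl, smul_smul]
      congr 1
      ring
    · rw [AlgHom.comp_apply, scal_X_inr, scal_X_inr, scal_X_inr]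
  exact AlgHom.congr_fun this f

theorem scal_one (f : Syz r s) : scal 1 f = f := by
  have : scal 1 = AlgHom.id ℂ (Syz r s) := by
    apply algHom_ext
    rintro (j | l)
    · rw [scal_X_inl]; simp
    · rw [scal_X_inr]; simp
  rw [this]; rfl

theorem scal_inv_scal {δ : ℂ} (hδ : δ ≠ 0) (f : Syz r s) : scal δ⁻¹ (scal δ f) = f := by
  rw [scal_scal, inv_mul_cancel₀ hδ, scal_one]

theorem scal_scal_inv {δ : ℂ} (hδ : δ ≠ 0) (f : Syz r s) : scal δ (scal δ⁻¹ f) = f := by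
  rw [scal_scal, mul_inv_cancel₀ hδ, scal_one]

theorem scal_isHomogeneous {f : Syz r s} {k : ℕ} (hf : f.IsHomogeneous k) (δ : ℂ) :
    (scal δ f).IsHomogeneous k := by
  have h := hf.aeval (n := 1) (Sum.elim (fun j => δ ^ 2 • X (Sum.inl j)) (fun l => X (Sum.inr l)) :
    Fin (r + 1) ⊕ Fin (s + 1) → Syz r s) (by
      rintro (j | l)
      · simp only [Sum.elim_inl, smul_eq_C_mul]
        exact (isHomogeneous_X _ _).C_mul _
      · exact isHomogeneous_X _ _)
  rwa [one_mul] at h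

theorem scal_act (p) (δ : ℂ) (f : Syz r s) : act p (scal δ f) = scal δ (act p f) := by
  have : (act p).comp (scal δ) = (scal δ : Syz r s →ₐ[ℂ] Syz r s).comp (act p) := by
    apply algHom_ext
    rintro (j | l)
    · rw [AlgHom.comp_apply, AlgHom.comp_apply, scal_X_inl, map_smul]
      simp [act, scal]
    · rw [AlgHom.comp_apply, AlgHom.comp_apply, scal_X_inr]
      simp [act, scal]
  exact AlgHom.congr_fun this f

theorem scal_mem_symSub {f : Syz r s} (hf : f ∈ symSub r s) (δ : ℂ) : scal δ f ∈ symSub r s := by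
  intro p
  rw [scal_act, hf p]

theorem scal_py (δ : ℂ) (k : ℕ) : scal δ (py r s k) = (δ ^ 2) ^ k • py r s k := by
  simp only [py, map_sum, map_pow, scal_X_inl, smul_pow, Finset.smul_sum]

theorem scal_pz (δ : ℂ) (k : ℕ) : scal δ (pz r s k) = pz r s k := by
  simp only [pz, map_sum, map_pow, scal_X_inr]

theorem scal_mem_curves (f : Syz r s) : (fun δ => scal δ f) ∈ curves (Syz r s) := by
  rw [← mem_curveAlg]
  induction f using MvPolynomial.induction_on with
  | C c =>
    have : (fun δ : ℂ => scal δ (C c : Syz r s)) = algebraMap ℂ (ℂ → Syz r s) c := by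
      funext δ
      exact (scal δ).commutes c
    rw [this]
    exact Subalgebra.algebraMap_mem _ _
  | add p q hp hq =>
    have : (fun δ : ℂ => scal δ (p + q)) = (fun δ => scal δ p) + fun δ => scal δ q := by
      funext δ
      simp
    rw [this]
    exact Subalgebra.add_mem _ hp hq
  | mul_X p i hp =>
    have : (fun δ : ℂ => scal δ (p * X i)) = (fun δ => scal δ p) * fun δ => scal δ (X i) := by
      funext δ
      simp
    rw [this]
    refine Subalgebra.mul_mem _ hp ?_
    rcases i with j | l
    · simp only [scal_X_inl]
      exact pow_smul_mem_curves 2 _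
    · simp only [scal_X_inr]
      exact const_mem_curves _

theorem scal_zero_disc_sq : scal 0 (disc r s ^ 2) = xX r s := by
  simp only [disc, map_pow, map_prod, map_sub, scal_X_inl, scal_X_inr, xX]
  simp [← Finset.prod_pow, pow_mul]
  refine Finset.prod_congr rfl fun l _ => ?_
  ring

variable (r s) in
/-- The algebra of deformed power sums. -/
def dpsAlg (b : ℂ) : Subalgebra ℂ (Syz r s) :=
  Algebra.adjoin ℂ {f | ∃ k, 1 ≤ k ∧ f = dps r s b k}

theorem dps_mem_dpsAlg (b : ℂ) {k : ℕ} (hk : 1 ≤ k) : dps r s b k ∈ dpsAlg r s b :=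
  Algebra.subset_adjoin ⟨k, hk, rfl⟩

theorem dpsAlg_le_quasi (b : ℂ) : dpsAlg r s b ≤ quasi r s b :=
  Algebra.adjoin_le (by rintro _ ⟨k, -, rfl⟩; exact dps_mem_quasi b k)

theorem dpsAlg_le_symSub (b : ℂ) : dpsAlg r s b ≤ symSub r s :=
  Algebra.adjoin_le (by rintro _ ⟨k, -, rfl⟩; exact dps_mem_symSub b k)

theorem homogeneousComponent_mem_adjoin {σ : Type*} {T : Set (MvPolynomial σ ℂ)}
    (hT : ∀ f ∈ T, ∃ k, f.IsHomogeneous k) {f : MvPolynomial σ ℂ} (hf : f ∈ Algebra.adjoin ℂ T)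
    (k : ℕ) : homogeneousComponent k f ∈ Algebra.adjoin ℂ T := by
  classical
  induction hf using Algebra.adjoin_induction generalizing k with
  | mem f hf =>
    obtain ⟨d, hd⟩ := hT f hf
    rw [homogeneousComponent_of_mem hd]
    split_ifs
    · exact Algebra.subset_adjoin hf
    · exact Subalgebra.zero_mem _
  | algebraMap c =>
    rw [algebraMap_eq, homogeneousComponent_of_mem (isHomogeneous_C σ c)]
    split_ifs
    · exact Subalgebra.algebraMap_mem _ c
    · exact Subalgebra.zero_mem _
  | add f g _ _ hf hg =>
    rw [map_add]
    exact Subalgebra.add_mem _ (hf k) (hg k)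
  | mul f g _ _ hf hg =>
    rw [← sum_homogeneousComponent f, Finset.sum_mul, map_sum]
    refine Subalgebra.sum_mem _ fun i _ => ?_
    obtain ⟨w, hw, hw'⟩ := homogeneousComponent_mul_eq (k := k) (w := g)
      (homogeneousComponent_isHomogeneous i f)
    rw [hw]
    refine Subalgebra.mul_mem _ (hf i) ?_
    rcases hw' with rfl | ⟨-, rfl⟩
    · exact Subalgebra.zero_mem _
    · exact hg _

theorem homogeneousComponent_mem_dpsAlg {b : ℂ} {f : Syz r s} (hf : f ∈ dpsAlg r s b) (k : ℕ) :
    homogeneousComponent k f ∈ dpsAlg r s b :=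
  homogeneousComponent_mem_adjoin (by
    rintro _ ⟨k, -, rfl⟩
    exact ⟨k, isHomogeneous_dps b k⟩) hf k

end

section
variable (r s : ℕ)

/-- Rescaled deformed power sums, as curves. -/
def dpsCurve (k : ℕ) (δ : ℂ) : Syz r s :=
  if k ≤ r + 1 then py r s k + δ ^ (2 * r + 3 - 2 * k) • pz r s k
  else pz r s k + δ ^ (2 * k - (2 * r + 3)) • py r s k

theorem dpsCurve_mem_curves (k : ℕ) : dpsCurve r s k ∈ curves (Syz r s) := by
  unfold dpsCurve
  split_ifs
  · exact (curves _).add_mem (const_mem_curves _) (pow_smul_mem_curves _ _)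
  · exact (curves _).add_mem (const_mem_curves _) (pow_smul_mem_curves _ _)

theorem dpsCurve_zero (k : ℕ) :
    dpsCurve r s k 0 = if k ≤ r + 1 then py r s k else pz r s k := by
  unfold dpsCurve
  split_ifs
  · rw [zero_pow (by omega), zero_smul, add_zero]
  · rw [zero_pow (by omega), zero_smul, add_zero]

theorem isHomogeneous_dpsCurve (k : ℕ) (δ : ℂ) : (dpsCurve r s k δ).IsHomogeneous k := by
  unfold dpsCurve
  simp only [smul_eq_C_mul]
  split_ifs
  · exact (isHomogeneous_py _ _ _).add ((isHomogeneous_pz _ _ _).C_mul _)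
  · exact (isHomogeneous_pz _ _ _).add ((isHomogeneous_py _ _ _).C_mul _)

theorem scal_inv_dpsCurve (k : ℕ) {δ : ℂ} (hδ : δ ≠ 0) :
    ∃ u : ℂ, u ≠ 0 ∧ scal δ⁻¹ (dpsCurve r s k δ) = u • dps r s (δ ^ (2 * r + 3)) k := by
  unfold dpsCurve
  split_ifs with h
  · refine ⟨(δ⁻¹ ^ 2) ^ k, by positivity, ?_⟩
    rw [map_add, map_smul, scal_py, scal_pz, dps, smul_add, smul_smul]
    congr 2
    obtain ⟨m, hm⟩ := Nat.exists_eq_add_of_le (show 2 * k ≤ 2 * r + 3 by omega)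
    rw [hm, Nat.add_sub_cancel_left, pow_add, ← pow_mul, inv_pow, inv_mul_cancel_left₀]
    positivity
  · refine ⟨(δ ^ (2 * r + 3))⁻¹, by positivity, ?_⟩
    rw [map_add, map_smul, scal_py, scal_pz, dps, smul_add, smul_smul, smul_smul,
      inv_mul_cancel₀ (by positivity), one_smul, add_comm]
    congr 2
    obtain ⟨m, hm⟩ := Nat.exists_eq_add_of_le (show 2 * r + 3 ≤ 2 * k by omega)
    rw [hm, Nat.add_sub_cancel_left, ← pow_mul, hm, inv_pow, pow_add, mul_inv, mul_comm, mul_assoc,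
      inv_mul_cancel₀ (by positivity), mul_one]

/-- Limits of the rescaled algebras of deformed power sums. -/
def limAlg : Subalgebra ℂ (Syz r s) where
  carrier := {f | ∃ F ∈ curveAlg (Syz r s), F 0 = f ∧
    ∀ δ, δ ≠ 0 → scal δ⁻¹ (F δ) ∈ dpsAlg r s (δ ^ (2 * r + 3))}
  mul_mem' := by
    rintro _ _ ⟨F, hF, rfl, h⟩ ⟨G, hG, rfl, h'⟩
    refine ⟨F * G, Subalgebra.mul_mem _ hF hG, rfl, fun δ hδ => ?_⟩
    rw [Pi.mul_apply, map_mul]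
    exact Subalgebra.mul_mem _ (h δ hδ) (h' δ hδ)
  add_mem' := by
    rintro _ _ ⟨F, hF, rfl, h⟩ ⟨G, hG, rfl, h'⟩
    refine ⟨F + G, Subalgebra.add_mem _ hF hG, rfl, fun δ hδ => ?_⟩
    rw [Pi.add_apply, map_add]
    exact Subalgebra.add_mem _ (h δ hδ) (h' δ hδ)
  algebraMap_mem' c := by
    refine ⟨algebraMap ℂ _ c, Subalgebra.algebraMap_mem _ c, rfl, fun δ hδ => ?_⟩
    rw [Pi.algebraMap_apply, AlgHom.commutes]
    exact Subalgebra.algebraMap_mem _ c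

theorem dpsCurve_zero_mem_limAlg {k : ℕ} (hk : 1 ≤ k) : dpsCurve r s k 0 ∈ limAlg r s := by
  refine ⟨dpsCurve r s k, dpsCurve_mem_curves r s k, rfl, fun δ hδ => ?_⟩
  obtain ⟨u, -, hu⟩ := scal_inv_dpsCurve r s k hδ
  rw [hu]
  exact Subalgebra.smul_mem _ (dps_mem_dpsAlg _ hk) _

variable {r s}

theorem exists_lift {f : Syz r s} {k : ℕ} (hf : f ∈ gapComp r s k) :
    ∃ F ∈ curves (Syz r s), F 0 = f ∧ (∀ δ, (F δ).IsHomogeneous k) ∧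
      ∀ δ, δ ≠ 0 → scal δ⁻¹ (F δ) ∈ dpsAlg r s (δ ^ (2 * r + 3)) := by
  obtain ⟨F, hF, h0, h⟩ : f ∈ limAlg r s := by
    refine gap_generated _ ?_ ?_ hf.1 hf.2.1
    · intro i h1 h2
      have := dpsCurve_zero_mem_limAlg r s h1
      rwa [dpsCurve_zero, if_pos h2] at this
    · intro i h2
      have := dpsCurve_zero_mem_limAlg r s (show 1 ≤ i by omega)
      rwa [dpsCurve_zero, if_neg (by omega)] at this
  have hcomm : ∀ δ : ℂ, ∀ g : Syz r s,
      scal δ (homogeneousComponent k g) = homogeneousComponent k (scal δ g) := by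
    intro δ g
    conv_rhs => rw [← sum_homogeneousComponent g]
    rw [map_sum, map_sum]
    simp only [homogeneousComponent_of_mem
      (scal_isHomogeneous (homogeneousComponent_isHomogeneous _ g) δ)]
    rw [Finset.sum_ite_eq]
    split_ifs with hk
    · rfl
    · rw [homogeneousComponent_eq_zero _ _ (by simpa using hk), map_zero]
  refine ⟨fun δ => homogeneousComponent k (F δ), map_mem_curves _ hF, ?_,
    fun δ => homogeneousComponent_isHomogeneous _ _, fun δ hδ => ?_⟩
  · simp only [h0]
    exact homogeneousComponent_eq_self hf.2.2
  · simp only [hcomm]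
    exact homogeneousComponent_mem_dpsAlg (h δ hδ) k

variable (r s) in
/-- Symmetric polynomials of degree `k - 2(r+1)(s+1)`. -/
def shiftComp (k : ℕ) : Submodule ℂ (Syz r s) :=
  if 2 * (r + 1) * (s + 1) ≤ k then symComp r s (k - 2 * (r + 1) * (s + 1)) else ⊥

instance finite_shiftComp (k : ℕ) : Module.Finite ℂ (shiftComp r s k) := by
  by_cases h : 2 * (r + 1) * (s + 1) ≤ k
  · rw [shiftComp, if_pos h]
    infer_instance
  · rw [shiftComp, if_neg h]
    infer_instance

theorem shiftComp_mem_symSub {k : ℕ} {g : Syz r s} (hg : g ∈ shiftComp r s k) :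
    g ∈ symSub r s := by
  unfold shiftComp at hg
  split_ifs at hg
  · exact hg.1
  · rw [Submodule.mem_bot] at hg
    rw [hg]
    exact Subalgebra.zero_mem _

theorem mul_shiftComp_isHomogeneous {t : Syz r s} (ht : t.IsHomogeneous (2 * (r + 1) * (s + 1)))
    {k : ℕ} {g : Syz r s} (hg : g ∈ shiftComp r s k) : (t * g).IsHomogeneous k := by
  unfold shiftComp at hg
  split_ifs at hg with h
  · have := ht.mul hg.2
    rwa [Nat.add_sub_cancel' h] at this
  · rw [Submodule.mem_bot] at hg
    rw [hg, mul_zero]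
    exact isHomogeneous_zero _ _ _

theorem scal_mem_shiftComp {k : ℕ} {g : Syz r s} (hg : g ∈ shiftComp r s k) (δ : ℂ) :
    scal δ g ∈ shiftComp r s k := by
  unfold shiftComp at hg ⊢
  split_ifs at hg ⊢ with h
  · exact ⟨scal_mem_symSub hg.1 δ, scal_isHomogeneous hg.2 δ⟩
  · rw [Submodule.mem_bot] at hg ⊢
    rw [hg, map_zero]

theorem exists_shiftComp {t : Syz r s} (ht : t.IsHomogeneous (2 * (r + 1) * (s + 1))) (h0 : t ≠ 0)
    (hts : t ∈ symSub r s) {k : ℕ} {h : Syz r s} (hs : homogeneousComponent k (t * h) ∈ symSub r s) :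
    ∃ g ∈ shiftComp r s k, homogeneousComponent k (t * h) = t * g := by
  obtain ⟨g, hg, hg'⟩ := homogeneousComponent_mul_eq (k := k) (w := h) ht
  refine ⟨g, ?_, hg⟩
  have hgs : g ∈ symSub r s := by
    intro p
    have := hs p
    rw [hg, map_mul, hts p] at this
    exact mul_left_cancel₀ h0 this
  unfold shiftComp
  rcases hg' with rfl | ⟨hk, rfl⟩
  · exact Submodule.zero_mem _
  · rw [if_pos hk]
    exact ⟨hgs, homogeneousComponent_isHomogeneous _ _⟩

theorem finite_wt {N : ℕ} {ι : Type*} [Finite ι] (d : ι → ℕ) (k : ℕ) :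
    {p : (Fin N → ℕ) × ι | wt d p = k}.Finite := by
  refine Set.Finite.subset (s := Set.pi Set.univ (fun _ : Fin N => Set.Iic k) ×ˢ Set.univ)
    (Set.Finite.prod (Set.Finite.pi fun _ => Set.finite_Iic k) Set.finite_univ) ?_
  rintro p hp
  refine ⟨fun i _ => ?_, trivial⟩
  rw [Set.mem_ofPred_eq, wt] at hp
  have h1 : (i.1 + 1) * p.1 i ≤ ∑ i : Fin N, (i.1 + 1) * p.1 i :=
    Finset.single_le_sum (f := fun i : Fin N => (i.1 + 1) * p.1 i) (fun _ _ => Nat.zero_le _)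
      (Finset.mem_univ i)
  have h2 : p.1 i ≤ (i.1 + 1) * p.1 i := Nat.le_mul_of_pos_left _ (by omega)
  rw [Set.mem_Iic]
  exact h2.trans (h1.trans (hp ▸ Nat.le_add_right _ _))

end

section
variable {r s : ℕ}

theorem linearIndependent_sumElim_mul {P J : Type*} {v : P → Syz r s} {x : Syz r s} (hx : x ≠ 0)
    {g : J → Syz r s} (hg : LinearIndependent ℂ g)
    (hv : ∀ w : P →₀ ℂ, x ∣ Finsupp.linearCombination ℂ v w → w = 0) :
    LinearIndependent ℂ (Sum.elim v fun i => x * g i) := by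
  refine LinearIndependent.sum_type ?_ ?_ ?_
  · rw [linearIndependent_iff]
    intro w hw
    exact hv w (hw ▸ dvd_zero x)
  · exact hg.map' (LinearMap.mulLeft ℂ x) (LinearMap.ker_eq_bot.2 (mul_right_injective₀ hx))
  · rw [Submodule.disjoint_def]
    intro y h1 h2
    rw [Finsupp.mem_span_range_iff_exists_finsupp] at h1
    obtain ⟨w, rfl⟩ := h1
    have h3 : Submodule.span ℂ (Set.range fun i => x * g i) ≤
        LinearMap.range (LinearMap.mulLeft ℂ x) := by
      rw [Submodule.span_le]
      rintro _ ⟨i, rfl⟩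
      exact ⟨g i, rfl⟩
    obtain ⟨u, hu⟩ := h3 h2
    have := hv w ⟨u, hu.symm⟩
    rw [this, Finsupp.sum_zero_index]

theorem IsGapBasis.span_range_eq {ι : Type*} {d : ι → ℕ} {β : ι → Syz r s}
    (hG : IsGapBasis r s d β) {k : ℕ} {J : Type*} {g : J → Syz r s}
    (hg : Submodule.span ℂ (Set.range g) = shiftComp r s k) :
    Submodule.span ℂ (Set.range (Sum.elim
      (fun p : {p : (Fin (r + 1 + s) → ℕ) × ι // wt d p = k} =>
        tb (fun i : Fin (r + 1 + s) => thX r s i) β p) fun i => xX r s * g i)) =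
      gapComp r s k := by
  have hhom : ∀ p, wt d p = k →
      (tb (fun i : Fin (r + 1 + s) => thX r s i) β p).IsHomogeneous k := fun p hp =>
    hp ▸ tb_isHomogeneous (fun i => isHomogeneous_thX r s i) hG.homog p
  apply le_antisymm
  · rw [Submodule.span_le]
    rintro _ ⟨p | i, rfl⟩
    · refine ⟨?_, ?_, ?_⟩
      · exact Subalgebra.mul_mem _ (Subalgebra.prod_mem _ fun i _ => Subalgebra.pow_mem _
          (thX_mem_gapAlg (by omega) _) _) (hG.mem_gap _)
      · exact Subalgebra.mul_mem _ (Subalgebra.prod_mem _ fun i _ => Subalgebra.pow_mem _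
          (thX_mem_symSub _) _) (hG.mem_sym _)
      · exact hhom p.1 p.2
    · have hi : g i ∈ shiftComp r s k := hg ▸ Submodule.subset_span ⟨i, rfl⟩
      exact ⟨xX_mul_mem _ (by omega), Subalgebra.mul_mem _ xX_mem_symSub (shiftComp_mem_symSub hi),
        mul_shiftComp_isHomogeneous isHomogeneous_xX hi⟩
  · rintro f ⟨h1, h2, h3⟩
    obtain ⟨h, hh, hs⟩ := hG.span k f h1 h2 h3
    have hk : (f - xX r s * h).IsHomogeneous k := by
      rw [← mem_homogeneousSubmodule]
      refine (Submodule.span_le.2 ?_) hs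
      rintro _ ⟨p, hp, rfl⟩
      exact hhom p hp
    have hxk : homogeneousComponent k (xX r s * h) = xX r s * h := by
      apply homogeneousComponent_eq_self
      have := h3.sub hk
      rwa [sub_sub_cancel] at this
    obtain ⟨g', hg', e⟩ := exists_shiftComp (k := k) (h := h) isHomogeneous_xX xX_ne_zero
      xX_mem_symSub (by rw [hxk]; exact Subalgebra.mul_mem _ xX_mem_symSub hh)
    rw [← sub_add_cancel f (xX r s * h), ← hxk, e]
    rw [Set.Sum.elim_range, Submodule.span_union]
    refine Submodule.add_mem_sup ?_ ?_
    · rw [← e, hxk]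
      refine Submodule.span_mono ?_ hs
      rintro _ ⟨p, hp, rfl⟩
      exact ⟨⟨p, hp⟩, rfl⟩
    · rw [← hg] at hg'
      have := Submodule.mem_map_of_mem (f := LinearMap.mulLeft ℂ (xX r s)) hg'
      rw [Submodule.map_span, ← Set.range_comp] at this
      exact this

theorem IsGapBasis.linearIndependent {ι : Type*} {d : ι → ℕ} {β : ι → Syz r s}
    (hG : IsGapBasis r s d β) {k : ℕ} {J : Type*} {g : J → Syz r s}
    (hg : LinearIndependent ℂ g) :
    LinearIndependent ℂ (Sum.elim
      (fun p : {p : (Fin (r + 1 + s) → ℕ) × ι // wt d p = k} =>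
        tb (fun i : Fin (r + 1 + s) => thX r s i) β p) fun i => xX r s * g i) := by
  refine linearIndependent_sumElim_mul xX_ne_zero hg fun w hw => ?_
  have h := hG.indep (w.mapDomain Subtype.val) (by rwa [Finsupp.linearCombination_mapDomain])
  exact Finsupp.mapDomain_injective Subtype.val_injective (h.trans Finsupp.mapDomain_zero.symm)

theorem IsGapBasis.finrank_gapComp {ι : Type*} [Finite ι] {d : ι → ℕ} {β : ι → Syz r s}
    (hG : IsGapBasis r s d β) (k : ℕ) :
    Module.finrank ℂ (gapComp r s k) =
      Nat.card {p : (Fin (r + 1 + s) → ℕ) × ι // wt d p = k} +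
        Module.finrank ℂ (shiftComp r s k) := by
  have := (finite_wt (N := r + 1 + s) d k).fintype
  let g := Module.finBasis ℂ (shiftComp r s k)
  have hg : LinearIndependent ℂ (fun i => (g i : Syz r s)) :=
    g.linearIndependent.map' (shiftComp r s k).subtype (Submodule.ker_subtype _)
  have hg' : Submodule.span ℂ (Set.range fun i => (g i : Syz r s)) = shiftComp r s k := by
    have := congrArg (Submodule.map (shiftComp r s k).subtype) g.span_eq
    rwa [Submodule.map_span, ← Set.range_comp, Submodule.map_top, Submodule.range_subtype] at this
  have : Fintype {p : (Fin (r + 1 + s) → ℕ) × ι // wt d p = k} := this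
  rw [← hG.span_range_eq hg', finrank_span_eq_card (hG.linearIndependent hg),
    Fintype.card_sum, Fintype.card_fin, Nat.card_eq_fintype_card]

/-- Families in the algebra of deformed power sums which behave like a basis modulo the square of
the discriminant. -/
structure IsQuasiBasis (r s : ℕ) (b : ℂ) {ι : Type*} (t : Fin (r + 1 + s) → Syz r s) (d : ι → ℕ)
    (β : ι → Syz r s) : Prop where
  t_eq : ∀ i, ∃ u : ℂ, u ≠ 0 ∧ t i = u • dps r s b (i + 1)
  mem : ∀ j, β j ∈ dpsAlg r s b
  homog : ∀ j, (β j).IsHomogeneous (d j)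
  indep : ∀ w : (Fin (r + 1 + s) → ℕ) × ι →₀ ℂ,
    disc r s ^ 2 ∣ Finsupp.linearCombination ℂ (tb t β) w → w = 0
  span : ∀ k, ∀ f ∈ quasiComp r s b k, ∃ h,
    f - disc r s ^ 2 * h ∈ Submodule.span ℂ (tb t β '' {p | wt d p = k})

theorem isHomogeneous_disc_sq : (disc r s ^ 2).IsHomogeneous (2 * (r + 1) * (s + 1)) := by
  have := (isHomogeneous_disc (r := r) (s := s)).pow 2
  rwa [show (r + 1) * (s + 1) * 2 = 2 * (r + 1) * (s + 1) by ring] at this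

theorem mem_dpsAlg_of_eq_smul_dps {b : ℂ} {t : Fin (r + 1 + s) → Syz r s}
    (ht : ∀ i, ∃ u : ℂ, u ≠ 0 ∧ t i = u • dps r s b (i + 1)) (i) :
    t i ∈ dpsAlg r s b := by
  obtain ⟨u, -, hu⟩ := ht i
  rw [hu]
  exact Subalgebra.smul_mem _ (dps_mem_dpsAlg b (by omega)) _

theorem isHomogeneous_of_eq_smul_dps {b : ℂ} {t : Fin (r + 1 + s) → Syz r s}
    (ht : ∀ i, ∃ u : ℂ, u ≠ 0 ∧ t i = u • dps r s b (i + 1)) (i) :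
    (t i).IsHomogeneous (i.1 + 1) := by
  obtain ⟨u, -, hu⟩ := ht i
  rw [hu, smul_eq_C_mul]
  exact (isHomogeneous_dps b _).C_mul _

theorem IsGapBasis.degree {ι : Type*} [Finite ι] {d : ι → ℕ} {β : ι → Syz r s}
    (hG : IsGapBasis r s d β) {F : ι → ℂ → Syz r s} (hF : ∀ j, F j ∈ curves (Syz r s))
    (hF0 : ∀ j, F j 0 = β j) (hFd : ∀ j δ, (F j δ).IsHomogeneous (d j))
    (hFm : ∀ j δ, δ ≠ 0 → scal δ⁻¹ (F j δ) ∈ dpsAlg r s (δ ^ (2 * r + 3))) (k : ℕ) :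
    ∃ D D' : Set ℂ, D.Finite ∧ D'.Finite ∧ ∀ δ, δ ≠ 0 → δ ∉ D → δ ^ (2 * r + 3) ∉ D' →
      (∀ w : {p : (Fin (r + 1 + s) → ℕ) × ι // wt d p = k} →₀ ℂ, ∀ h ∈ shiftComp r s k,
        Finsupp.linearCombination ℂ (fun p : {p : (Fin (r + 1 + s) → ℕ) × ι // wt d p = k} =>
          tb (fun i : Fin (r + 1 + s) => scal δ⁻¹ (dpsCurve r s (i + 1) δ))
          (fun j => scal δ⁻¹ (F j δ)) p) w = disc r s ^ 2 * h → w = 0) ∧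
      ∀ f ∈ quasiComp r s (δ ^ (2 * r + 3)) k, ∃ h,
        f - disc r s ^ 2 * h ∈ Submodule.span ℂ
          (tb (fun i : Fin (r + 1 + s) => scal δ⁻¹ (dpsCurve r s (i + 1) δ))
          (fun j => scal δ⁻¹ (F j δ)) '' {p | wt d p = k}) := by
  have hfin : Finite {p : (Fin (r + 1 + s) → ℕ) × ι // wt d p = k} :=
    (finite_wt (N := r + 1 + s) d k).to_subtype
  have := Fintype.ofFinite {p : (Fin (r + 1 + s) → ℕ) × ι // wt d p = k}
  let g := Module.finBasis ℂ (shiftComp r s k)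
  have hg : LinearIndependent ℂ (fun i => (g i : Syz r s)) :=
    g.linearIndependent.map' (shiftComp r s k).subtype (Submodule.ker_subtype _)
  have hg' : Submodule.span ℂ (Set.range fun i => (g i : Syz r s)) = shiftComp r s k := by
    have := congrArg (Submodule.map (shiftComp r s k).subtype) g.span_eq
    rwa [Submodule.map_span, ← Set.range_comp, Submodule.map_top, Submodule.range_subtype] at this
  let G : {p : (Fin (r + 1 + s) → ℕ) × ι // wt d p = k} ⊕
      Fin (Module.finrank ℂ (shiftComp r s k)) → ℂ → Syz r s :=
    Sum.elim (fun p δ => tb (fun i : Fin (r + 1 + s) => dpsCurve r s (i + 1) δ)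
      (fun j => F j δ) p.1) fun i δ => scal δ (disc r s ^ 2) * (g i : Syz r s)
  have hGc : ∀ q, G q ∈ curves (Syz r s) := by
    rintro (p | i)
    · have : G (Sum.inl p) = (∏ i : Fin (r + 1 + s), dpsCurve r s (i + 1) ^ p.1.1 i) * F p.1.2 := by
        funext δ
        simp [G, tb]
      rw [this, ← mem_curveAlg]
      exact Subalgebra.mul_mem _ (Subalgebra.prod_mem _ fun i _ => Subalgebra.pow_mem _
        (dpsCurve_mem_curves r s _) _) (hF _)
    · exact mul_mem_curves (scal_mem_curves _) (const_mem_curves _)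
  have hG0 : (fun q => G q 0) = Sum.elim
      (fun p : {p : (Fin (r + 1 + s) → ℕ) × ι // wt d p = k} =>
        tb (fun i : Fin (r + 1 + s) => thX r s i) β p) fun i => xX r s * g i := by
    funext q
    rcases q with p | i
    · simp only [G, Sum.elim_inl, dpsCurve_zero, hF0, tb, thX, Order.add_one_le_iff]
    · simp only [G, Sum.elim_inr, scal_zero_disc_sq]
  obtain ⟨D, hD, hDi⟩ := linearIndependent_curves G hGc (by
    rw [hG0]; exact hG.linearIndependent hg)
  obtain ⟨D', hD', hDi'⟩ := finrank_quasiComp_le r s k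
  refine ⟨D, D', hD, hD', fun δ hδ h1 h2 => ?_⟩
  let t := fun i : Fin (r + 1 + s) => scal δ⁻¹ (dpsCurve r s (i + 1) δ)
  let β' := fun j => scal δ⁻¹ (F j δ)
  let v : {p : (Fin (r + 1 + s) → ℕ) × ι // wt d p = k} → Syz r s := fun p => tb t β' p.1
  let u : Fin (Module.finrank ℂ (shiftComp r s k)) → Syz r s :=
    fun i => disc r s ^ 2 * scal δ⁻¹ (g i)
  have hinj : Function.Injective (scal δ⁻¹ : Syz r s → Syz r s) :=
    Function.LeftInverse.injective (g := scal δ) (scal_scal_inv hδ)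
  have hE : Sum.elim v u = fun q => scal δ⁻¹ (G q δ) := by
    funext q
    rcases q with p | i
    · simp only [v, G, Sum.elim_inl, tb, map_mul, map_prod, map_pow, t, β']
    · simp only [u, G, Sum.elim_inr, map_mul, scal_inv_scal hδ]
  have hEi : LinearIndependent ℂ (Sum.elim v u) := by
    rw [hE]
    exact (hDi δ h1).map' (scal δ⁻¹).toLinearMap (LinearMap.ker_eq_bot.2 hinj)
  have ht : ∀ i, t i ∈ dpsAlg r s (δ ^ (2 * r + 3)) := by
    intro i
    obtain ⟨c, -, hc⟩ := scal_inv_dpsCurve r s (i + 1) hδ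
    simp only [t, hc]
    exact Subalgebra.smul_mem _ (dps_mem_dpsAlg _ (by omega)) _
  have hEm : Submodule.span ℂ (Set.range (Sum.elim v u)) ≤
      quasiComp r s (δ ^ (2 * r + 3)) k := by
    rw [Submodule.span_le]
    rintro _ ⟨p | i, rfl⟩
    · have hm : tb t β' p.1 ∈ dpsAlg r s (δ ^ (2 * r + 3)) :=
        Subalgebra.mul_mem _ (Subalgebra.prod_mem _ fun i _ => Subalgebra.pow_mem _ (ht i) _)
          (hFm _ _ hδ)
      refine ⟨dpsAlg_le_quasi _ hm, dpsAlg_le_symSub _ hm, ?_⟩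
      have := tb_isHomogeneous (t := t) (β := β') (d := d)
        (fun i => scal_isHomogeneous (isHomogeneous_dpsCurve r s _ δ) _)
        (fun j => scal_isHomogeneous (hFd j δ) _) p.1
      rwa [p.2] at this
    · have hs := scal_mem_shiftComp (g i).2 δ⁻¹
      exact ⟨disc_sq_mul_mem_quasi _ _, Subalgebra.mul_mem _ (Subalgebra.pow_mem _
        disc_mem_symSub _) (shiftComp_mem_symSub hs),
        mul_shiftComp_isHomogeneous isHomogeneous_disc_sq hs⟩
  have hEs : Submodule.span ℂ (Set.range (Sum.elim v u)) =
      quasiComp r s (δ ^ (2 * r + 3)) k := by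
    refine Submodule.eq_of_le_of_finrank_le hEm ?_
    refine (hDi' _ h2).trans ((finrank_quasiComp_zero_le r s k).trans ?_)
    rw [hG.finrank_gapComp, finrank_span_eq_card hEi, Fintype.card_sum, Fintype.card_fin,
      Nat.card_eq_fintype_card]
  constructor
  · intro w h hh e
    have h3 := linearIndependent_sum.1 hEi
    have h4 : disc r s ^ 2 * h ∈ Submodule.span ℂ (Set.range u) := by
      have h5 := scal_mem_shiftComp hh δ
      rw [← hg'] at h5
      have h6 := Submodule.mem_map_of_mem
        (f := LinearMap.mulLeft ℂ (disc r s ^ 2) ∘ₗ (scal δ⁻¹).toLinearMap) h5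
      rw [Submodule.map_span, ← Set.range_comp, LinearMap.comp_apply, AlgHom.toLinearMap_apply,
        scal_inv_scal hδ] at h6
      exact h6
    have h7 : Finsupp.linearCombination ℂ v w ∈ Submodule.span ℂ (Set.range v) := by
      rw [← Finsupp.range_linearCombination]
      exact ⟨w, rfl⟩
    rw [← e] at h4
    have h8 := Submodule.disjoint_def.1 h3.2.2 _ h7 h4
    exact linearIndependent_iff.1 h3.1 w h8
  · intro f hf
    rw [← hEs, Set.Sum.elim_range, Submodule.span_union, Submodule.mem_sup] at hf
    obtain ⟨y, hy, z, hz, rfl⟩ := hf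
    have h3 : Submodule.span ℂ (Set.range u) ≤
        LinearMap.range (LinearMap.mulLeft ℂ (disc r s ^ 2)) := by
      rw [Submodule.span_le]
      rintro _ ⟨i, rfl⟩
      exact ⟨scal δ⁻¹ (g i), rfl⟩
    obtain ⟨h, rfl⟩ := h3 hz
    refine ⟨h, ?_⟩
    rw [LinearMap.mulLeft_apply, add_sub_cancel_right]
    refine Submodule.span_mono ?_ hy
    rintro _ ⟨p, rfl⟩
    exact ⟨p.1, p.2, rfl⟩

end

section
variable {r s : ℕ}

theorem homogeneousComponent_linearCombination {σ P : Type*} {v : P → MvPolynomial σ ℂ} {e : P → ℕ}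
    (hv : ∀ p, (v p).IsHomogeneous (e p)) (k : ℕ) (w : P →₀ ℂ) :
    homogeneousComponent k (Finsupp.linearCombination ℂ v w) =
      Finsupp.linearCombination ℂ (fun p : {p // e p = k} => v p)
        (w.subtypeDomain (fun p => e p = k)) := by
  classical
  induction w using Finsupp.induction_linear with
  | zero => simp
  | add f g hf hg => rw [map_add, map_add, hf, hg, Finsupp.subtypeDomain_add, map_add]
  | single p c =>
    rw [Finsupp.linearCombination_single, map_smul, homogeneousComponent_of_mem (hv p)]
    split_ifs with h
    · have : (Finsupp.single p c).subtypeDomain (fun p => e p = k) =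
          Finsupp.single ⟨p, h.symm⟩ c := by
        ext q
        simp [Finsupp.single_apply, Subtype.ext_iff]
      rw [this, Finsupp.linearCombination_single]
    · have : (Finsupp.single p c).subtypeDomain (fun p => e p = k) = 0 := by
        ext q
        rw [Finsupp.subtypeDomain_apply, Finsupp.single_apply, if_neg]
        · rfl
        · rintro rfl
          exact h q.2.symm
      rw [this, map_zero, smul_zero]

theorem IsGapBasis.exists_isQuasiBasis {ι : Type*} [Finite ι] {d : ι → ℕ} {β : ι → Syz r s}
    (hG : IsGapBasis r s d β) : ∃ E : Set ℂ, E.Countable ∧ ∀ b ∉ E,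
      ∃ t β', IsQuasiBasis r s b t d β' := by
  choose F hF hF0 hFd hFm using fun j => exists_lift (f := β j) (k := d j)
    ⟨hG.mem_gap j, hG.mem_sym j, hG.homog j⟩
  choose D D' hD hD' h using hG.degree hF hF0 hFd hFm
  refine ⟨{0} ∪ ((⋃ k, D' k) ∪ (fun δ : ℂ => δ ^ (2 * r + 3)) '' ⋃ k, D k), ?_, ?_⟩
  · exact (Set.countable_singleton _).union ((Set.countable_iUnion fun k => (hD' k).countable).union
      ((Set.countable_iUnion fun k => (hD k).countable).image _))
  · intro b hb
    simp only [Set.mem_union, not_or, Set.mem_singleton_iff, Set.mem_iUnion, not_exists] at hb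
    obtain ⟨hb0, hb1, hb2⟩ := hb
    obtain ⟨δ, rfl⟩ := IsAlgClosed.exists_pow_nat_eq b (show 0 < 2 * r + 3 by omega)
    have hδ : δ ≠ 0 := by
      rintro rfl
      exact hb0 (zero_pow (by omega))
    have hδD : ∀ k, δ ∉ D k := fun k hk => hb2 ⟨δ, Set.mem_iUnion.2 ⟨k, hk⟩, rfl⟩
    have hdeg : ∀ p, (tb (fun i : Fin (r + 1 + s) => scal δ⁻¹ (dpsCurve r s (i + 1) δ))
        (fun j => scal δ⁻¹ (F j δ)) p).IsHomogeneous (wt d p) :=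
      tb_isHomogeneous (fun i => scal_isHomogeneous (isHomogeneous_dpsCurve r s _ δ) _)
        (fun j => scal_isHomogeneous (hFd j δ) _)
    refine ⟨fun i => scal δ⁻¹ (dpsCurve r s (i + 1) δ), fun j => scal δ⁻¹ (F j δ),
      fun i => scal_inv_dpsCurve r s _ hδ, fun j => hFm j δ hδ,
      fun j => scal_isHomogeneous (hFd j δ) _, ?_,
      fun k => (h k δ hδ (hδD k) (hb1 k)).2⟩
    rintro w ⟨g, hg⟩
    have key : ∀ k, w.subtypeDomain (fun p => wt d p = k) = 0 := by
      intro k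
      have e1 := homogeneousComponent_linearCombination hdeg k w
      have hsym : homogeneousComponent k (disc r s ^ 2 * g) ∈ symSub r s := by
        rw [← hg]
        refine homogeneousComponent_mem_symSub ?_ k
        rw [Finsupp.linearCombination_apply]
        refine Subalgebra.sum_mem _ fun p _ => Subalgebra.smul_mem _ ?_ _
        refine Subalgebra.mul_mem _ (Subalgebra.prod_mem _ fun i _ => Subalgebra.pow_mem _ ?_ _)
          (dpsAlg_le_symSub _ (hFm _ δ hδ))
        obtain ⟨u, -, hu⟩ := scal_inv_dpsCurve r s (i + 1) hδ
        simp only [hu]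
        exact Subalgebra.smul_mem _ (dps_mem_symSub _ _) _
      obtain ⟨g', hg', e2⟩ := exists_shiftComp isHomogeneous_disc_sq (pow_ne_zero 2 disc_ne_zero)
        (Subalgebra.pow_mem _ disc_mem_symSub _) hsym
      refine (h k δ hδ (hδD k) (hb1 k)).1 _ g' hg' ?_
      rw [← e1, hg, e2]
    ext p
    exact DFunLike.congr_fun (key (wt d p)) ⟨p, rfl⟩

end

section
variable (r s : ℕ)

/-- Identification of the last variables of both blocks. -/
def res : Syz r s →ₐ[ℂ] Rxrs r s :=
  aeval (Sum.elim
    (Fin.lastCases (X (Sum.inl ())) fun j => X (Sum.inr (Sum.inl j)))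
    (Fin.lastCases (X (Sum.inl ())) fun l => X (Sum.inr (Sum.inr l))))

/-- A section of `res`, up to specialization. -/
def emb : Rxrs r s →ₐ[ℂ] Syz r s :=
  aeval (Sum.elim (fun _ => X (Sum.inl (Fin.last r)))
    (Sum.elim (fun j => X (Sum.inl j.castSucc)) fun l => X (Sum.inr l.castSucc)))

variable {r s}

theorem res_inl_last : res r s (X (Sum.inl (Fin.last r))) = X (Sum.inl ()) := by simp [res]
theorem res_inr_last : res r s (X (Sum.inr (Fin.last s))) = X (Sum.inl ()) := by simp [res]
theorem res_inl (j : Fin r) : res r s (X (Sum.inl j.castSucc)) = X (Sum.inr (Sum.inl j)) := by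
  simp [res]
theorem res_inr (l : Fin s) : res r s (X (Sum.inr l.castSucc)) = X (Sum.inr (Sum.inr l)) := by
  simp [res]

theorem emb_res (f : Syz r s) : emb r s (res r s f) = spec (Fin.last s) (Fin.last r) f := by
  have : (emb r s).comp (res r s) = spec (Fin.last s) (Fin.last r) := by
    apply algHom_ext
    rintro (j | l)
    · rw [AlgHom.comp_apply, spec_X_inl]
      cases j using Fin.lastCases with
      | last => rw [res_inl_last]; simp [emb]
      | cast j => rw [res_inl]; simp [emb]
    · rw [AlgHom.comp_apply]
      cases l using Fin.lastCases with
      | last => rw [res_inr_last, spec_X_self]; simp [emb]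
      | cast l => rw [res_inr, spec_X_of_ne _ (Fin.castSucc_lt_last l).ne]; simp [emb]
  exact DFunLike.congr_fun this f

theorem res_disc : res r s (disc r s) = 0 := by
  have := map_dvd (res r s) (disc_dvd (Fin.last s) (Fin.last r))
  rwa [map_sub, res_inl_last, res_inr_last, sub_self, zero_dvd_iff] at this

theorem res_isHomogeneous {f : Syz r s} {k : ℕ} (hf : f.IsHomogeneous k) :
    (res r s f).IsHomogeneous k := by
  have h := hf.aeval (n := 1) (Sum.elim
    (Fin.lastCases (X (Sum.inl ())) fun j => X (Sum.inr (Sum.inl j)))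
    (Fin.lastCases (X (Sum.inl ())) fun l => X (Sum.inr (Sum.inr l))) :
    Fin (r + 1) ⊕ Fin (s + 1) → Rxrs r s) (by
      rintro (j | l)
      · cases j using Fin.lastCases with
        | last => simpa using isHomogeneous_X _ _
        | cast j => simpa using isHomogeneous_X _ _
      · cases l using Fin.lastCases with
        | last => simpa using isHomogeneous_X _ _
        | cast l => simpa using isHomogeneous_X _ _)
  rwa [one_mul] at h

theorem spec_defect_disc_ne_zero {b : ℂ} (hb : 1 + b ≠ 0) (l : Fin (s + 1)) (j : Fin (r + 1)) :
    defect b l j (disc r s) ≠ 0 := by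
  classical
  have h1 : disc r s = (X (Sum.inr l) - X (Sum.inl j)) *
      ∏ p ∈ Finset.univ.erase (l, j), (X (Sum.inr p.1) - X (Sum.inl p.2) : Syz r s) := by
    rw [Finset.mul_prod_erase Finset.univ
      (fun p : Fin (s + 1) × Fin (r + 1) => (X (Sum.inr p.1) - X (Sum.inl p.2) : Syz r s))
      (Finset.mem_univ (l, j)), disc, Fintype.prod_prod_type]
  have h2 : defect b l j (X (Sum.inr l) - X (Sum.inl j) : Syz r s) = C (1 + b) := by
    rw [defect_apply]
    simp [pderiv_X, smul_eq_C_mul]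
  rw [h1, defect_mul, h2, map_sub, spec_X_self, spec_X_inl, sub_self, zero_mul, zero_add]
  refine mul_ne_zero ?_ (by rwa [Ne, C_eq_zero])
  rw [map_prod, Finset.prod_ne_zero_iff]
  rintro ⟨l', j'⟩ hp
  rw [map_sub, spec_X_inl]
  by_cases hl : l' = l
  · subst hl
    rw [spec_X_self, sub_ne_zero]
    intro h
    have := Sum.inl_injective (X_injective h)
    simp [this] at hp
  · rw [spec_X_of_ne _ hl]
    exact linear_ne_zero _ _

theorem disc_sq_dvd_of_res_eq_zero {b : ℂ} (hb : 1 + b ≠ 0) {f : Syz r s} (hf : f ∈ quasi r s b)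
    (hfs : f ∈ symSub r s) (h0 : res r s f = 0) : disc r s ^ 2 ∣ f := by
  have h1 : (X (Sum.inr (Fin.last s)) - X (Sum.inl (Fin.last r)) : Syz r s) ∣ f := by
    rw [← spec_eq_zero_iff, ← emb_res, h0, map_zero]
  obtain ⟨g, rfl⟩ : disc r s ∣ f := by
    refine disc_dvd_of_forall fun l j => ?_
    have := map_dvd (act (Equiv.swap (Fin.last r) j, Equiv.swap (Fin.last s) l)) h1
    rw [hfs] at this
    simpa [act] using this
  rw [pow_two]
  refine mul_dvd_mul_left _ (disc_dvd_of_forall fun l j => ?_)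
  rw [← spec_eq_zero_iff]
  have h2 := hf l j
  rw [defect_mul, spec_eq_zero_iff.2 (disc_dvd l j), zero_mul, zero_add] at h2
  exact (mul_eq_zero.1 h2).resolve_right (spec_defect_disc_ne_zero hb l j)

theorem smul_res_dps {a : ℂ} (ha : a ≠ 0) (k : ℕ) :
    a • res r s (dps r s a⁻¹ k) = Pa r s a k := by
  rw [dps, map_add, map_smul, smul_add, smul_smul, mul_inv_cancel₀ ha, one_smul]
  simp only [py, pz, map_add, map_sum, map_pow, Fin.sum_univ_castSucc, res_inl_last, res_inr_last,
    res_inl, res_inr, Pa, smul_eq_C_mul, C_1]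
  ring

theorem Ars_eq_map {a : ℂ} (ha : a ≠ 0) : Ars r s a = (dpsAlg r s a⁻¹).map (res r s) := by
  rw [dpsAlg, AlgHom.map_adjoin]
  apply le_antisymm
  · refine Algebra.adjoin_le ?_
    rintro _ ⟨i, hi, rfl⟩
    rw [← smul_res_dps ha]
    refine Subalgebra.smul_mem _ (Algebra.subset_adjoin ?_) _
    exact ⟨_, ⟨i, hi, rfl⟩, rfl⟩
  · refine Algebra.adjoin_le ?_
    rintro _ ⟨_, ⟨i, hi, rfl⟩, rfl⟩
    have := smul_res_dps (r := r) (s := s) ha i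
    rw [← inv_smul_smul₀ ha (res r s (dps r s a⁻¹ i)), this]
    refine Subalgebra.smul_mem _ (Algebra.subset_adjoin ?_) _
    exact ⟨i, hi, rfl⟩

theorem BA_eq_adjoin {a : ℂ} (ha : a ≠ 0) {t : Fin (r + 1 + s) → Syz r s}
    (ht : ∀ i, ∃ u : ℂ, u ≠ 0 ∧ t i = u • dps r s a⁻¹ (i + 1)) :
    BA r s a = Algebra.adjoin ℂ (Set.range fun i => res r s (t i)) := by
  have key : ∀ i, ∃ u : ℂ, u ≠ 0 ∧ res r s (t i) = u • Pa r s a (i + 1) := by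
    intro i
    obtain ⟨u, hu, e⟩ := ht i
    refine ⟨u * a⁻¹, mul_ne_zero hu (inv_ne_zero ha), ?_⟩
    rw [e, map_smul, ← smul_res_dps ha, smul_smul, mul_assoc, inv_mul_cancel₀ ha, mul_one]
  apply le_antisymm
  · refine Algebra.adjoin_le ?_
    rintro _ ⟨i, hi, hi', rfl⟩
    obtain ⟨u, hu, e⟩ := key ⟨i - 1, by omega⟩
    simp only [Nat.sub_add_cancel hi] at e
    rw [← inv_smul_smul₀ hu (Pa r s a i), ← e]
    refine Subalgebra.smul_mem _ (Algebra.subset_adjoin ?_) _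
    exact ⟨_, rfl⟩
  · refine Algebra.adjoin_le ?_
    rintro _ ⟨i, rfl⟩
    obtain ⟨u, hu, e⟩ := key i
    simp only [e]
    refine Subalgebra.smul_mem _ (Algebra.subset_adjoin ?_) _
    exact ⟨i + 1, by omega, by omega, rfl⟩

end

section

theorem linearIndependent_adjoin {R : Type*} [CommRing R] [Algebra ℂ R] {N : ℕ} {ι : Type*}
    [Finite ι] {t : Fin N → R} {β : ι → R} (h : LinearIndependent ℂ (tb t β)) :
    LinearIndependent (Algebra.adjoin ℂ (Set.range t)) β := by
  classical
  have := Fintype.ofFinite ι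
  rw [Fintype.linearIndependent_iff]
  intro c hc
  have hP : ∀ j, ∃ P : MvPolynomial (Fin N) ℂ, aeval t P = (c j : R) := by
    intro j
    exact (Algebra.adjoin_range_eq_range_aeval ℂ t).le (c j).2
  choose P hP using hP
  let w : (Fin N → ℕ) × ι →₀ ℂ :=
    ∑ j, ∑ e ∈ (P j).support, Finsupp.single (⇑e, j) ((P j).coeff e)
  have hw : Finsupp.linearCombination ℂ (tb t β) w = 0 := by
    rw [← hc]
    simp only [w, map_sum, Finsupp.linearCombination_single]
    refine Finset.sum_congr rfl fun j _ => ?_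
    rw [Subalgebra.smul_def, ← hP, aeval_def, eval₂_eq', smul_eq_mul, Finset.sum_mul]
    refine Finset.sum_congr rfl fun e _ => ?_
    rw [tb, Algebra.smul_def, mul_assoc]
  have hw0 := linearIndependent_iff.1 h w hw
  intro j
  apply Subtype.ext
  rw [← hP, ZeroMemClass.coe_zero]
  have : P j = 0 := by
    ext e
    have h1 := DFunLike.congr_fun hw0 (⇑e, j)
    simp only [w, Finsupp.coe_finsetSum, Finset.sum_apply, Finsupp.single_apply, Prod.mk.injEq,
      DFunLike.coe_fn_eq] at h1
    rw [Finset.sum_eq_single j (by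
      intro i _ hij
      simp [hij]) (by simp)] at h1
    simpa using h1
  rw [this, map_zero]

theorem finite_free_of_tb {R : Type*} [CommRing R] [Algebra ℂ R] {N : ℕ} {ι : Type*}
    [Finite ι] {t : Fin N → R} {β : ι → R} (h : LinearIndependent ℂ (tb t β)) {B : Subalgebra ℂ R}
    (hB : B = Algebra.adjoin ℂ (Set.range t)) {A : Set R} (hβ : ∀ j, β j ∈ A)
    (hA : A ⊆ Submodule.span ℂ (Set.range (tb t β))) :
    Module.Finite B (Submodule.span B A) ∧ Module.Free B (Submodule.span B A) := by
  subst hB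
  have hsp : Submodule.span (Algebra.adjoin ℂ (Set.range t)) (Set.range β) =
      Submodule.span (Algebra.adjoin ℂ (Set.range t)) A := by
    apply le_antisymm
    · rw [Submodule.span_le]
      rintro _ ⟨j, rfl⟩
      exact Submodule.subset_span (hβ j)
    · rw [Submodule.span_le]
      intro f hf
      have h1 : Submodule.span ℂ (Set.range (tb t β)) ≤ Submodule.restrictScalars ℂ
          (Submodule.span (Algebra.adjoin ℂ (Set.range t)) (Set.range β)) := by
        rw [Submodule.span_le]
        rintro _ ⟨p, rfl⟩
        have h2 : ∏ i, t i ^ p.1 i ∈ Algebra.adjoin ℂ (Set.range t) :=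
          Subalgebra.prod_mem _ fun i _ =>
            Subalgebra.pow_mem _ (Algebra.subset_adjoin (Set.mem_range_self i)) _
        exact Submodule.smul_mem (Submodule.span (Algebra.adjoin ℂ (Set.range t)) (Set.range β))
          (⟨_, h2⟩ : Algebra.adjoin ℂ (Set.range t))
          (Submodule.subset_span (Set.mem_range_self p.2))
      exact h1 (hA hf)
  rw [← hsp]
  let e := Module.Basis.span (linearIndependent_adjoin h)
  exact ⟨Module.Finite.of_basis e, Module.Free.of_basis e⟩

variable {r s : ℕ}

theorem homogeneousComponent_res (f : Syz r s) (k : ℕ) :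
    homogeneousComponent k (res r s f) = res r s (homogeneousComponent k f) := by
  conv_lhs => rw [← sum_homogeneousComponent f]
  rw [map_sum, map_sum]
  simp only [homogeneousComponent_of_mem
    (res_isHomogeneous (homogeneousComponent_isHomogeneous _ f))]
  rw [Finset.sum_ite_eq]
  split_ifs with hk
  · rfl
  · rw [homogeneousComponent_eq_zero _ _ (by simpa using hk), map_zero]

theorem res_tb {ι : Type*} (t : Fin (r + 1 + s) → Syz r s) (β : ι → Syz r s) (p) :
    res r s (tb t β p) = tb (fun i => res r s (t i)) (fun j => res r s (β j)) p := by
  simp only [tb, map_mul, map_prod, map_pow]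

section
variable {b : ℂ} {ι : Type*} {t : Fin (r + 1 + s) → Syz r s} {d : ι → ℕ} {β : ι → Syz r s}

theorem IsQuasiBasis.tb_mem (hQ : IsQuasiBasis r s b t d β) (p) : tb t β p ∈ dpsAlg r s b :=
  Subalgebra.mul_mem _ (Subalgebra.prod_mem _ fun i _ => Subalgebra.pow_mem _
    (mem_dpsAlg_of_eq_smul_dps hQ.t_eq i) _) (hQ.mem _)

theorem IsQuasiBasis.linearIndependent (hQ : IsQuasiBasis r s b t d β) (hb : 1 + b ≠ 0) :
    LinearIndependent ℂ (tb (fun i => res r s (t i)) (fun j => res r s (β j))) := by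
  rw [linearIndependent_iff]
  intro w hw
  apply hQ.indep
  have hm : Finsupp.linearCombination ℂ (tb t β) w ∈ dpsAlg r s b := by
    rw [Finsupp.linearCombination_apply]
    exact Subalgebra.sum_mem _ fun p _ => Subalgebra.smul_mem _ (hQ.tb_mem p) _
  refine disc_sq_dvd_of_res_eq_zero hb (dpsAlg_le_quasi _ hm) (dpsAlg_le_symSub _ hm) ?_
  rw [← hw, Finsupp.linearCombination_apply, Finsupp.linearCombination_apply, map_finsuppSum]
  simp only [map_smul, res_tb]

theorem IsQuasiBasis.res_mem_span (hQ : IsQuasiBasis r s b t d β) {f : Syz r s}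
    (hf : f ∈ dpsAlg r s b) (k : ℕ) : res r s (homogeneousComponent k f) ∈
      Submodule.span ℂ (tb (fun i => res r s (t i)) (fun j => res r s (β j)) ''
        {p | wt d p = k}) := by
  have hm := homogeneousComponent_mem_dpsAlg hf k
  obtain ⟨h, hh⟩ := hQ.span k (homogeneousComponent k f)
    ⟨dpsAlg_le_quasi _ hm, dpsAlg_le_symSub _ hm, homogeneousComponent_isHomogeneous k f⟩
  have := Submodule.mem_map_of_mem (f := (res r s).toLinearMap) hh
  rw [Submodule.map_span, ← Set.image_comp, AlgHom.toLinearMap_apply, map_sub, map_mul, map_pow,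
    res_disc, zero_pow two_ne_zero, zero_mul, sub_zero] at this
  have e : ((res r s).toLinearMap ∘ tb t β) =
      tb (fun i => res r s (t i)) (fun j => res r s (β j)) := by
    funext p
    exact res_tb t β p
  rwa [e] at this

theorem IsQuasiBasis.map_subset_span (hQ : IsQuasiBasis r s b t d β) :
    (((dpsAlg r s b).map (res r s) : Subalgebra ℂ (Rxrs r s)) : Set (Rxrs r s)) ⊆
      Submodule.span ℂ (Set.range (tb (fun i => res r s (t i)) (fun j => res r s (β j)))) := by
  rintro _ ⟨f, hf, rfl⟩
  change res r s f ∈ Submodule.span ℂ _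
  rw [← sum_homogeneousComponent f, map_sum]
  exact Submodule.sum_mem _ fun k _ =>
    Submodule.span_mono (Set.image_subset_range _ _) (hQ.res_mem_span hf k)

theorem IsQuasiBasis.finrank_compX [Finite ι] (hQ : IsQuasiBasis r s b t d β) (hb : 1 + b ≠ 0)
    (k : ℕ) : Module.finrank ℂ (compX r s
      (Subalgebra.toSubmodule ((dpsAlg r s b).map (res r s))) k) =
      Nat.card {p : (Fin (r + 1 + s) → ℕ) × ι // wt d p = k} := by
  have hfin : Finite {p : (Fin (r + 1 + s) → ℕ) × ι // wt d p = k} :=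
    (finite_wt (N := r + 1 + s) d k).to_subtype
  have := Fintype.ofFinite {p : (Fin (r + 1 + s) → ℕ) × ι // wt d p = k}
  let v : {p : (Fin (r + 1 + s) → ℕ) × ι // wt d p = k} → Rxrs r s :=
    fun p => tb (fun i => res r s (t i)) (fun j => res r s (β j)) p.1
  have hv : LinearIndependent ℂ v :=
    (hQ.linearIndependent hb).comp Subtype.val Subtype.val_injective
  have hs : Submodule.span ℂ (Set.range v) = compX r s
      (Subalgebra.toSubmodule ((dpsAlg r s b).map (res r s))) k := by
    apply le_antisymm
    · rw [Submodule.span_le]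
      rintro _ ⟨p, rfl⟩
      have e : v p = res r s (tb t β p.1) := (res_tb t β p.1).symm
      rw [e]
      refine ⟨⟨_, hQ.tb_mem p.1, rfl⟩, res_isHomogeneous ?_⟩
      have := tb_isHomogeneous (isHomogeneous_of_eq_smul_dps hQ.t_eq) hQ.homog p.1
      rwa [p.2] at this
    · rintro _ ⟨⟨f, hf, rfl⟩, hk⟩
      change res r s f ∈ _
      have h1 := homogeneousComponent_eq_self hk
      change homogeneousComponent k (res r s f) = res r s f at h1
      rw [← h1, homogeneousComponent_res]
      refine Submodule.span_mono ?_ (hQ.res_mem_span hf k)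
      rintro _ ⟨p, hp, rfl⟩
      exact ⟨⟨p, hp⟩, rfl⟩
  rw [← hs, finrank_span_eq_card hv, Nat.card_eq_fintype_card]

end

variable (r s) in
theorem exists_generic : ∃ E : Set ℂ, E.Countable ∧ ∀ a : ℂ, a ∉ E →
    Module.Finite (BA r s a) (ArsMod r s a) ∧ Module.Free (BA r s a) (ArsMod r s a) ∧
    ∀ k, Module.finrank ℂ (compX r s (Subalgebra.toSubmodule (Ars r s a)) k) +
      Module.finrank ℂ (shiftComp r s k) = Module.finrank ℂ (gapComp r s k) := by
  obtain ⟨ι, _, d, β, hG⟩ := exists_gapBasis r s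
  obtain ⟨E, hE, h⟩ := hG.exists_isQuasiBasis
  refine ⟨{0, -1} ∪ Inv.inv ⁻¹' E, ?_, fun a ha => ?_⟩
  · exact ((Set.countable_singleton _).insert _).union (hE.preimage inv_injective)
  · simp only [Set.mem_union, Set.mem_insert_iff, Set.mem_singleton_iff, Set.mem_preimage,
      not_or] at ha
    obtain ⟨⟨h0, h1⟩, h2⟩ := ha
    obtain ⟨t, β', hQ⟩ := h _ h2
    have hb : 1 + a⁻¹ ≠ 0 := by
      intro hb
      apply h1
      field_simp at hb
      linear_combination hb
    obtain ⟨h3, h4⟩ := finite_free_of_tb (hQ.linearIndependent hb) (BA_eq_adjoin h0 hQ.t_eq)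
      (A := Ars r s a) (fun j => by
        rw [Ars_eq_map h0]
        exact ⟨_, hQ.mem j, rfl⟩) (by
        rw [Ars_eq_map h0]
        exact hQ.map_subset_span)
    refine ⟨h3, h4, fun k => ?_⟩
    rw [Ars_eq_map h0, hQ.finrank_compX hb, hG.finrank_gapComp]

end

section

/-- Multisets of `m` natural numbers with sum `k`, each zero or at least `c`. -/
def gapSet (c m k : ℕ) : Set (Multiset ℕ) :=
  {l | l.card = m ∧ (∀ a ∈ l, a = 0 ∨ c ≤ a) ∧ l.sum = k}

theorem gapSet_finite (c m k : ℕ) : (gapSet c m k).Finite := by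
  refine (Set.finite_Icc 0 (m • Multiset.range (k + 1))).subset ?_
  rintro l ⟨h1, -, h2⟩
  refine ⟨Multiset.zero_le l, Multiset.le_iff_count.2 fun a => ?_⟩
  rw [Multiset.count_nsmul]
  by_cases ha : a ∈ l
  · have h3 : a ≤ k := h2 ▸ Multiset.single_le_sum (fun _ _ => Nat.zero_le _) a ha
    rw [Multiset.count_eq_one_of_mem (Multiset.nodup_range _)
      (Multiset.mem_range.2 (Nat.lt_succ_of_le h3)), mul_one]
    exact h1 ▸ Multiset.count_le_card a l
  · rw [Multiset.count_eq_zero_of_notMem ha]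
    exact Nat.zero_le _

theorem sum_map_add_right (l : Multiset ℕ) (c : ℕ) :
    (l.map (· + c)).sum = l.sum + c * l.card := by
  induction l using Multiset.induction_on with
  | empty => simp
  | cons a l ih => simp only [Multiset.map_cons, Multiset.sum_cons, ih, Multiset.card_cons]; ring

theorem gapSet_succ (c m k : ℕ) :
    gapSet c (m + 1) k = (Multiset.cons 0) '' gapSet c m k ∪
      (Multiset.map (· + c)) '' {l | l ∈ gapSet 1 (m + 1) (k - c * (m + 1)) ∧
        c * (m + 1) ≤ k} := by
  ext l
  constructor
  · rintro ⟨h1, h2, h3⟩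
    by_cases h0 : 0 ∈ l
    · obtain ⟨l, rfl⟩ := Multiset.exists_cons_of_mem h0
      refine Or.inl ⟨l, ⟨by simpa using h1, fun a ha => h2 a (Multiset.mem_cons_of_mem ha),
        by simpa using h3⟩, rfl⟩
    · have h4 : ∀ a ∈ l, c ≤ a := fun a ha => (h2 a ha).resolve_left (by rintro rfl; exact h0 ha)
      have h5 : (l.map (· - c)).map (· + c) = l := by
        rw [Multiset.map_map]
        conv_rhs => rw [← Multiset.map_id' l]
        exact Multiset.map_congr rfl fun a ha => Nat.sub_add_cancel (h4 a ha)
      have h6 := sum_map_add_right (l.map (· - c)) c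
      rw [h5, Multiset.card_map, h1, h3] at h6
      refine Or.inr ⟨l.map (· - c), ⟨⟨by simpa using h1, fun a _ => by omega, ?_⟩, ?_⟩, h5⟩
      · omega
      · omega
  · rintro (⟨l, ⟨h1, h2, h3⟩, rfl⟩ | ⟨l, ⟨⟨h1, h2, h3⟩, h4⟩, rfl⟩)
    · refine ⟨by simpa using h1, fun a ha => ?_, by simpa using h3⟩
      rcases Multiset.mem_cons.1 ha with rfl | ha
      · exact Or.inl rfl
      · exact h2 a ha
    · refine ⟨by simpa using h1, fun a ha => ?_, ?_⟩
      · obtain ⟨b, -, rfl⟩ := Multiset.mem_map.1 ha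
        exact Or.inr (Nat.le_add_left _ _)
      · rw [sum_map_add_right, h1, h3]
        omega

theorem ncard_gapSet_succ {c : ℕ} (hc : 1 ≤ c) (m k : ℕ) :
    (gapSet c (m + 1) k).ncard = (gapSet c m k).ncard +
      if c * (m + 1) ≤ k then (gapSet 1 (m + 1) (k - c * (m + 1))).ncard else 0 := by
  have hd : Disjoint (Multiset.cons 0 '' gapSet c m k) (Multiset.map (· + c) ''
      {l | l ∈ gapSet 1 (m + 1) (k - c * (m + 1)) ∧ c * (m + 1) ≤ k}) := by
    rw [Set.disjoint_left]
    rintro _ ⟨l, -, rfl⟩ ⟨l', -, h⟩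
    have : 0 ∈ Multiset.map (· + c) l' := by
      simp only [h]
      exact Multiset.mem_cons_self 0 l
    obtain ⟨b, -, hb⟩ := Multiset.mem_map.1 this
    omega
  rw [gapSet_succ, Set.ncard_union_eq hd ((gapSet_finite _ _ _).image _)
    (((gapSet_finite 1 (m + 1) (k - c * (m + 1))).subset fun l hl => hl.1).image _),
    Set.ncard_image_of_injective _ fun a b h => (Multiset.cons_inj_right 0).1 h,
    Set.ncard_image_of_injective _ (Multiset.map_injective (add_left_injective c))]
  split_ifs with h
  · simp [h]
  · simp [h]

/-- The generating function of `gapSet`. -/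
def gapGF (c m : ℕ) : PowerSeries ℚ := PowerSeries.mk fun k => ((gapSet c m k).ncard : ℚ)

theorem gapGF_zero (c : ℕ) : gapGF c 0 = 1 := by
  ext k
  rw [gapGF, PowerSeries.coeff_mk, PowerSeries.coeff_one]
  split_ifs with h
  · have : gapSet c 0 k = {0} := by
      ext l
      constructor
      · rintro ⟨h1, -, -⟩
        exact Multiset.card_eq_zero.1 h1
      · rintro rfl
        exact ⟨rfl, by simp, by simp [h]⟩
    rw [this, Set.ncard_singleton, Nat.cast_one]
  · have : gapSet c 0 k = ∅ := by
      rw [Set.eq_empty_iff_forall_notMem]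
      rintro l ⟨h1, -, h2⟩
      rw [Multiset.card_eq_zero.1 h1] at h2
      exact h h2.symm
    rw [this, Set.ncard_empty, Nat.cast_zero]

theorem gapGF_succ {c : ℕ} (hc : 1 ≤ c) (m : ℕ) :
    gapGF c (m + 1) = gapGF c m + PowerSeries.X ^ (c * (m + 1)) * gapGF 1 (m + 1) := by
  ext k
  simp only [gapGF, map_add, PowerSeries.coeff_mk, PowerSeries.coeff_X_pow_mul',
    ncard_gapSet_succ hc]
  push_cast
  split_ifs <;> simp

theorem gapGF_one_mul (m : ℕ) : gapGF 1 m * uu m = 1 := by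
  induction m with
  | zero => simp [gapGF_zero, uu]
  | succ m ih =>
    have h := gapGF_succ le_rfl m
    rw [one_mul] at h
    rw [uu, Finset.prod_range_succ, ← uu]
    linear_combination ih + uu m * h

theorem gapGF_mul {c : ℕ} (hc : 1 ≤ c) (m : ℕ) : gapGF c m * uu m =
    ∑ i ∈ Finset.range (m + 1), PowerSeries.X ^ (i * c) *
      ∏ k ∈ Finset.Ico i m, (1 - PowerSeries.X ^ (k + 1)) := by
  induction m with
  | zero => simp [gapGF_zero, uu]
  | succ m ih =>
    rw [Finset.sum_range_succ, Finset.Ico_self, Finset.prod_empty]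
    have h1 : ∑ i ∈ Finset.range (m + 1), (PowerSeries.X : PowerSeries ℚ) ^ (i * c) *
        ∏ k ∈ Finset.Ico i (m + 1), (1 - PowerSeries.X ^ (k + 1)) =
        (∑ i ∈ Finset.range (m + 1), PowerSeries.X ^ (i * c) *
          ∏ k ∈ Finset.Ico i m, (1 - PowerSeries.X ^ (k + 1))) *
          (1 - PowerSeries.X ^ (m + 1)) := by
      rw [Finset.sum_mul]
      refine Finset.sum_congr rfl fun i hi => ?_
      rw [Finset.prod_Ico_succ_top (by simpa [Nat.lt_succ_iff] using hi), mul_assoc]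
    rw [h1, ← ih, gapGF_succ hc, add_mul, mul_assoc, gapGF_one_mul, mul_comm c]
    rw [uu, Finset.prod_range_succ, ← uu]
    ring

/-- Pairs of multisets of total sum `k`, with a gap condition on the second one. -/
def gapPairs (c n m k : ℕ) : Set (Multiset ℕ × Multiset ℕ) :=
  {x | x.1.card = n ∧ x.2.card = m ∧ (∀ a ∈ x.2, a = 0 ∨ c ≤ a) ∧ x.1.sum + x.2.sum = k}

theorem gapPairs_eq (c n m k : ℕ) : gapPairs c n m k =
    ⋃ p ∈ Finset.HasAntidiagonal.antidiagonal k, gapSet 1 n p.1 ×ˢ gapSet c m p.2 := by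
  ext x
  simp only [Set.mem_iUnion, Set.mem_prod, Finset.HasAntidiagonal.mem_antidiagonal]
  constructor
  · rintro ⟨h1, h2, h3, h4⟩
    exact ⟨(x.1.sum, x.2.sum), h4, ⟨h1, fun a _ => by omega, rfl⟩, h2, h3, rfl⟩
  · rintro ⟨p, hp, ⟨h1, -, h2⟩, h3, h4, h5⟩
    exact ⟨h1, h3, h4, by rw [h2, h5, hp]⟩

theorem gapPairs_finite (c n m k : ℕ) : (gapPairs c n m k).Finite := by
  rw [gapPairs_eq]
  exact Set.Finite.biUnion (Finset.finite_toSet _) fun p _ =>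
    (gapSet_finite _ _ _).prod (gapSet_finite _ _ _)

theorem mk_ncard_gapPairs (c n m : ℕ) :
    PowerSeries.mk (fun k => ((gapPairs c n m k).ncard : ℚ)) = gapGF 1 n * gapGF c m := by
  ext k
  rw [PowerSeries.coeff_mk, PowerSeries.coeff_mul, gapPairs_eq]
  rw [Set.ncard_eq_toFinset_card _ (by rw [← gapPairs_eq]; exact gapPairs_finite c n m k)]
  have : (Set.Finite.toFinset
      (s := ⋃ p ∈ Finset.HasAntidiagonal.antidiagonal k, gapSet 1 n p.1 ×ˢ gapSet c m p.2)
      (by rw [← gapPairs_eq]; exact gapPairs_finite c n m k)) =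
      (Finset.HasAntidiagonal.antidiagonal k).biUnion fun p =>
        (gapSet_finite 1 n p.1).toFinset ×ˢ (gapSet_finite c m p.2).toFinset := by
    ext x
    simp only [Set.Finite.mem_toFinset, Set.mem_iUnion, Set.mem_prod, Finset.mem_biUnion,
      Finset.mem_product, exists_prop]
  rw [this, Finset.card_biUnion]
  · push_cast
    refine Finset.sum_congr rfl fun p _ => ?_
    rw [Finset.card_product, gapGF, gapGF, PowerSeries.coeff_mk, PowerSeries.coeff_mk,
      Set.ncard_eq_toFinset_card _ (gapSet_finite 1 n p.1),
      Set.ncard_eq_toFinset_card _ (gapSet_finite c m p.2), Nat.cast_mul]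
  · intro p _ q _ hpq
    rw [Function.onFun, Finset.disjoint_left]
    intro x hx hx'
    simp only [Finset.mem_product, Set.Finite.mem_toFinset] at hx hx'
    exact hpq (Prod.ext (hx.1.2.2.symm.trans hx'.1.2.2) (hx.2.2.2.symm.trans hx'.2.2.2))

end

section

theorem exists_perm_of_map_eq {n : ℕ} {f g : Fin n → ℕ}
    (h : Finset.univ.val.map f = Finset.univ.val.map g) : ∃ σ : Equiv.Perm (Fin n), f ∘ σ = g := by
  have key : f ∘ Tuple.sort f = g ∘ Tuple.sort g := by
    apply List.ofFn_injective
    refine List.Perm.eq_of_sortedLE (List.sortedLE_ofFn_iff.2 (Tuple.monotone_sort f))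
      (List.sortedLE_ofFn_iff.2 (Tuple.monotone_sort g)) ?_
    refine (Equiv.Perm.ofFn_comp_perm _ f).trans (List.Perm.trans ?_
      (Equiv.Perm.ofFn_comp_perm _ g).symm)
    rw [Fin.univ_val_map, Fin.univ_val_map] at h
    exact Multiset.coe_eq_coe.1 h
  refine ⟨(Tuple.sort g).symm.trans (Tuple.sort f), ?_⟩
  funext i
  have := congrFun key ((Tuple.sort g).symm i)
  simpa using this

theorem exists_map_univ_eq {n : ℕ} {l : Multiset ℕ} (h : l.card = n) :
    ∃ f : Fin n → ℕ, Finset.univ.val.map f = l := by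
  subst h
  obtain ⟨l, rfl⟩ := Quot.exists_rep l
  refine ⟨l.get, (Fin.univ_val_map l.get).trans ?_⟩
  rw [List.ofFn_get]
  rfl

theorem map_univ_comp_perm {n : ℕ} (σ : Equiv.Perm (Fin n)) (f : Fin n → ℕ) :
    Finset.univ.val.map (fun i => f (σ i)) = Finset.univ.val.map f := by
  conv_rhs => rw [← Finset.map_univ_equiv σ, Finset.map_val, Multiset.map_map]
  rfl

variable {r s : ℕ}

/-- The two multisets of exponents of a monomial. -/
def cl (ν : Fin (r + 1) ⊕ Fin (s + 1) →₀ ℕ) : Multiset ℕ × Multiset ℕ :=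
  (Finset.univ.val.map fun j => ν (Sum.inl j), Finset.univ.val.map fun l => ν (Sum.inr l))

theorem exists_cl_eq {x : Multiset ℕ × Multiset ℕ} (h1 : x.1.card = r + 1)
    (h2 : x.2.card = s + 1) : ∃ ν : Fin (r + 1) ⊕ Fin (s + 1) →₀ ℕ, cl ν = x := by
  obtain ⟨f, hf⟩ := exists_map_univ_eq h1
  obtain ⟨g, hg⟩ := exists_map_univ_eq h2
  exact ⟨Finsupp.equivFunOnFinite.symm (Sum.elim f g), Prod.ext (by simpa [cl] using hf)
    (by simpa [cl] using hg)⟩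

theorem cl_mem_gapPairs {c k : ℕ} {ν : Fin (r + 1) ⊕ Fin (s + 1) →₀ ℕ} (h : ν.degree = k)
    (hg : ∀ i, ν i = 0 ∨ gp r s c i ≤ ν i) : cl ν ∈ gapPairs c (r + 1) (s + 1) k := by
  refine ⟨by simp [cl], by simp [cl], ?_, ?_⟩
  · intro a ha
    rw [cl, Multiset.mem_map] at ha
    obtain ⟨l, -, rfl⟩ := ha
    exact hg (Sum.inr l)
  · rw [← h, Finsupp.degree_eq_sum, Fintype.sum_sum_type]
    rfl

theorem gap_of_cl_mem {c k : ℕ} {ν : Fin (r + 1) ⊕ Fin (s + 1) →₀ ℕ}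
    (h : cl ν ∈ gapPairs c (r + 1) (s + 1) k) :
    ν.degree = k ∧ ∀ i, ν i = 0 ∨ gp r s c i ≤ ν i := by
  obtain ⟨-, -, h1, h2⟩ := h
  constructor
  · rw [← h2, Finsupp.degree_eq_sum, Fintype.sum_sum_type]
    rfl
  · rintro (j | l)
    · change _ ∨ 1 ≤ _
      omega
    · exact h1 _ (Multiset.mem_map.2 ⟨l, Finset.mem_univ_val l, rfl⟩)

theorem coeff_act_symm (p : Equiv.Perm (Fin (r + 1)) × Equiv.Perm (Fin (s + 1)))
    (f : Syz r s) (ν : Fin (r + 1) ⊕ Fin (s + 1) →₀ ℕ) :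
    coeff ν (act p f) = coeff (ν.mapDomain (Equiv.sumCongr p.1 p.2).symm) f := by
  have h : ν = (ν.mapDomain (Equiv.sumCongr p.1 p.2).symm).mapDomain
      (Equiv.sumCongr p.1 p.2) := by
    ext i
    rw [Finsupp.mapDomain_equiv_apply, Finsupp.mapDomain_equiv_apply, Equiv.symm_symm,
      Equiv.apply_symm_apply]
  conv_lhs => rw [h]
  exact coeff_rename_mapDomain _ (Equiv.injective _) _ _

theorem cl_mapDomain (p : Equiv.Perm (Fin (r + 1)) × Equiv.Perm (Fin (s + 1)))
    (ν : Fin (r + 1) ⊕ Fin (s + 1) →₀ ℕ) :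
    cl (ν.mapDomain (Equiv.sumCongr p.1 p.2).symm) = cl ν := by
  have h : ∀ i, ν.mapDomain (Equiv.sumCongr p.1 p.2).symm i = ν (Equiv.sumCongr p.1 p.2 i) :=
    fun i => by rw [Finsupp.mapDomain_equiv_apply, Equiv.symm_symm]
  refine Prod.ext ?_ ?_
  · simp only [cl, h]
    exact map_univ_comp_perm p.1 (fun j => ν (Sum.inl j))
  · simp only [cl, h]
    exact map_univ_comp_perm p.2 (fun j => ν (Sum.inr j))

theorem coeff_eq_of_cl_eq {f : Syz r s} (hf : f ∈ symSub r s)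
    {ν μ : Fin (r + 1) ⊕ Fin (s + 1) →₀ ℕ} (h : cl ν = cl μ) : coeff ν f = coeff μ f := by
  obtain ⟨σ, hσ⟩ := exists_perm_of_map_eq (congrArg Prod.fst h)
  obtain ⟨τ, hτ⟩ := exists_perm_of_map_eq (congrArg Prod.snd h)
  have h1 : μ = ν.mapDomain (Equiv.sumCongr σ τ).symm := by
    ext i
    rw [Finsupp.mapDomain_equiv_apply, Equiv.symm_symm]
    rcases i with j | l
    · exact (congrFun hσ j).symm
    · exact (congrFun hτ l).symm
  rw [h1, ← coeff_act_symm (σ, τ), hf (σ, τ)]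

/-- The class sum with prescribed coefficients. -/
def clSum (k : ℕ) (ψ : Multiset ℕ × Multiset ℕ → ℂ) : Syz r s :=
  ∑ ν ∈ (Finset.univ : Finset (Fin (r + 1) ⊕ Fin (s + 1))).finsuppAntidiag k,
    monomial ν (ψ (cl ν))

theorem coeff_clSum (k : ℕ) (ψ : Multiset ℕ × Multiset ℕ → ℂ)
    (ν : Fin (r + 1) ⊕ Fin (s + 1) →₀ ℕ) :
    coeff ν (clSum k ψ) = if ν.degree = k then ψ (cl ν) else 0 := by
  rw [clSum, coeff_sum]
  simp only [coeff_monomial]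
  rw [Finset.sum_ite_eq']
  simp only [Finset.mem_finsuppAntidiag, Finset.subset_univ, and_true, Finsupp.degree_eq_sum]

theorem finrank_gap_eq_ncard (c k : ℕ) :
    Module.finrank ℂ ↥(Subalgebra.toSubmodule (gapAlg (gp r s c)) ⊓ symComp r s k) =
      (gapPairs c (r + 1) (s + 1) k).ncard := by
  have hfin := gapPairs_finite c (r + 1) (s + 1) k
  have := hfin.fintype
  choose rep hrep using fun τ : gapPairs c (r + 1) (s + 1) k => exists_cl_eq τ.2.1 τ.2.2.1
  let φ : ↥(Subalgebra.toSubmodule (gapAlg (gp r s c)) ⊓ symComp r s k) →ₗ[ℂ]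
      (gapPairs c (r + 1) (s + 1) k → ℂ) :=
    LinearMap.pi fun τ => lcoeff ℂ (rep τ) ∘ₗ Submodule.subtype _
  have hφ : ∀ f τ, φ f τ = coeff (rep τ) f.1 := fun _ _ => rfl
  have hb : Function.Bijective φ := by
    constructor
    · rw [injective_iff_map_eq_zero]
      intro f hf
      refine Subtype.ext (MvPolynomial.ext _ _ fun ν => ?_)
      by_contra hν
      have h1 : ν ∈ f.1.support := mem_support_iff.2 hν
      have h2 : ν.degree = k := by
        rw [Finsupp.degree_eq_weight_one]
        exact f.2.2.2 hν
      have h3 := cl_mem_gapPairs h2 (f.2.1 ν h1)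
      apply hν
      have h4 := congrFun hf ⟨_, h3⟩
      rw [hφ] at h4
      rw [← coeff_eq_of_cl_eq f.2.2.1 (hrep ⟨_, h3⟩), h4]
      rfl
    · intro ψ
      let ψ' : Multiset ℕ × Multiset ℕ → ℂ := Function.extend Subtype.val ψ 0
      have hc : ∀ ν, coeff ν (clSum (r := r) (s := s) k ψ') =
          if ν.degree = k then ψ' (cl ν) else 0 := coeff_clSum k ψ'
      have hs : ∀ ν, coeff ν (clSum (r := r) (s := s) k ψ') ≠ 0 →
          cl ν ∈ gapPairs c (r + 1) (s + 1) k := by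
        intro ν hν
        by_contra h
        apply hν
        rw [hc]
        split_ifs
        · exact Function.extend_apply' _ _ _ fun ⟨τ, hτ⟩ => h (hτ ▸ τ.2)
        · rfl
      refine ⟨⟨clSum k ψ', ?_, ?_, ?_⟩, ?_⟩
      · intro ν hν
        exact (gap_of_cl_mem (hs ν (mem_support_iff.1 hν))).2
      · intro p
        ext ν
        rw [coeff_act_symm, hc, hc, cl_mapDomain]
        congr 2
        rw [Finsupp.degree_mapDomain]
      · intro ν hν
        have := (gap_of_cl_mem (hs ν hν)).1
        rwa [Finsupp.degree_eq_weight_one] at this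
      · funext τ
        rw [hφ, hc, hrep, if_pos (gap_of_cl_mem (c := c) (by rw [hrep]; exact τ.2)).1]
        exact Subtype.val_injective.extend_apply _ _ _
  rw [(LinearEquiv.ofBijective φ hb).finrank_eq, Module.finrank_fintype_fun_eq_card,
    ← Nat.card_eq_fintype_card]
  rfl

theorem finrank_symComp (k : ℕ) :
    Module.finrank ℂ (symComp r s k) = (gapPairs 1 (r + 1) (s + 1) k).ncard := by
  rw [← finrank_gap_eq_ncard]
  congr 2
  all_goals
    refine (inf_eq_right.2 fun f _ => ?_).symm
    refine gapAlg_of_le_one ?_ f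
    rintro (j | l) <;> exact le_rfl

theorem hilbX_eq_of_finrank {M : Submodule ℂ (Rxrs r s)} (h : ∀ k,
    Module.finrank ℂ (compX r s M k) + Module.finrank ℂ (shiftComp r s k) =
      Module.finrank ℂ (gapComp r s k)) :
    hilbX r s M = gapGF 1 (r + 1) * gapGF (r + 2) (s + 1) -
      PowerSeries.X ^ (2 * (r + 1) * (s + 1)) * (gapGF 1 (r + 1) * gapGF 1 (s + 1)) := by
  rw [← mk_ncard_gapPairs, ← mk_ncard_gapPairs]
  ext k
  rw [hilbX, PowerSeries.coeff_mk, map_sub, PowerSeries.coeff_mk, PowerSeries.coeff_X_pow_mul',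
    PowerSeries.coeff_mk, ← finrank_gap_eq_ncard]
  have h1 : (Module.finrank ℂ (shiftComp r s k) : ℚ) =
      if 2 * (r + 1) * (s + 1) ≤ k then
        ((gapPairs 1 (r + 1) (s + 1) (k - 2 * (r + 1) * (s + 1))).ncard : ℚ) else 0 := by
    by_cases hk : 2 * (r + 1) * (s + 1) ≤ k
    · rw [shiftComp, if_pos hk, if_pos hk, finrank_symComp]
    · rw [shiftComp, if_neg hk, if_neg hk, finrank_bot, Nat.cast_zero]
  rw [← h1, eq_sub_iff_add_eq]
  exact_mod_cast h k

end

/-- For `r, s ≥ 1` and all `a` outside some countable subset of `ℂ`, the algebra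
`A_{r,s,a}` is Cohen–Macaulay (it is a free module of finite rank over its polynomial
subalgebra `ℂ[P_1,...,P_{r+s+1}]`), and its Hilbert series equals
`h_{r+1,s+1}(u) − u^{2(r+1)(s+1)}/((u;u)_{r+1}(u;u)_{s+1})`, i.e.
`H(u)·(u;u)_{r+1}·(u;u)_{s+1} = Σ_{i=0}^{s+1} u^{i(r+2)} Π_{k=i+1}^{s+1}(1-u^k) − u^{2(r+1)(s+1)}`. -/
theorem Ars_CM_generic (r s : ℕ) (hr : 1 ≤ r) (hs : 1 ≤ s) :
    ∃ E : Set ℂ, E.Countable ∧ ∀ a : ℂ, a ∉ E →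
      Module.Finite ↥(BA r s a) ↥(ArsMod r s a) ∧
      Module.Free ↥(BA r s a) ↥(ArsMod r s a) ∧
      hilbX r s (Subalgebra.toSubmodule (Ars r s a)) * (uu (r + 1) * uu (s + 1)) =
        (∑ i ∈ Finset.range (s + 2), PowerSeries.X ^ (i * (r + 2)) *
          ∏ k ∈ Finset.Ico i (s + 1), (1 - PowerSeries.X ^ (k + 1))) -
          PowerSeries.X ^ (2 * (r + 1) * (s + 1)) := by
  obtain ⟨E, hE, h⟩ := exists_generic r s
  refine ⟨E, hE, fun a ha => ⟨(h a ha).1, (h a ha).2.1, ?_⟩⟩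
  rw [hilbX_eq_of_finrank (h a ha).2.2, ← gapGF_mul (by omega) (s + 1)]
  linear_combination (gapGF (r + 2) (s + 1) * uu (s + 1) -
    PowerSeries.X ^ (2 * (r + 1) * (s + 1)) * (gapGF 1 (s + 1) * uu (s + 1))) *
      gapGF_one_mul (r + 1) -
    PowerSeries.X ^ (2 * (r + 1) * (s + 1)) * gapGF_one_mul (s + 1)
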